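/- arXiv:2605.21853 — 3 statements merged into one kernel-verified Lean document; each statement's English description precedes it below -/
import Mathlib

section
/- Let A^(0), A^(1) ∈ (0,∞)^E, let μ_s := μ_{v0,A^(s)}, let P_s^(T) be the ERRW trajectory law on V^{T+1} with initial weights A^(s), for s ∈ {0,1}, and set Gap_T := D(μ_0 ‖ μ_1) − D(P_0^(T) ‖ P_1^(T)). Let δ_e := a_e^(1) − a_e^(0) and ā := min_{e∈E} min{a_e^(0), a_e^(1)}. Then for every T ≥ 1: Gap_T ≤ (1/2) Σ_{e∈E} δ_e² · E_{P_0^(T)}[ 1/(N_e + ā) + 1/(N_e + ā)² ], and consequently Gap_T ≤ (1/2)(1 + 1/ā) Σ_{e∈E} δ_e² · E_{P_0^(T)}[ 1/(N_e + ā) ], where N_e is the undirected traversal count of edge e along the trajectory. -/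
open MeasureTheory Real Filter
open scoped ENNReal NNReal Classical BigOperators

noncomputable section

namespace ERRW

variable {V : Type*} [Fintype V] [DecidableEq V]

/-- Total weight at a vertex: sum of the edge weights over the edges incident to `i`. -/
def vw (G : SimpleGraph V) [DecidableRel G.Adj] (w : Sym2 V → ℝ) (i : V) : ℝ :=
  ∑ j ∈ G.neighborFinset i, w s(i, j)

/-- Product of a vertex function over the two endpoints of an unordered pair. -/
def sprod (f : V → ℝ) : Sym2 V → ℝ :=
  Sym2.lift ⟨fun i j => f i * f j, fun i j => mul_comm _ _⟩

/-- Sum of a vertex function over the two endpoints of an unordered pair. -/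
def ssum (f : V → ℝ) : Sym2 V → ℝ :=
  Sym2.lift ⟨fun i j => f i + f j, fun i j => add_comm _ _⟩

/-- Quenched transition probability `p_{ij}(w) = w_{ij}/w_i`. -/
def qstep (G : SimpleGraph V) [DecidableRel G.Adj] (w : Sym2 V → ℝ) (i j : V) : ℝ :=
  if G.Adj i j then w s(i, j) / vw G w i else 0

/-- Stationary distribution `π_i(w) = w_i / Σ_v w_v` of the quenched chain. -/
def statDist (G : SimpleGraph V) [DecidableRel G.Adj] (w : Sym2 V → ℝ) (i : V) : ℝ :=
  vw G w i / ∑ v : V, vw G w v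

/-- Spanning trees of `G`, as edge sets. -/
def spanningTrees (G : SimpleGraph V) [DecidableRel G.Adj] : Finset (Finset (Sym2 V)) :=
  G.edgeFinset.powerset.filter fun F =>
    (SimpleGraph.fromEdgeSet (F : Set (Sym2 V))).IsTree

/-- Spanning-tree polynomial `τ(w) = Σ_{T} Π_{e ∈ T} w_e`. -/
def tau (G : SimpleGraph V) [DecidableRel G.Adj] (w : Sym2 V → ℝ) : ℝ :=
  ∑ F ∈ spanningTrees G, ∏ e ∈ F, w e

/-- Vertex parameter `b_v = (B_v + 1 - 𝟙(v = x))/2`. -/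
def bwt (G : SimpleGraph V) [DecidableRel G.Adj] (x : V) (B : Sym2 V → ℝ) (v : V) : ℝ :=
  (vw G B v + 1 - if v = x then 1 else 0) / 2

/-- The normalizing constant `Z_{x,B}` of the magic formula. -/
def Znorm (G : SimpleGraph V) [DecidableRel G.Adj] (x : V) (B : Sym2 V → ℝ) : ℝ :=
  ((∏ e ∈ G.edgeFinset, Real.Gamma (B e)) /
      ∏ v : V, Real.Gamma (bwt G x B v)) *
    Real.pi ^ (((Fintype.card V : ℝ) - 1) / 2) /
    2 ^ ((1 : ℝ) - (Fintype.card V : ℝ) + ∑ e ∈ G.edgeFinset, B e)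

/-- The magic-formula density of `μ_{x,B}` with respect to `Π_{e ≠ e0} dw_e`. -/
def magicDensity (G : SimpleGraph V) [DecidableRel G.Adj] (x : V) (B : Sym2 V → ℝ)
    (w : Sym2 V → ℝ) : ℝ :=
  (Znorm G x B)⁻¹ * (vw G w x) ^ ((1 : ℝ) / 2) *
      (∏ e ∈ G.edgeFinset, w e ^ (B e - 1)) /
      (∏ v : V, (vw G w v) ^ ((vw G B v + 1) / 2)) *
    Real.sqrt (tau G w)

/-- Coordinates indexed by the non-reference edges. -/
abbrev Epin (G : SimpleGraph V) [DecidableRel G.Adj] (e0 : Sym2 V) :=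
  {e : Sym2 V // e ∈ G.edgeFinset ∧ e ≠ e0}

/-- Extension of non-reference edge coordinates to a pinned environment (`w_{e0} = 1`). -/
def pinExt (G : SimpleGraph V) [DecidableRel G.Adj] (e0 : Sym2 V)
    (u : Epin G e0 → ℝ) : Sym2 V → ℝ :=
  fun e => if e = e0 then 1 else if h : e ∈ G.edgeFinset ∧ e ≠ e0 then u ⟨e, h⟩ else 0

/-- The mixing measure `μ_{x,B}` of the magic formula, as a measure on
environments pinned at the reference edge `e0`. -/
def mixing (G : SimpleGraph V) [DecidableRel G.Adj] (e0 : Sym2 V) (x : V) (B : Sym2 V → ℝ) :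
    Measure (Sym2 V → ℝ) :=
  Measure.map (pinExt G e0)
    ((volume : Measure (Epin G e0 → ℝ)).withDensity fun u =>
      ENNReal.ofReal
        (if ∀ e ∈ G.edgeFinset, 0 < pinExt G e0 u e then
          magicDensity G x B (pinExt G e0 u) else 0))

/-- Kullback–Leibler divergence (natural logarithm), `+∞` if `P` is not
absolutely continuous with respect to `Q`. -/
def KL {Ω : Type*} [MeasurableSpace Ω] (P Q : Measure Ω) : EReal :=
  if P ≪ Q then ((∫ x, Real.log (P.rnDeriv Q x).toReal ∂P : ℝ) : EReal) else ⊤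

/-- Edge local time (current edge weight) at time `t` along a path. -/
def localTime (a : Sym2 V → ℝ) (x : ℕ → V) (t : ℕ) (e : Sym2 V) : ℝ :=
  a e + ((Finset.range t).filter fun k => s(x k, x (k + 1)) = e).card

/-- One-step ERRW conditional probability at time `t` given the past of the path. -/
def errwStep (G : SimpleGraph V) [DecidableRel G.Adj] (a : Sym2 V → ℝ) (x : ℕ → V)
    (t : ℕ) : ℝ :=
  if G.Adj (x t) (x (t + 1)) then
    localTime a x t s(x t, x (t + 1)) /
      ∑ u ∈ G.neighborFinset (x t), localTime a x t s(x t, u)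
  else 0

/-- Extension of a finite path to ℕ (junk value `v0` beyond time `T`). -/
def extendPath {T : ℕ} (v0 : V) (x : Fin (T + 1) → V) : ℕ → V :=
  fun t => if h : t < T + 1 then x ⟨t, h⟩ else v0

/-- ERRW trajectory probability of a length-`T` path (the trajectory law mass function). -/
def errwProb (G : SimpleGraph V) [DecidableRel G.Adj] (v0 : V) (a : Sym2 V → ℝ) (T : ℕ)
    (x : Fin (T + 1) → V) : ℝ :=
  if x 0 = v0 then ∏ t ∈ Finset.range T, errwStep G a (extendPath v0 x) t else 0

/-- Undirected traversal count `N_e` of an edge along a finite path. -/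
def edgeCount {T : ℕ} (v0 : V) (x : Fin (T + 1) → V) (e : Sym2 V) : ℕ :=
  ((Finset.range T).filter fun k =>
    s(extendPath v0 x k, extendPath v0 x (k + 1)) = e).card

/-- Quenched path probability of a length-`T` path started at `v0`. -/
def quenchedProb (G : SimpleGraph V) [DecidableRel G.Adj] (v0 : V) (w : Sym2 V → ℝ) (T : ℕ)
    (x : Fin (T + 1) → V) : ℝ :=
  if x 0 = v0 then
    ∏ t ∈ Finset.range T, qstep G w (extendPath v0 x t) (extendPath v0 x (t + 1))
  else 0

/-- The measure on a finite type determined by a mass function. -/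
def discreteMeasure {Ω : Type*} [Fintype Ω] [MeasurableSpace Ω] (p : Ω → ℝ) : Measure Ω :=
  ∑ x : Ω, ENNReal.ofReal (p x) • Measure.dirac x

/-- Digamma function `Ψ = (log Γ)'`. -/
def digamma (x : ℝ) : ℝ := deriv (fun y => Real.log (Real.Gamma y)) x

/-- Trigamma function `Ψ₁ = Ψ'`. -/
def trigamma (x : ℝ) : ℝ := deriv digamma x

/-- `Λ(p,q) = log Γ(q) − log Γ(p) − (q−p)·Ψ(p)`. -/
def Lam (p q : ℝ) : ℝ :=
  Real.log (Real.Gamma q) - Real.log (Real.Gamma p) - (q - p) * digamma p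

set_option linter.unusedSectionVars false

/-! ### The weighted matrix-tree theorem -/

/-- The extension by `x ↦ x` of a map defined off the root `x`. -/
def rootedMap {x : V} (f : {v : V // v ≠ x} → V) (v : V) : V :=
  if h : v ≠ x then f ⟨v, h⟩ else x

lemma rootedMap_coe {x : V} (f : {v : V // v ≠ x} → V) (i : {v : V // v ≠ x}) :
    rootedMap f i = f i := by
  simp [rootedMap, i.2]

/-- All orbits of the rooted map end in the root. -/
def ReachesRoot {x : V} (f : {v : V // v ≠ x} → V) : Prop :=
  ∀ v, ∃ n, (rootedMap f)^[n] v = x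

/-- The matrix `1 - P_f`, where `P_f` is the transition matrix of `f` killed at the root. -/
def funcMatrix {x : V} (f : {v : V // v ≠ x} → V) :
    Matrix {v : V // v ≠ x} {v : V // v ≠ x} ℝ :=
  Matrix.of fun i j => (if i = j then 1 else 0) - (if f i = j.1 then 1 else 0)

lemma det_funcMatrix_of_not_reachesRoot {x : V} (f : {v : V // v ≠ x} → V)
    (hf : ¬ ReachesRoot f) : (funcMatrix f).det = 0 := by
  rw [← Matrix.exists_mulVec_eq_zero_iff]
  unfold ReachesRoot at hf
  push Not at hf
  obtain ⟨v, hv⟩ := hf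
  have hvx : v ≠ x := fun h => hv 0 (by simpa using h)
  refine ⟨fun i => if ∃ n, (rootedMap f)^[n] i = x then 0 else 1, ?_, ?_⟩
  · intro h
    have := congrFun h ⟨v, hvx⟩
    simp [hv] at this
  · ext i
    have key : (∃ n, (rootedMap f)^[n] (f i) = x) ↔ ∃ n, (rootedMap f)^[n] i = x := by
      constructor
      · rintro ⟨n, hn⟩
        exact ⟨n + 1, by rw [Function.iterate_succ_apply, rootedMap_coe]; exact hn⟩
      · rintro ⟨n, hn⟩
        cases n with
        | zero => exact absurd hn i.2
        | succ n => exact ⟨n, by rwa [Function.iterate_succ_apply, rootedMap_coe] at hn⟩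
    simp only [Matrix.mulVec, dotProduct, funcMatrix, Matrix.of_apply, sub_mul,
      Finset.sum_sub_distrib, ite_mul, one_mul, zero_mul, Finset.sum_ite_eq, Finset.mem_univ,
      if_true, Pi.zero_apply]
    by_cases hx : f i = x
    · have h1 : ∃ n, (rootedMap f)^[n] i = x := key.1 ⟨0, by simpa using hx⟩
      have h2 : ∀ j : {v : V // v ≠ x}, f i ≠ j.1 := fun j h => j.2 (h ▸ hx)
      simp [h1, h2]
    · rw [Finset.sum_eq_single_of_mem (⟨f i, hx⟩ : {v : V // v ≠ x}) (Finset.mem_univ _)]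
      · simp only [if_true]
        simp only [key, sub_self]
      · intro j _ hj
        rw [if_neg]
        intro h
        exact hj (Subtype.ext h.symm)

lemma det_funcMatrix_of_reachesRoot {x : V} (f : {v : V // v ≠ x} → V)
    (hf : ReachesRoot f) : (funcMatrix f).det = 1 := by
  let d : {v : V // v ≠ x} → ℕ := fun i => Nat.find (hf i)
  have hd : ∀ i j : {v : V // v ≠ x}, f i = j.1 → d j < d i := by
    intro i j h
    have h1 : (rootedMap f)^[d i] i = x := Nat.find_spec (hf i)
    have h0 : d i ≠ 0 := by
      intro h0
      rw [h0] at h1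
      exact i.2 h1
    obtain ⟨m, hm⟩ := Nat.exists_eq_succ_of_ne_zero h0
    rw [hm, Function.iterate_succ_apply, rootedMap_coe, h] at h1
    have : d j ≤ m := Nat.find_min' (hf j) h1
    omega
  have hT : (funcMatrix f).BlockTriangular (fun i => OrderDual.toDual (d i)) := by
    intro i j hij
    have hij' : d i < d j := hij
    have h1 : i ≠ j := by rintro rfl; exact lt_irrefl _ hij'
    have h2 : f i ≠ j.1 := fun h => by have := hd i j h; omega
    simp [funcMatrix, h1, h2]
  rw [hT.det]
  refine Finset.prod_eq_one fun a _ => ?_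
  have : (funcMatrix f).toSquareBlock (fun i => OrderDual.toDual (d i)) a = 1 := by
    ext i j
    have h2 : f i.1 ≠ j.1.1 := fun h => by
      have := hd i.1 j.1 h
      have h3 : d i.1 = d j.1 := (OrderDual.toDual.injective (i.2.trans j.2.symm))
      omega
    simp [Matrix.toSquareBlock, Matrix.toSquareBlockProp, funcMatrix, h2, Matrix.one_apply,
      Subtype.ext_iff]
  rw [this, Matrix.det_one]

/-- The Laplacian of the weights `w` on the edges of `G`, with the root removed. -/
def rootedLap (G : SimpleGraph V) [DecidableRel G.Adj] (x : V) (w : Sym2 V → ℝ) :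
    Matrix {v : V // v ≠ x} {v : V // v ≠ x} ℝ :=
  Matrix.of fun i j => (if i = j then vw G w i else 0) -
    (if G.Adj i.1 j.1 then w s(i.1, j.1) else 0)

lemma vw_eq_sum (G : SimpleGraph V) [DecidableRel G.Adj] (w : Sym2 V → ℝ) (i : V) :
    vw G w i = ∑ j, if G.Adj i j then w s(i, j) else 0 := by
  rw [vw, ← Finset.sum_filter]
  congr 1
  ext j
  simp

lemma det_rootedLap (G : SimpleGraph V) [DecidableRel G.Adj] (x : V) (w : Sym2 V → ℝ) :
    (rootedLap G x w).det = ∑ f : {v : V // v ≠ x} → V,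
      (∏ i, if G.Adj i.1 (f i) then w s(i.1, f i) else 0) * (funcMatrix f).det := by
  have hrow : (rootedLap G x w) = fun i : {v : V // v ≠ x} => ∑ k : V,
      (if G.Adj i.1 k then w s(i.1, k) else 0) •
        (fun j : {v : V // v ≠ x} =>
          ((if i = j then 1 else 0) - (if k = j.1 then 1 else 0) : ℝ)) := by
    funext i j
    rw [Finset.sum_apply]
    simp only [rootedLap, Matrix.of_apply, Pi.smul_apply, smul_eq_mul, mul_sub,
      Finset.sum_sub_distrib, mul_ite, mul_one, mul_zero, Finset.sum_ite_eq', Finset.mem_univ,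
      if_true]
    congr 1
    split_ifs with h
    · rw [vw_eq_sum]
    · simp
  change Matrix.detRowAlternating.toMultilinearMap (rootedLap G x w) = _
  rw [hrow, MultilinearMap.map_sum]
  refine Finset.sum_congr rfl fun f _ => ?_
  rw [MultilinearMap.map_smul_univ]
  rfl

/-- The edges `{i, f i}` of the functional graph of `f`. -/
def funcEdges {x : V} (f : {v : V // v ≠ x} → V) : Finset (Sym2 V) :=
  Finset.univ.image fun i : {v : V // v ≠ x} => s(i.1, f i)

lemma ReachesRoot.no_two_cycle {x : V} {f : {v : V // v ≠ x} → V} (hf : ReachesRoot f)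
    (i j : {v : V // v ≠ x}) (h1 : f i = j.1) (h2 : f j = i.1) : False := by
  obtain ⟨n, hn⟩ := hf i
  have : ∀ n, (rootedMap f)^[n] i = i.1 ∨ (rootedMap f)^[n] i = j.1 := by
    intro n
    induction n with
    | zero => exact Or.inl rfl
    | succ n ih =>
      rw [Function.iterate_succ_apply']
      rcases ih with h | h <;> rw [h, rootedMap_coe]
      · exact Or.inr h1
      · exact Or.inl h2
  rcases this n with h | h
  · exact i.2 (h.symm.trans hn)
  · exact j.2 (h.symm.trans hn)

lemma ReachesRoot.edge_injective {x : V} {f : {v : V // v ≠ x} → V} (hf : ReachesRoot f) :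
    Function.Injective fun i : {v : V // v ≠ x} => s(i.1, f i) := by
  intro i j h
  rcases Sym2.eq_iff.1 h with h | h
  · exact Subtype.ext h.1
  · exact (hf.no_two_cycle i j h.2 h.1.symm).elim

lemma ReachesRoot.eq_of_funcEdges_eq {x : V} {f g : {v : V // v ≠ x} → V} (hf : ReachesRoot f)
    (h : funcEdges f = funcEdges g) : f = g := by
  have key : ∀ n, ∀ i : {v : V // v ≠ x}, (rootedMap f)^[n] i = x → g i = f i := by
    intro n
    induction n with
    | zero => intro i hi; exact absurd hi i.2
    | succ n ih =>
      intro i hi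
      have hmem : s(i.1, f i) ∈ funcEdges g := h ▸ Finset.mem_image_of_mem _ (Finset.mem_univ i)
      obtain ⟨j, -, hj⟩ := Finset.mem_image.1 hmem
      rcases Sym2.eq_iff.1 hj with h' | h'
      · have : j = i := Subtype.ext h'.1
        exact this ▸ h'.2
      · have hj' : (rootedMap f)^[n] j = x := by
          rw [Function.iterate_succ_apply, rootedMap_coe] at hi
          rw [h'.1]; exact hi
        have := ih j hj'
        exact (hf.no_two_cycle i j h'.1.symm (this.symm.trans h'.2)).elim
  funext i
  obtain ⟨n, hn⟩ := hf i
  exact (key n i hn).symm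

lemma ReachesRoot.card_funcEdges {x : V} {f : {v : V // v ≠ x} → V} (hf : ReachesRoot f) :
    (funcEdges f).card + 1 = Fintype.card V := by
  rw [funcEdges, Finset.card_image_of_injective _ hf.edge_injective, Finset.card_univ]
  have := Fintype.card_subtype_compl (fun v : V => v = x)
  have hpos : 0 < Fintype.card V := Fintype.card_pos_iff.2 ⟨x⟩
  simp only [Fintype.card_subtype_eq] at this
  rw [this]
  omega

lemma nat_card_edgeSet_fromEdgeSet {G : SimpleGraph V} [DecidableRel G.Adj] {F : Finset (Sym2 V)}
    (hF : F ⊆ G.edgeFinset) :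
    Nat.card (SimpleGraph.fromEdgeSet (F : Set (Sym2 V))).edgeSet = F.card := by
  have : (SimpleGraph.fromEdgeSet (F : Set (Sym2 V))).edgeSet = (F : Set (Sym2 V)) := by
    rw [SimpleGraph.edgeSet_fromEdgeSet]
    ext e
    simp only [Set.mem_sdiff, Finset.mem_coe, and_iff_left_iff_imp]
    intro he
    exact G.not_isDiag_of_mem_edgeFinset (hF he)
  rw [this]
  simp

lemma ReachesRoot.funcEdges_mem_spanningTrees (G : SimpleGraph V) [DecidableRel G.Adj] {x : V}
    {f : {v : V // v ≠ x} → V} (hf : ReachesRoot f) (hadj : ∀ i, G.Adj i.1 (f i)) :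
    funcEdges f ∈ spanningTrees G := by
  have hsub : funcEdges f ⊆ G.edgeFinset := by
    intro e he
    obtain ⟨i, -, rfl⟩ := Finset.mem_image.1 he
    simpa using hadj i
  rw [spanningTrees, Finset.mem_filter, Finset.mem_powerset]
  refine ⟨hsub, ?_⟩
  rw [SimpleGraph.isTree_iff_connected_and_card]
  refine ⟨?_, ?_⟩
  · rw [SimpleGraph.connected_iff_exists_forall_reachable]
    refine ⟨x, fun v => ?_⟩
    obtain ⟨n, hn⟩ := hf v
    induction n generalizing v with
    | zero =>
      rw [show v = x from hn]
    | succ n ih =>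
      by_cases hv : v = x
      · rw [hv]
      · have h1 := ih _ hn
        refine h1.trans (SimpleGraph.Adj.reachable ?_)
        rw [SimpleGraph.fromEdgeSet_adj]
        have h2 : rootedMap f v = f ⟨v, hv⟩ := rootedMap_coe f ⟨v, hv⟩
        rw [h2]
        refine ⟨?_, (hadj ⟨v, hv⟩).ne'⟩
        rw [Sym2.eq_swap]
        exact Finset.mem_coe.2 (Finset.mem_image.2 ⟨⟨v, hv⟩, Finset.mem_univ _, rfl⟩)
  · rw [nat_card_edgeSet_fromEdgeSet hsub, hf.card_funcEdges, Nat.card_eq_fintype_card]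

lemma exists_funcEdges_eq (G : SimpleGraph V) [DecidableRel G.Adj] (x : V)
    {F : Finset (Sym2 V)} (hF : F ∈ spanningTrees G) :
    ∃ f : {v : V // v ≠ x} → V, ReachesRoot f ∧ (∀ i, G.Adj i.1 (f i)) ∧ funcEdges f = F := by
  rw [spanningTrees, Finset.mem_filter, Finset.mem_powerset] at hF
  obtain ⟨hsub, hT⟩ := hF
  set H := SimpleGraph.fromEdgeSet (F : Set (Sym2 V)) with hH
  have hcard := (SimpleGraph.isTree_iff_connected_and_card.1 hT).2
  have hconn := hT.connected
  have step : ∀ i : {v : V // v ≠ x}, ∃ k, H.Adj i.1 k ∧ H.dist k x < H.dist i.1 x := by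
    intro i
    obtain ⟨i, hi⟩ := i
    obtain ⟨p, hp⟩ := (hconn i x).exists_walk_length_eq_dist
    cases p with
    | nil => exact absurd rfl hi
    | cons h q =>
      refine ⟨_, h, ?_⟩
      have := SimpleGraph.dist_le q
      rw [SimpleGraph.Walk.length_cons] at hp
      simp only
      omega
  choose f hf hfd using step
  have hreach : ReachesRoot f := by
    have : ∀ n v, H.dist v x = n → ∃ n, (rootedMap f)^[n] v = x := by
      intro n
      induction n using Nat.strong_induction_on with
      | _ n ih =>
        intro v hv
        by_cases hvx : v = x
        · exact ⟨0, hvx⟩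
        · obtain ⟨m, hm⟩ := ih _ (hv ▸ hfd ⟨v, hvx⟩) (f ⟨v, hvx⟩) rfl
          refine ⟨m + 1, ?_⟩
          rw [Function.iterate_succ_apply]
          have h2 : rootedMap f v = f ⟨v, hvx⟩ := rootedMap_coe f ⟨v, hvx⟩
          rw [h2, hm]
    exact fun v => this _ v rfl
  have hFm : ∀ i, s(i.1, f i) ∈ F := fun i => by
    have := hf i
    rw [hH, SimpleGraph.fromEdgeSet_adj] at this
    exact this.1
  refine ⟨f, hreach, fun i => by simpa using hsub (hFm i), ?_⟩
  apply Finset.eq_of_subset_of_card_le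
  · intro e he
    obtain ⟨i, -, rfl⟩ := Finset.mem_image.1 he
    exact hFm i
  · rw [nat_card_edgeSet_fromEdgeSet hsub, Nat.card_eq_fintype_card] at hcard
    have := hreach.card_funcEdges
    omega

/-- The weighted matrix-tree theorem. -/
theorem tau_eq_det (G : SimpleGraph V) [DecidableRel G.Adj] (x : V) (w : Sym2 V → ℝ) :
    tau G w = (rootedLap G x w).det := by
  rw [det_rootedLap, tau]
  symm
  refine Finset.sum_bij_ne_zero (fun f _ _ => funcEdges f) ?_ ?_ ?_ ?_
  · intro f _ hf
    have h1 : ReachesRoot f := by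
      by_contra h
      exact hf (by rw [det_funcMatrix_of_not_reachesRoot f h, mul_zero])
    refine h1.funcEdges_mem_spanningTrees G fun i => ?_
    by_contra h
    exact hf (by rw [Finset.prod_eq_zero (Finset.mem_univ i) (if_neg h), zero_mul])
  · intro f _ hf g _ _ h
    have h1 : ReachesRoot f := by
      by_contra h
      exact hf (by rw [det_funcMatrix_of_not_reachesRoot f h, mul_zero])
    exact h1.eq_of_funcEdges_eq h
  · intro F hF hne
    obtain ⟨f, h1, h2, rfl⟩ := exists_funcEdges_eq G x hF
    refine ⟨f, Finset.mem_univ _, ?_, rfl⟩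
    rw [det_funcMatrix_of_reachesRoot f h1, mul_one]
    simp only [h2, if_true]
    rwa [funcEdges, Finset.prod_image h1.edge_injective.injOn] at hne
  · intro f _ hf
    have h1 : ReachesRoot f := by
      by_contra h
      exact hf (by rw [det_funcMatrix_of_not_reachesRoot f h, mul_zero])
    have h2 : ∀ i, G.Adj i.1 (f i) := fun i => by
      by_contra h
      exact hf (by rw [Finset.prod_eq_zero (Finset.mem_univ i) (if_neg h), zero_mul])
    rw [det_funcMatrix_of_reachesRoot f h1, mul_one, funcEdges,
      Finset.prod_image h1.edge_injective.injOn]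
    simp only [h2, if_true]

/-! ### Integrals over the positive orthant -/

/-- Lebesgue measure on the positive half-line. -/
def posMeas : Measure ℝ := volume.restrict (Set.Ioi 0)

instance : SigmaFinite posMeas := by unfold posMeas; infer_instance

lemma ae_posMeas : ∀ᵐ x ∂posMeas, 0 < x := by
  unfold posMeas
  exact ae_restrict_mem measurableSet_Ioi

/-- Lebesgue measure on the positive orthant. -/
def orthant (ι : Type*) [Fintype ι] : Measure (ι → ℝ) := Measure.pi fun _ => posMeas

instance (ι : Type*) [Fintype ι] : SigmaFinite (orthant ι) := by
  unfold orthant; infer_instance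

lemma orthant_eq_restrict (ι : Type*) [Fintype ι] :
    orthant ι = volume.restrict (Set.univ.pi fun _ => Set.Ioi 0) := by
  rw [volume_pi, Measure.restrict_pi_pi]
  rfl

lemma measurableSet_orthant (ι : Type*) [Fintype ι] :
    MeasurableSet (Set.univ.pi fun _ : ι => Set.Ioi (0 : ℝ)) :=
  MeasurableSet.univ_pi fun _ => measurableSet_Ioi

lemma ae_orthant (ι : Type*) [Fintype ι] : ∀ᵐ s ∂orthant ι, ∀ i, 0 < s i := by
  rw [orthant_eq_restrict]
  filter_upwards [ae_restrict_mem (measurableSet_orthant ι)] with s hs i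
  exact hs i (Set.mem_univ i)

lemma lintegral_posMeas_scale {c : ℝ} (hc : 0 < c) (f : ℝ → ℝ≥0∞) :
    ∫⁻ x, f x ∂posMeas = ENNReal.ofReal c * ∫⁻ x, f (c * x) ∂posMeas := by
  have himg : (fun x : ℝ => c * x) '' Set.Ioi 0 = Set.Ioi 0 := by
    ext y
    simp only [Set.mem_image, Set.mem_Ioi]
    constructor
    · rintro ⟨x, hx, rfl⟩; positivity
    · intro hy
      exact ⟨y / c, by positivity, by field_simp⟩
  unfold posMeas
  conv_lhs => rw [← himg]
  rw [lintegral_image_eq_lintegral_abs_deriv_mul (f' := fun _ => c) measurableSet_Ioi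
    (fun x _ => by simpa using ((hasDerivAt_id x).const_mul c).hasDerivWithinAt)
    (fun x _ y _ h => mul_left_cancel₀ hc.ne' h)]
  rw [lintegral_const_mul' _ _ ENNReal.ofReal_ne_top, abs_of_pos hc]

lemma lintegral_orthant_scale {ι : Type*} [Fintype ι] {c : ι → ℝ} (hc : ∀ i, 0 < c i)
    {f : (ι → ℝ) → ℝ≥0∞} (hf : Measurable f) :
    ∫⁻ x, f x ∂orthant ι = ENNReal.ofReal (∏ i, c i) * ∫⁻ x, f (fun i => c i * x i) ∂orthant ι := by
  have hdet : (Matrix.diagonal c).det = ∏ i, c i := Matrix.det_diagonal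
  have hpos : 0 < ∏ i, c i := Finset.prod_pos fun i _ => hc i
  have hmap := Real.smul_map_diagonal_volume_pi (D := c) (by rw [hdet]; exact hpos.ne')
  rw [hdet, abs_of_pos hpos] at hmap
  have hS := measurableSet_orthant ι
  rw [orthant_eq_restrict, ← lintegral_indicator hS, ← lintegral_indicator hS]
  conv_lhs => rw [← hmap]
  have hlin : ⇑(Matrix.toLin' (Matrix.diagonal c)) = fun x i => c i * x i := by
    funext x i
    simp [Matrix.toLin'_apply, Matrix.mulVec_diagonal]
  rw [hlin, lintegral_smul_measure, lintegral_map (hf.indicator hS) (by fun_prop), smul_eq_mul]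
  congr 2
  funext x
  have : (fun i => c i * x i) ∈ (Set.univ.pi fun _ : ι => Set.Ioi (0 : ℝ)) ↔
      x ∈ (Set.univ.pi fun _ : ι => Set.Ioi (0 : ℝ)) := by
    simp [hc]
  by_cases hx : x ∈ (Set.univ.pi fun _ : ι => Set.Ioi (0 : ℝ))
  · rw [Set.indicator_of_mem (this.2 hx), Set.indicator_of_mem hx]
  · rw [Set.indicator_of_notMem (fun h => hx (this.1 h)), Set.indicator_of_notMem hx]

lemma lintegral_orthant_prod {ι : Type*} [Fintype ι] {f : ι → ℝ → ℝ}
    (hf : ∀ i, Integrable (f i) posMeas) (hpos : ∀ i x, 0 < x → 0 ≤ f i x) :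
    ∫⁻ x, ENNReal.ofReal (∏ i, f i (x i)) ∂orthant ι =
      ENNReal.ofReal (∏ i, ∫ x, f i x ∂posMeas) := by
  rw [← integral_fintype_prod_eq_prod, ofReal_integral_eq_lintegral_ofReal]
  · rfl
  · exact Integrable.fintype_prod hf
  · filter_upwards [ae_orthant ι] with x hx
    exact Finset.prod_nonneg fun i _ => hpos i _ (hx i)

/-- The normalization of the reciprocal inverse Gaussian law. -/
lemma lintegral_reciprocal_inverse_gaussian {a : ℝ} (ha : 0 < a) :
    ∫⁻ h, ENNReal.ofReal ((√h)⁻¹ * exp (-(h + a ^ 2 / h) / 2)) ∂posMeas =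
      ENNReal.ofReal (√(2 * π) * exp (-a)) := by
  set K := ∫⁻ h, ENNReal.ofReal ((√h)⁻¹ * exp (-(h + a ^ 2 / h) / 2)) ∂posMeas with hK
  have hinv : K = ∫⁻ h, ENNReal.ofReal (a * (√h)⁻¹ * h⁻¹ * exp (-(h + a ^ 2 / h) / 2))
      ∂posMeas := by
    have himg : (fun x : ℝ => a ^ 2 / x) '' Set.Ioi 0 = Set.Ioi 0 := by
      ext y
      simp only [Set.mem_image, Set.mem_Ioi]
      constructor
      · rintro ⟨x, hx, rfl⟩; positivity
      · intro hy
        exact ⟨a ^ 2 / y, by positivity, by field_simp⟩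
    rw [hK]
    unfold posMeas
    conv_lhs => rw [← himg]
    rw [lintegral_image_eq_lintegral_abs_deriv_mul (f' := fun x => a ^ 2 * (-(x ^ 2)⁻¹))
      measurableSet_Ioi]
    · refine setLIntegral_congr_fun measurableSet_Ioi fun h (hh : 0 < h) => ?_
      rw [← ENNReal.ofReal_mul (abs_nonneg _)]
      congr 1
      have h1 : a ^ 2 / h + a ^ 2 / (a ^ 2 / h) = h + a ^ 2 / h := by field_simp; ring
      have h2 : √(a ^ 2 / h) = a / √h := by
        rw [Real.sqrt_div (sq_nonneg a), Real.sqrt_sq ha.le]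
      have h3 : |a ^ 2 * (-(h ^ 2)⁻¹)| = a ^ 2 / h ^ 2 := by
        rw [mul_neg, abs_neg, abs_of_pos (by positivity)]; rfl
      rw [h1, h2, h3, ← mul_assoc]
      congr 1
      have h4 : √h ≠ 0 := (Real.sqrt_pos.2 hh).ne'
      have h5 : h = √h * √h := (Real.mul_self_sqrt hh.le).symm
      field_simp
      rw [sq, ← h5]
    · intro x hx
      have hx' : x ≠ 0 := ne_of_gt hx
      have := ((hasDerivAt_inv hx').const_mul (a ^ 2)).hasDerivWithinAt (s := Set.Ioi 0)
      simpa [div_eq_mul_inv] using this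
    · intro x hx y hy hxy
      have hx' : x ≠ 0 := ne_of_gt hx
      have hy' : y ≠ 0 := ne_of_gt hy
      simp only at hxy
      field_simp at hxy
      exact hxy.symm
  have hsum : K + K = ENNReal.ofReal (2 * (√(2 * π) * exp (-a))) := by
    have himg : (fun x : ℝ => √x - a / √x) '' Set.Ioi 0 = Set.univ := by
      ext y
      simp only [Set.mem_image, Set.mem_Ioi, Set.mem_univ, iff_true]
      have h1 : |y| < √(y ^ 2 + 4 * a) := by
        rw [← Real.sqrt_sq_eq_abs]
        exact Real.sqrt_lt_sqrt (sq_nonneg y) (by linarith)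
      have h2 : 0 < (y + √(y ^ 2 + 4 * a)) / 2 := by
        have := neg_abs_le y
        linarith
      have h3 : √(y ^ 2 + 4 * a) ^ 2 = y ^ 2 + 4 * a := Real.sq_sqrt (by positivity)
      refine ⟨((y + √(y ^ 2 + 4 * a)) / 2) ^ 2, by positivity, ?_⟩
      rw [Real.sqrt_sq h2.le]
      set r := √(y ^ 2 + 4 * a)
      have h4 : y + r ≠ 0 := by intro h; rw [h] at h2; simp at h2
      field_simp
      nlinarith
    have hgauss : ∫⁻ v : ℝ, ENNReal.ofReal (2 * exp (-a) * exp (-(1 / 2) * v ^ 2)) =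
        ENNReal.ofReal (2 * (√(2 * π) * exp (-a))) := by
      rw [← ofReal_integral_eq_lintegral_ofReal]
      · rw [integral_const_mul, integral_gaussian]
        congr 1
        rw [show π / (1 / 2) = 2 * π by ring]
        ring
      · exact (integrable_exp_neg_mul_sq (by norm_num)).const_mul _
      · exact Eventually.of_forall fun v => by positivity
    rw [← hgauss, ← Measure.restrict_univ (μ := (volume : Measure ℝ)), ← himg,
      lintegral_image_eq_lintegral_abs_deriv_mul
        (f' := fun x => 1 / (2 * √x) + a * ((1 / (2 * √x)) / √x ^ 2)) measurableSet_Ioi]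
    · conv_lhs => rw [hinv]
      nth_rewrite 2 [← hinv]
      rw [hK, ← lintegral_add_left (by fun_prop)]
      unfold posMeas
      refine setLIntegral_congr_fun measurableSet_Ioi fun h (hh : 0 < h) => ?_
      have h4 : 0 < √h := Real.sqrt_pos.2 hh
      have h5 : √h ^ 2 = h := Real.sq_sqrt hh.le
      rw [← ENNReal.ofReal_mul (abs_nonneg _), ← ENNReal.ofReal_add (by positivity) (by positivity),
        abs_of_pos (by positivity), h5]
      congr 1
      have h6 : exp (-(h + a ^ 2 / h) / 2) = exp (-a) * exp (-(1 / 2) * (√h - a / √h) ^ 2) := by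
        rw [← exp_add]
        congr 1
        rw [sub_sq, div_pow, h5]
        field_simp
        ring
      rw [h6]
      field_simp
      ring
    · intro x hx
      have hx' : x ≠ 0 := ne_of_gt hx
      have h4 : √x ≠ 0 := (Real.sqrt_pos.2 hx).ne'
      have h1 := Real.hasDerivAt_sqrt hx'
      have h2 := h1.sub ((h1.inv h4).const_mul a)
      refine HasDerivAt.hasDerivWithinAt ?_
      convert h2 using 1
      · funext y
        simp [div_eq_mul_inv]
      · ring
    · intro x hx y hy hxy
      have hx' : 0 < √x := Real.sqrt_pos.2 hx
      have hy' : 0 < √y := Real.sqrt_pos.2 hy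
      simp only at hxy
      have h3 : (√x - √y) * (1 + a / (√x * √y)) = 0 := by
        field_simp at hxy ⊢
        linarith
      have h4 : √x = √y := by
        rcases mul_eq_zero.1 h3 with h | h
        · linarith
        · have : 0 < 1 + a / (√x * √y) := by positivity
          linarith
      exact (Real.sqrt_inj (le_of_lt hx) (le_of_lt hy)).1 h4
  rw [← two_mul, ENNReal.ofReal_mul (by norm_num), ENNReal.ofReal_ofNat] at hsum
  exact (ENNReal.mul_right_inj (by norm_num) (by norm_num)).1 hsum

/-! ### The normalization of the random-environment density for fixed weights -/

lemma det_eq_mul_det_schur {n : ℕ} (A : Matrix (Fin (n + 1)) (Fin (n + 1)) ℝ) (h : A 0 0 ≠ 0) :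
    A.det = A 0 0 * (Matrix.of fun i j : Fin n =>
      A i.succ j.succ - A i.succ 0 * A 0 j.succ / A 0 0).det := by
  let B : Matrix (Fin (n + 1)) (Fin (n + 1)) ℝ := Matrix.of fun i j =>
    A i j - (if i = 0 then 0 else A i 0 / A 0 0) * A 0 j
  have hAB : A.det = B.det := by
    refine Matrix.det_eq_of_forall_row_eq_smul_add_const
      (fun i => if i = 0 then 0 else A i 0 / A 0 0) 0 (by simp) fun i j => ?_
    simp [B]
  rw [hAB, Matrix.det_succ_column_zero, Fin.sum_univ_succ]
  rw [Finset.sum_eq_zero]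
  · have h1 : B 0 0 = A 0 0 := by simp [B]
    have h2 : B.submatrix (Fin.succAbove 0) Fin.succ = Matrix.of fun i j : Fin n =>
      A i.succ j.succ - A i.succ 0 * A 0 j.succ / A 0 0 := by
      ext i j
      simp [B, Fin.succ_ne_zero]
      ring
    rw [h1, h2]
    simp
  · intro i _
    have : B i.succ 0 = 0 := by
      simp [B, Fin.succ_ne_zero, h]
    rw [this]
    ring

/-- The reduced Laplacian with conductances `M i j / (s i * s j)` and killing `η i / s i`. -/
def envLap {ι : Type*} [Fintype ι] [DecidableEq ι] (M : ι → ι → ℝ) (η s : ι → ℝ) :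
    Matrix ι ι ℝ :=
  Matrix.of fun i j => (if i = j then ∑ k, M i k / (s i * s k) + η i / s i else 0) -
    M i j / (s i * s j)

/-- The unnormalized density of the environment given the weights, the root being pinned. -/
def envDensity {ι : Type*} [Fintype ι] [DecidableEq ι] (M : ι → ι → ℝ) (η s : ι → ℝ) : ℝ :=
  exp (-(∑ i, ∑ j, M i j * (s j / s i) + ∑ i, η i * (s i + 1 / s i)) / 2) *
    √(envLap M η s).det

/-- Every nonempty set of vertices is linked by a positive weight to its complement
or to the root. -/
def LinkedToRoot {ι : Type*} (M : ι → ι → ℝ) (η : ι → ℝ) : Prop :=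
  ∀ S : Set ι, S.Nonempty → (∃ i ∈ S, 0 < η i) ∨ ∃ i ∈ S, ∃ j ∉ S, 0 < M i j

lemma measurable_envDensity {ι α : Type*} [Fintype ι] [DecidableEq ι] [MeasurableSpace α]
    {M : α → ι → ι → ℝ} {η s : α → ι → ℝ} (hM : ∀ i j, Measurable fun x => M x i j)
    (hη : ∀ i, Measurable fun x => η x i) (hs : ∀ i, Measurable fun x => s x i) :
    Measurable fun x => envDensity (M x) (η x) (s x) := by
  unfold envDensity
  have hdet : Measurable fun x => (envLap (M x) (η x) (s x)).det := by
    simp only [Matrix.det_apply, envLap, Matrix.of_apply]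
    refine Finset.measurable_sum _ fun σ _ => ?_
    refine Measurable.const_smul ?_ _
    refine Finset.measurable_prod _ fun i _ => ?_
    refine Measurable.sub ?_ ((hM _ _).div ((hs _).mul (hs _)))
    split_ifs
    · exact (Finset.measurable_sum _ fun k _ => (hM _ _).div ((hs _).mul (hs _))).add
        ((hη _).div (hs _))
    · exact measurable_const
  refine Measurable.mul (Measurable.exp ?_) hdet.sqrt
  refine Measurable.div_const (Measurable.neg (Measurable.add ?_ ?_)) _
  · exact Finset.measurable_sum _ fun i _ => Finset.measurable_sum _ fun j _ =>
      (hM _ _).mul ((hs _).div (hs _))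
  · exact Finset.measurable_sum _ fun i _ => (hη _).mul ((hs _).add ((measurable_const).div (hs _)))

section Elimination

variable {n : ℕ} (M : Fin (n + 1) → Fin (n + 1) → ℝ) (η : Fin (n + 1) → ℝ)

/-- The weights after eliminating vertex `0` by a star-mesh transformation. -/
def elimWeights (h : ℝ) (i j : Fin n) : ℝ :=
  M i.succ j.succ + M i.succ 0 * M 0 j.succ / h

/-- The weights to the root after eliminating vertex `0` by a star-mesh transformation. -/
def elimRoot (h : ℝ) (i : Fin n) : ℝ := η i.succ + M i.succ 0 * η 0 / h

variable {M η}

lemma LinkedToRoot.elim (hM : ∀ i j, 0 ≤ M i j) (hη : ∀ i, 0 ≤ η i)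
    (hl : LinkedToRoot M η) {h : ℝ} (hh : 0 < h) :
    LinkedToRoot (elimWeights M h) (elimRoot M η h) := by
  intro S hS
  have hM' : ∀ i j, M i.succ j.succ ≤ elimWeights M h i j := fun i j => by
    have := mul_nonneg (hM i.succ 0) (hM 0 j.succ)
    have : 0 ≤ M i.succ 0 * M 0 j.succ / h := by positivity
    unfold elimWeights; linarith
  have hη' : ∀ i, η i.succ ≤ elimRoot M η h i := fun i => by
    have := mul_nonneg (hM i.succ 0) (hη 0)
    have : 0 ≤ M i.succ 0 * η 0 / h := by positivity
    unfold elimRoot; linarith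
  rcases hl (Fin.succ '' S) (hS.image _) with ⟨_, ⟨i, hi, rfl⟩, h1⟩ | ⟨_, ⟨i, hi, rfl⟩, j, hj, h1⟩
  · exact Or.inl ⟨i, hi, h1.trans_le (hη' i)⟩
  · induction j using Fin.cases with
    | succ j =>
      refine Or.inr ⟨i, hi, j, fun h => hj ⟨j, h, rfl⟩, h1.trans_le (hM' i j)⟩
    | zero =>
      rcases hl (insert 0 (Fin.succ '' S)) (Set.insert_nonempty _ _) with
        ⟨k, hk, h2⟩ | ⟨k, hk, j, hj, h2⟩
      · rcases hk with rfl | ⟨k, hk, rfl⟩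
        · refine Or.inl ⟨i, hi, ?_⟩
          have : 0 < M i.succ 0 * η 0 / h := by positivity
          have := hη i.succ
          unfold elimRoot; linarith
        · exact Or.inl ⟨k, hk, h2.trans_le (hη' k)⟩
      · induction j using Fin.cases with
        | zero => exact absurd (Set.mem_insert _ _) hj
        | succ j =>
          have hj' : j ∉ S := fun h => hj (Set.mem_insert_of_mem _ ⟨j, h, rfl⟩)
          rcases hk with rfl | ⟨k, hk, rfl⟩
          · refine Or.inr ⟨i, hi, j, hj', ?_⟩
            have : 0 < M i.succ 0 * M 0 j.succ / h := by positivity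
            have := hM i.succ j.succ
            unfold elimWeights; linarith
          · exact Or.inr ⟨k, hk, j, hj', h2.trans_le (hM' k j)⟩

lemma LinkedToRoot.exists_pos_zero (hl : LinkedToRoot M η) :
    0 < η 0 ∨ ∃ k : Fin n, 0 < M 0 k.succ := by
  rcases hl {0} (Set.singleton_nonempty _) with ⟨i, hi, h⟩ | ⟨i, hi, j, hj, h⟩
  · rw [Set.mem_singleton_iff] at hi
    exact Or.inl (hi ▸ h)
  · rw [Set.mem_singleton_iff] at hi hj
    obtain ⟨k, rfl⟩ := Fin.exists_succ_eq.2 hj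
    exact Or.inr ⟨k, hi ▸ h⟩

lemma LinkedToRoot.elim_pos (hM : ∀ i j, 0 ≤ M i j) (hη : ∀ i, 0 ≤ η i)
    (hl : LinkedToRoot M η) {s : Fin n → ℝ} (hs : ∀ i, 0 < s i) :
    0 < ∑ k : Fin n, M 0 k.succ / s k + η 0 := by
  have h0 : ∀ k ∈ Finset.univ, 0 ≤ M 0 (Fin.succ k) / s k := fun k _ =>
    div_nonneg (hM _ _) (hs k).le
  rcases hl.exists_pos_zero with h | ⟨k, h⟩
  · have := Finset.sum_nonneg h0
    linarith
  · have h1 := Finset.single_le_sum h0 (Finset.mem_univ k)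
    have h2 : 0 < M 0 k.succ / s k := div_pos h (hs k)
    have := hη 0
    linarith

lemma det_envLap_cons {s : Fin n → ℝ} (hs : ∀ i, 0 < s i)
    {h A : ℝ} (hh : 0 < h) (hA : A = ∑ k : Fin n, M 0 k.succ / s k + η 0) (hApos : 0 < A) :
    (envLap M η (Fin.cons (h / A) s : Fin (n + 1) → ℝ)).det =
      A ^ 2 / h * (envLap (elimWeights M h) (elimRoot M η h) s).det := by
  have h00 : envLap M η (Fin.cons (h / A) s : Fin (n + 1) → ℝ) 0 0 = A ^ 2 / h := by
    simp only [envLap, Matrix.of_apply, if_true, Fin.sum_univ_succ, Fin.cons_zero, Fin.cons_succ]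
    have : ∑ i : Fin n, M 0 i.succ / (h / A * s i) = (∑ i : Fin n, M 0 i.succ / s i) * (A / h) := by
      rw [Finset.sum_mul]
      refine Finset.sum_congr rfl fun i _ => ?_
      have := (hs i).ne'
      field_simp
    rw [this]
    have h2 : (∑ i : Fin n, M 0 i.succ / s i) = A - η 0 := by rw [hA]; ring
    rw [h2]
    field_simp
    ring
  have hpos : A ^ 2 / h ≠ 0 := by positivity
  rw [det_eq_mul_det_schur _ (by rw [h00]; exact hpos), h00]
  congr 2
  ext i j
  have hsi := (hs i).ne'
  have hsj := (hs j).ne'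
  have e1 : envLap M η (Fin.cons (h / A) s : Fin (n + 1) → ℝ) i.succ 0 =
      - (M i.succ 0 * A / (s i * h)) := by
    simp only [envLap, Matrix.of_apply, Fin.succ_ne_zero, if_false, Fin.cons_zero, Fin.cons_succ]
    field_simp
    ring
  have e2 : envLap M η (Fin.cons (h / A) s : Fin (n + 1) → ℝ) 0 j.succ =
      - (M 0 j.succ * A / (s j * h)) := by
    simp only [envLap, Matrix.of_apply, (Fin.succ_ne_zero _).symm, if_false, Fin.cons_zero,
      Fin.cons_succ]
    field_simp
    ring
  simp only [Matrix.of_apply]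
  rw [e1, e2]
  simp only [envLap, Matrix.of_apply, Fin.succ_inj, Fin.sum_univ_succ, Fin.cons_zero,
    Fin.cons_succ]
  split_ifs with hij
  · have e3 : ∑ k : Fin n, elimWeights M h i k / (s i * s k) =
        ∑ k : Fin n, M i.succ k.succ / (s i * s k) + M i.succ 0 / (s i * h) * (A - η 0) := by
      have : A - η 0 = ∑ k : Fin n, M 0 k.succ / s k := by rw [hA]; ring
      rw [this, Finset.mul_sum, ← Finset.sum_add_distrib]
      refine Finset.sum_congr rfl fun k _ => ?_
      have := (hs k).ne'
      unfold elimWeights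
      field_simp
    rw [e3]
    unfold elimRoot elimWeights
    field_simp
    ring
  · unfold elimWeights
    field_simp
    ring

lemma exponent_cons (hsym : ∀ i j, M i j = M j i) {s : Fin n → ℝ} (hs : ∀ i, 0 < s i)
    {h A : ℝ} (hh : 0 < h) (hA : A = ∑ k : Fin n, M 0 k.succ / s k + η 0) (hApos : 0 < A)
    {t : Fin (n + 1) → ℝ} (ht : t = Fin.cons (h / A) s) :
    ∑ i, ∑ j, M i j * (t j / t i) + ∑ i, η i * (t i + 1 / t i) =
      h + η 0 ^ 2 / h + M 0 0 + (∑ i, ∑ j, elimWeights M h i j * (s j / s i) +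
        ∑ i, elimRoot M η h i * (s i + 1 / s i)) := by
  subst ht
  simp only [Fin.sum_univ_succ, Fin.cons_zero, Fin.cons_succ]
  set P := ∑ k : Fin n, M 0 k.succ / s k with hP
  set Q := ∑ k : Fin n, M 0 k.succ * s k with hQ
  have e1 : ∑ i : Fin n, M 0 i.succ * (s i / (h / A)) = Q * (A / h) := by
    rw [hQ, Finset.sum_mul]
    refine Finset.sum_congr rfl fun i _ => ?_
    field_simp
  have e2 : ∑ i : Fin n, M i.succ 0 * (h / A / s i) = P * (h / A) := by
    rw [hP, Finset.sum_mul]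
    refine Finset.sum_congr rfl fun i _ => ?_
    rw [hsym i.succ 0]
    have := (hs i).ne'
    field_simp
  have e3 : ∑ i, ∑ j, elimWeights M h i j * (s j / s i) =
      ∑ i : Fin n, ∑ j : Fin n, M i.succ j.succ * (s j / s i) + P * Q / h := by
    rw [hP, hQ, Finset.sum_mul_sum, Finset.sum_div, ← Finset.sum_add_distrib]
    refine Finset.sum_congr rfl fun i _ => ?_
    rw [Finset.sum_div, ← Finset.sum_add_distrib]
    refine Finset.sum_congr rfl fun j _ => ?_
    have := (hs i).ne'
    unfold elimWeights
    rw [hsym i.succ 0]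
    field_simp
  have e4 : ∑ i, elimRoot M η h i * (s i + 1 / s i) =
      ∑ i : Fin n, η i.succ * (s i + 1 / s i) + η 0 / h * (P + Q) := by
    rw [hP, hQ, ← Finset.sum_add_distrib, Finset.mul_sum, ← Finset.sum_add_distrib]
    refine Finset.sum_congr rfl fun i _ => ?_
    have := (hs i).ne'
    unfold elimRoot
    rw [hsym i.succ 0]
    field_simp
    ring
  rw [e1, e3, e4, Finset.sum_add_distrib, e2]
  have hPA : P = A - η 0 := by rw [hA]; ring
  rw [hPA]
  field_simp
  ring

lemma envDensity_cons (hsym : ∀ i j, M i j = M j i) {s : Fin n → ℝ} (hs : ∀ i, 0 < s i)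
    {h A : ℝ} (hh : 0 < h) (hA : A = ∑ k : Fin n, M 0 k.succ / s k + η 0) (hApos : 0 < A) :
    1 / A * envDensity M η (Fin.cons (h / A) s : Fin (n + 1) → ℝ) =
      ((√h)⁻¹ * exp (-(h + η 0 ^ 2 / h + M 0 0) / 2)) *
        envDensity (elimWeights M h) (elimRoot M η h) s := by
  unfold envDensity
  rw [det_envLap_cons hs hh hA hApos, exponent_cons hsym hs hh hA hApos rfl, neg_add, add_div,
    exp_add, Real.sqrt_mul (by positivity), Real.sqrt_div (sq_nonneg A), Real.sqrt_sq hApos.le]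
  field_simp

lemma elim_total (hsym : ∀ i j, M i j = M j i) {h : ℝ} (hh : 0 < h) :
    (h + η 0 ^ 2 / h + M 0 0) / 2 +
        ((∑ i, ∑ j, elimWeights M h i j) / 2 + ∑ i, elimRoot M η h i) =
      (h + (∑ k : Fin n, M 0 k.succ + η 0) ^ 2 / h) / 2 + M 0 0 / 2 +
        (∑ i : Fin n, ∑ j : Fin n, M i.succ j.succ) / 2 + ∑ i : Fin n, η i.succ := by
  set P := ∑ k : Fin n, M 0 k.succ with hP
  have e1 : ∑ i, ∑ j, elimWeights M h i j =
      ∑ i : Fin n, ∑ j : Fin n, M i.succ j.succ + P * P / h := by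
    rw [hP, Finset.sum_mul_sum, Finset.sum_div, ← Finset.sum_add_distrib]
    refine Finset.sum_congr rfl fun i _ => ?_
    rw [Finset.sum_div, ← Finset.sum_add_distrib]
    refine Finset.sum_congr rfl fun j _ => ?_
    rw [← hsym i.succ 0]
    rfl
  have e2 : ∑ i, elimRoot M η h i = ∑ i : Fin n, η i.succ + P * η 0 / h := by
    rw [hP, Finset.sum_mul, Finset.sum_div, ← Finset.sum_add_distrib]
    refine Finset.sum_congr rfl fun i _ => ?_
    rw [← hsym i.succ 0]
    rfl
  rw [e1, e2]
  field_simp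
  ring

end Elimination

theorem lintegral_envDensity_fin : ∀ (n : ℕ) (M : Fin n → Fin n → ℝ) (η : Fin n → ℝ),
    (∀ i j, 0 ≤ M i j) → (∀ i, 0 ≤ η i) → (∀ i j, M i j = M j i) → LinkedToRoot M η →
    ∫⁻ s, ENNReal.ofReal (envDensity M η s) ∂orthant (Fin n) =
      ENNReal.ofReal (√(2 * π) ^ n * exp (-((∑ i, ∑ j, M i j) / 2 + ∑ i, η i))) := by
  intro n
  induction n with
  | zero =>
    intro M η _ _ _ _
    rw [orthant, Measure.pi_of_empty, lintegral_dirac]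
    simp [envDensity]
  | succ n ih =>
    intro M η hM hη hsym hl
    have hmp := (measurePreserving_piFinSuccAbove (fun _ : Fin (n + 1) => posMeas) 0).symm
    have hmeas : Measurable fun p : ℝ × (Fin n → ℝ) =>
        ENNReal.ofReal (envDensity M η (Fin.cons p.1 p.2 : Fin (n + 1) → ℝ)) := by
      refine ENNReal.measurable_ofReal.comp (measurable_envDensity (fun _ _ => measurable_const)
        (fun _ => measurable_const) fun i => ?_)
      induction i using Fin.cases with
      | zero => exact measurable_fst
      | succ i => exact (measurable_pi_apply i).comp measurable_snd
    have hmeas2 : Measurable fun p : (Fin n → ℝ) × ℝ => ENNReal.ofReal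
        (((√p.2)⁻¹ * exp (-(p.2 + η 0 ^ 2 / p.2 + M 0 0) / 2)) *
          envDensity (elimWeights M p.2) (elimRoot M η p.2) p.1) := by
      refine ENNReal.measurable_ofReal.comp (Measurable.mul (by fun_prop) ?_)
      refine measurable_envDensity (fun i j => ?_) (fun i => ?_) (fun i => ?_)
      · unfold elimWeights; fun_prop
      · unfold elimRoot; fun_prop
      · fun_prop
    have hcons : ∀ p : ℝ × (Fin n → ℝ),
        (MeasurableEquiv.piFinSuccAbove (fun _ : Fin (n + 1) => ℝ) 0).symm p =
          (Fin.cons p.1 p.2 : Fin (n + 1) → ℝ) := fun p => by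
      simp [MeasurableEquiv.piFinSuccAbove]
      rfl
    calc ∫⁻ s, ENNReal.ofReal (envDensity M η s) ∂orthant (Fin (n + 1))
        = ∫⁻ p, ENNReal.ofReal (envDensity M η (Fin.cons p.1 p.2 : Fin (n + 1) → ℝ))
            ∂(posMeas.prod (orthant (Fin n))) := by
          rw [orthant, hmp.lintegral_map_equiv]
          simp only [hcons]
          rfl
      _ = ∫⁻ s, ∫⁻ z, ENNReal.ofReal (envDensity M η (Fin.cons z s : Fin (n + 1) → ℝ))
            ∂posMeas ∂orthant (Fin n) := lintegral_prod_symm' _ hmeas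
      _ = ∫⁻ s, ∫⁻ h, ENNReal.ofReal (((√h)⁻¹ * exp (-(h + η 0 ^ 2 / h + M 0 0) / 2)) *
            envDensity (elimWeights M h) (elimRoot M η h) s) ∂posMeas ∂orthant (Fin n) := by
          refine lintegral_congr_ae ?_
          filter_upwards [ae_orthant (Fin n)] with s hs
          have hA := hl.elim_pos hM hη hs
          set A := ∑ k : Fin n, M 0 k.succ / s k + η 0 with hAdef
          rw [lintegral_posMeas_scale (c := 1 / A) (by positivity),
            ← lintegral_const_mul' _ _ ENNReal.ofReal_ne_top]
          refine lintegral_congr_ae ?_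
          filter_upwards [ae_posMeas] with h hh
          rw [← ENNReal.ofReal_mul (by positivity), show 1 / A * h = h / A by ring,
            envDensity_cons hsym hs hh hAdef hA]
      _ = ∫⁻ h, ∫⁻ s, ENNReal.ofReal (((√h)⁻¹ * exp (-(h + η 0 ^ 2 / h + M 0 0) / 2)) *
            envDensity (elimWeights M h) (elimRoot M η h) s) ∂orthant (Fin n) ∂posMeas :=
          lintegral_lintegral_swap hmeas2.aemeasurable
      _ = ∫⁻ h, ENNReal.ofReal (√(2 * π) ^ n * exp (-(M 0 0 / 2 +
            (∑ i : Fin n, ∑ j : Fin n, M i.succ j.succ) / 2 + ∑ i : Fin n, η i.succ))) *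
            ENNReal.ofReal ((√h)⁻¹ * exp (-(h + (∑ k : Fin n, M 0 k.succ + η 0) ^ 2 / h) / 2))
            ∂posMeas := by
          refine lintegral_congr_ae ?_
          filter_upwards [ae_posMeas] with h hh
          simp_rw [ENNReal.ofReal_mul
            (show 0 ≤ (√h)⁻¹ * exp (-(h + η 0 ^ 2 / h + M 0 0) / 2) by positivity)]
          rw [lintegral_const_mul' _ _ ENNReal.ofReal_ne_top, ih _ _ _ _ _ (hl.elim hM hη hh),
            ← ENNReal.ofReal_mul (by positivity), ← ENNReal.ofReal_mul (by positivity)]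
          · congr 1
            have := elim_total (η := η) hsym hh
            have h2 : exp (-(h + η 0 ^ 2 / h + M 0 0) / 2) * exp (-((∑ i, ∑ j, elimWeights M h i j) / 2
                + ∑ i, elimRoot M η h i)) = exp (-(M 0 0 / 2 +
                (∑ i : Fin n, ∑ j : Fin n, M i.succ j.succ) / 2 + ∑ i : Fin n, η i.succ)) *
                exp (-(h + (∑ k : Fin n, M 0 k.succ + η 0) ^ 2 / h) / 2) := by
              rw [← exp_add, ← exp_add]
              congr 1
              linarith
            linear_combination (√h)⁻¹ * √(2 * π) ^ n * h2
          · intro i j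
            have := mul_nonneg (hM i.succ 0) (hM 0 j.succ)
            exact add_nonneg (hM _ _) (by positivity)
          · intro i
            have := mul_nonneg (hM i.succ 0) (hη 0)
            exact add_nonneg (hη _) (by positivity)
          · intro i j
            unfold elimWeights
            rw [hsym i.succ j.succ, hsym i.succ 0, hsym 0 j.succ]
            ring
      _ = _ := by
          have hA : 0 < ∑ k : Fin n, M 0 k.succ + η 0 := by
            have := hl.elim_pos hM hη (s := fun _ => 1) (fun _ => one_pos)
            simpa using this
          rw [lintegral_const_mul' _ _ ENNReal.ofReal_ne_top,
            lintegral_reciprocal_inverse_gaussian hA, ← ENNReal.ofReal_mul (by positivity)]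
          congr 1
          have e : (∑ i, ∑ j, M i j) / 2 + ∑ i, η i = (M 0 0 / 2 +
                (∑ i : Fin n, ∑ j : Fin n, M i.succ j.succ) / 2 + ∑ i : Fin n, η i.succ) +
                (∑ k : Fin n, M 0 k.succ + η 0) := by
            simp only [Fin.sum_univ_succ]
            rw [Finset.sum_add_distrib]
            have : ∑ i : Fin n, M i.succ 0 = ∑ i : Fin n, M 0 i.succ :=
              Finset.sum_congr rfl fun i _ => hsym _ _
            rw [this]
            ring
          rw [e, pow_succ]
          generalize M 0 0 / 2 + (∑ i : Fin n, ∑ j : Fin n, M i.succ j.succ) / 2 +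
            ∑ i : Fin n, η i.succ = X
          generalize ∑ k : Fin n, M 0 k.succ + η 0 = Y
          rw [neg_add X Y, exp_add]
          ring

lemma envDensity_comp_equiv {ι κ : Type*} [Fintype ι] [DecidableEq ι] [Fintype κ] [DecidableEq κ]
    (f : κ ≃ ι) (M : ι → ι → ℝ) (η s : ι → ℝ) :
    envDensity (fun i j => M (f i) (f j)) (fun i => η (f i)) (fun i => s (f i)) =
      envDensity M η s := by
  have hdet : (envLap (fun i j => M (f i) (f j)) (fun i => η (f i)) fun i => s (f i)) =
      (envLap M η s).submatrix f f := by
    ext i j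
    simp only [envLap, Matrix.of_apply, Matrix.submatrix_apply, f.injective.eq_iff]
    rw [f.sum_comp fun k => M (f i) k / (s (f i) * s k)]
  unfold envDensity
  rw [hdet, Matrix.det_submatrix_equiv_self, f.sum_comp fun i => η i * (s i + 1 / s i),
    f.sum_comp fun i => ∑ j, M i (f j) * (s (f j) / s i)]
  simp_rw [fun i => f.sum_comp fun j => M i j * (s j / s i)]

theorem lintegral_envDensity {ι : Type*} [Fintype ι] [DecidableEq ι] (M : ι → ι → ℝ) (η : ι → ℝ)
    (hM : ∀ i j, 0 ≤ M i j) (hη : ∀ i, 0 ≤ η i) (hsym : ∀ i j, M i j = M j i)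
    (hl : LinkedToRoot M η) :
    ∫⁻ s, ENNReal.ofReal (envDensity M η s) ∂orthant ι =
      ENNReal.ofReal (√(2 * π) ^ Fintype.card ι *
        exp (-((∑ i, ∑ j, M i j) / 2 + ∑ i, η i))) := by
  let f : Fin (Fintype.card ι) ≃ ι := (Fintype.equivFin ι).symm
  have hmp := measurePreserving_piCongrLeft (fun _ : ι => posMeas) f
  have h := lintegral_envDensity_fin _ (fun i j => M (f i) (f j)) (fun i => η (f i))
    (fun _ _ => hM _ _) (fun _ => hη _) (fun _ _ => hsym _ _) (by
      intro S hS
      rcases hl (f '' S) (hS.image _) with ⟨_, ⟨i, hi, rfl⟩, h⟩ | ⟨_, ⟨i, hi, rfl⟩, j, hj, h⟩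
      · exact Or.inl ⟨i, hi, h⟩
      · refine Or.inr ⟨i, hi, f.symm j, fun hj' => hj ⟨_, hj', by simp⟩, by simpa using h⟩)
  rw [f.sum_comp η, f.sum_comp fun i => ∑ j, M i (f j)] at h
  simp_rw [fun i => f.sum_comp fun j => M i j] at h
  rw [← h, orthant, ← hmp.map_eq, lintegral_map_equiv]
  refine lintegral_congr fun s => ?_
  rw [← envDensity_comp_equiv f M η]
  congr 2
  ext i
  exact (MeasurableEquiv.piCongrLeft_apply_apply (β := fun _ : ι => ℝ) f s i)

/-! ### Sums and products over edges -/

section EdgeSums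

variable (G : SimpleGraph V) [DecidableRel G.Adj]

lemma sum_neighborFinset_eq_sum_edges (f : Sym2 V → ℝ) (v : V) :
    ∑ j ∈ G.neighborFinset v, f s(v, j) = ∑ e ∈ G.edgeFinset, if v ∈ e then f e else 0 := by
  rw [← Finset.sum_filter]
  refine Finset.sum_bij (fun j _ => s(v, j)) ?_ ?_ ?_ ?_
  · intro j hj
    simpa using hj
  · intro j _ k _ h
    exact Sym2.congr_right.1 h
  · intro e he
    rw [Finset.mem_filter] at he
    obtain ⟨j, rfl⟩ := he.2
    exact ⟨j, by simpa using he.1, rfl⟩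
  · intro j _
    rfl

lemma sum_mul_vw (w : Sym2 V → ℝ) (f : V → ℝ) :
    ∑ v, f v * vw G w v = ∑ e ∈ G.edgeFinset, w e * ssum f e := by
  unfold vw
  simp_rw [sum_neighborFinset_eq_sum_edges, Finset.mul_sum]
  rw [Finset.sum_comm]
  refine Finset.sum_congr rfl fun e he => ?_
  induction e with
  | _ a b =>
    have hab : a ≠ b := (SimpleGraph.mem_edgeFinset.1 he).ne
    simp only [mul_ite, mul_zero, Sym2.mem_iff]
    rw [← Finset.sum_filter]
    have : (Finset.univ.filter fun v => v = a ∨ v = b) = {a, b} := by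
      ext v; simp
    rw [this, Finset.sum_pair hab]
    simp only [ssum, Sym2.lift_mk]
    ring

lemma sum_vw (w : Sym2 V → ℝ) : ∑ v, vw G w v = 2 * ∑ e ∈ G.edgeFinset, w e := by
  have h := sum_mul_vw G w fun _ => 1
  simp only [one_mul] at h
  rw [h, Finset.mul_sum]
  refine Finset.sum_congr rfl fun e _ => ?_
  induction e with
  | _ a b => simp only [ssum, Sym2.lift_mk]; ring

lemma prod_sprod_rpow (B : Sym2 V → ℝ) {s : V → ℝ} (hs : ∀ v, 0 < s v) :
    ∏ e ∈ G.edgeFinset, sprod s e ^ B e = ∏ v, s v ^ vw G B v := by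
  have hsp : ∀ e, 0 < sprod s e := fun e => by
    induction e with
    | _ a b => exact mul_pos (hs a) (hs b)
  have h1 : ∏ e ∈ G.edgeFinset, sprod s e ^ B e =
      exp (∑ e ∈ G.edgeFinset, B e * ssum (fun v => log (s v)) e) := by
    rw [exp_sum]
    refine Finset.prod_congr rfl fun e _ => ?_
    rw [rpow_def_of_pos (hsp e), mul_comm]
    congr 2
    induction e with
    | _ a b =>
      simp only [sprod, ssum, Sym2.lift_mk]
      exact log_mul (hs a).ne' (hs b).ne'
  rw [h1, ← sum_mul_vw, exp_sum]
  refine Finset.prod_congr rfl fun v _ => ?_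
  rw [rpow_def_of_pos (hs v)]

lemma sprod_pos {s : V → ℝ} (hs : ∀ v, 0 < s v) (e : Sym2 V) : 0 < sprod s e := by
  induction e with
  | _ a b => exact mul_pos (hs a) (hs b)

lemma sum_bwt (x : V) (B : Sym2 V → ℝ) :
    ∑ v, bwt G x B v = ∑ e ∈ G.edgeFinset, B e + ((Fintype.card V : ℝ) - 1) / 2 := by
  unfold bwt
  rw [← Finset.sum_div, Finset.sum_sub_distrib, Finset.sum_add_distrib, sum_vw]
  simp
  ring

variable {G}

lemma vw_pos (hG : G.Connected) {e0 : Sym2 V} (he0 : e0 ∈ G.edgeFinset) {w : Sym2 V → ℝ}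
    (hw : ∀ e ∈ G.edgeFinset, 0 < w e) (v : V) : 0 < vw G w v := by
  have : Nontrivial V := by
    induction e0 with
    | _ a b => exact ⟨a, b, (SimpleGraph.mem_edgeFinset.1 he0).ne⟩
  obtain ⟨u, hu⟩ := hG.preconnected.exists_adj_of_nontrivial v
  refine Finset.sum_pos (fun j hj => hw _ (by simpa using hj)) ⟨u, by simpa using hu⟩

lemma bwt_pos (hG : G.Connected) {e0 : Sym2 V} (he0 : e0 ∈ G.edgeFinset) {B : Sym2 V → ℝ}
    (hB : ∀ e ∈ G.edgeFinset, 0 < B e) (x v : V) : 0 < bwt G x B v := by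
  have := vw_pos hG he0 hB v
  unfold bwt
  split_ifs <;> linarith

lemma prod_edgeFinset_eq {M : Type*} [CommMonoid M] {e0 : Sym2 V} (he0 : e0 ∈ G.edgeFinset)
    (f : Sym2 V → M) : ∏ e ∈ G.edgeFinset, f e = f e0 * ∏ e : Epin G e0, f e := by
  rw [← Finset.mul_prod_erase _ _ he0]
  congr 1
  refine Finset.prod_subtype _ (fun e => ?_) f
  rw [Finset.mem_erase, and_comm]

/-- Extension of non-reference edge coordinates to an environment with `w_{e0} = t`. -/
def edgeExt (G : SimpleGraph V) [DecidableRel G.Adj] (e0 : Sym2 V) (t : ℝ)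
    (u : Epin G e0 → ℝ) : Sym2 V → ℝ :=
  fun e => if e = e0 then t else if h : e ∈ G.edgeFinset ∧ e ≠ e0 then u ⟨e, h⟩ else 0

lemma edgeExt_self (e0 : Sym2 V) (t : ℝ) (u : Epin G e0 → ℝ) : edgeExt G e0 t u e0 = t := by
  simp [edgeExt]

lemma edgeExt_coe (e0 : Sym2 V) (t : ℝ) (u : Epin G e0 → ℝ) (e : Epin G e0) :
    edgeExt G e0 t u e = u e := by
  simp [edgeExt, e.2.2, -SimpleGraph.mem_edgeFinset, e.2.1]

lemma pinExt_eq_edgeExt (e0 : Sym2 V) (u : Epin G e0 → ℝ) :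
    pinExt G e0 u = edgeExt G e0 1 u := rfl

lemma forall_edgeExt_pos {e0 : Sym2 V} (he0 : e0 ∈ G.edgeFinset) {t : ℝ} {u : Epin G e0 → ℝ} :
    (∀ e ∈ G.edgeFinset, 0 < edgeExt G e0 t u e) ↔ 0 < t ∧ ∀ e, 0 < u e := by
  constructor
  · intro h
    refine ⟨by simpa [edgeExt_self] using h e0 he0, fun e => ?_⟩
    have := h e e.2.1
    rwa [edgeExt_coe] at this
  · rintro ⟨h1, h2⟩ e he
    by_cases h : e = e0
    · rw [h, edgeExt_self]; exact h1
    · have := edgeExt_coe e0 t u ⟨e, he, h⟩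
      simp only at this
      rw [this]
      exact h2 _

lemma measurable_edgeExt {α : Type*} [MeasurableSpace α] {e0 : Sym2 V} {t : α → ℝ}
    {u : α → Epin G e0 → ℝ} (ht : Measurable t) (hu : Measurable u) :
    Measurable fun x => edgeExt G e0 (t x) (u x) := by
  refine measurable_pi_lambda _ fun e => ?_
  unfold edgeExt
  split_ifs with h1 h2
  · exact ht
  · exact (measurable_pi_apply _).comp hu
  · exact measurable_const

lemma measurable_vw (v : V) : Measurable fun w : Sym2 V → ℝ => vw G w v := by
  unfold vw; fun_prop

lemma measurable_tau : Measurable fun w : Sym2 V → ℝ => tau G w := by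
  unfold tau; fun_prop

end EdgeSums

/-! ### Gamma integrals -/

lemma integrable_posMeas_sq {β c : ℝ} (hβ : 0 < β) (hc : 0 < c) :
    Integrable (fun s : ℝ => 2 * s ^ (2 * β - 1) * exp (-c * s ^ 2)) posMeas := by
  have h := (integrableOn_rpow_mul_exp_neg_mul_sq hc (s := 2 * β - 1) (by linarith)).const_mul 2
  unfold posMeas
  simpa only [mul_assoc] using h

lemma integral_posMeas_sq {β c : ℝ} (hβ : 0 < β) (hc : 0 < c) :
    ∫ s, 2 * s ^ (2 * β - 1) * exp (-c * s ^ 2) ∂posMeas = Gamma β * c ^ (-β) := by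
  have h := integral_rpow_mul_exp_neg_mul_rpow (p := 2) (q := 2 * β - 1) (b := c) two_pos
    (by linarith) hc
  simp only [mul_assoc]
  rw [integral_const_mul]
  simp only [rpow_two] at h
  unfold posMeas
  rw [h, show (2 * β - 1 + 1) / 2 = β by ring, show -(2 * β - 1 + 1) / 2 = -β by ring]
  ring

lemma lintegral_posMeas_gamma {β c : ℝ} (hβ : 0 < β) (hc : 0 < c) :
    ∫⁻ t, ENNReal.ofReal (t ^ (β - 1) * exp (-(c * t))) ∂posMeas =
      ENNReal.ofReal (Gamma β * c ^ (-β)) := by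
  have h := Real.integral_rpow_mul_exp_neg_mul_Ioi hβ hc
  have hi : IntegrableOn (fun t : ℝ => t ^ (β - 1) * exp (-(c * t))) (Set.Ioi 0) := by
    have := integrableOn_rpow_mul_exp_neg_mul_rpow (s := β - 1) (p := 1) (b := c) (by linarith)
      one_pos hc
    simpa using this
  unfold posMeas
  rw [← ofReal_integral_eq_lintegral_ofReal hi, h, one_div, inv_rpow hc.le, rpow_neg hc.le, mul_comm]
  filter_upwards [ae_restrict_mem measurableSet_Ioi] with t ht
  have : 0 < t := ht
  simp only [Pi.zero_apply]
  positivity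

lemma lintegral_orthant_gamma {ι : Type*} [Fintype ι] {β : ι → ℝ} (hβ : ∀ i, 0 < β i) :
    ∫⁻ t, ENNReal.ofReal (∏ i, t i ^ (β i - 1) * exp (-t i)) ∂orthant ι =
      ENNReal.ofReal (∏ i, Gamma (β i)) := by
  rw [lintegral_orthant_prod (f := fun i t => t ^ (β i - 1) * exp (-t))]
  · congr 1
    refine Finset.prod_congr rfl fun i _ => ?_
    rw [Gamma_eq_integral (hβ i)]
    unfold posMeas
    simp_rw [mul_comm]
  · intro i
    have := GammaIntegral_convergent (hβ i)
    unfold posMeas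
    refine Integrable.congr this.integrable ?_
    filter_upwards with t
    rw [mul_comm]
  · intro i t ht
    positivity

/-- Joint gamma-type kernel whose integral over `(r, s)` is a product of powers. -/
def gammaKernel (x : V) (β c : V → ℝ) (r : ℝ) (s : {v // v ≠ x} → ℝ) : ℝ :=
  r ^ (∑ v, β v - 1) * (∏ v : {v // v ≠ x}, 2 * s v ^ (2 * β v - 1)) *
    exp (-r * (c x + ∑ v : {v // v ≠ x}, s v ^ 2 * c v))

lemma lintegral_gammaKernel (x : V) {β c : V → ℝ} (hβ : ∀ v, 0 < β v) (hc : ∀ v, 0 < c v) :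
    ∫⁻ r, ∫⁻ s, ENNReal.ofReal (gammaKernel x β c r s) ∂orthant {v // v ≠ x} ∂posMeas =
      ENNReal.ofReal (∏ v, Gamma (β v) * c v ^ (-β v)) := by
  have hP : 0 ≤ ∏ v : {v // v ≠ x}, Gamma (β v) * c v ^ (-β v) :=
    Finset.prod_nonneg fun v _ => mul_nonneg (Gamma_pos_of_pos (hβ v)).le (rpow_nonneg (hc v).le _)
  have key : ∀ r : ℝ, 0 < r → ∫⁻ s, ENNReal.ofReal (gammaKernel x β c r s) ∂orthant {v // v ≠ x} =
      ENNReal.ofReal (∏ v : {v // v ≠ x}, Gamma (β v) * c v ^ (-β v)) *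
        ENNReal.ofReal (r ^ (β x - 1) * exp (-(c x * r))) := by
    intro r hr
    have e : ∀ s : {v // v ≠ x} → ℝ, gammaKernel x β c r s =
        r ^ (∑ v, β v - 1) * exp (-(c x * r)) *
          ∏ v : {v // v ≠ x}, (2 * s v ^ (2 * β v - 1) * exp (-(r * c v) * s v ^ 2)) := by
      intro s
      unfold gammaKernel
      rw [Finset.prod_mul_distrib (f := fun v : {v // v ≠ x} => 2 * s v ^ (2 * β v - 1)), ← exp_sum,
        mul_mul_mul_comm, ← exp_add]
      simp only [mul_assoc]
      congr 3
      rw [mul_add, Finset.mul_sum]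
      congr 1
      · ring
      · refine Finset.sum_congr rfl fun v _ => ?_
        ring
    simp_rw [e]
    simp_rw [ENNReal.ofReal_mul (show 0 ≤ r ^ (∑ v, β v - 1) * exp (-(c x * r)) by positivity)]
    rw [lintegral_const_mul' _ _ ENNReal.ofReal_ne_top,
      lintegral_orthant_prod
        (f := fun (v : {v // v ≠ x}) s => 2 * s ^ (2 * β v - 1) * exp (-(r * c v) * s ^ 2))
        (fun v => integrable_posMeas_sq (hβ v) (mul_pos hr (hc v)))
        (fun v s hs => by positivity), ← ENNReal.ofReal_mul (by positivity),
      ← ENNReal.ofReal_mul hP]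
    congr 1
    simp_rw [fun v : {v // v ≠ x} => integral_posMeas_sq (hβ v) (mul_pos hr (hc v)),
      fun v : {v // v ≠ x} => mul_rpow (y := c v) (z := -β v) hr.le (hc v).le]
    have h2 : ∏ v : {v // v ≠ x}, (Gamma (β v) * (r ^ (-β v) * c v ^ (-β v))) =
        (∏ v : {v // v ≠ x}, Gamma (β v) * c v ^ (-β v)) * r ^ (-∑ v : {v // v ≠ x}, β v) := by
      rw [← Finset.sum_neg_distrib, rpow_sum_of_pos hr, ← Finset.prod_mul_distrib]
      refine Finset.prod_congr rfl fun v _ => ?_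
      ring
    rw [h2, Fintype.sum_eq_add_sum_subtype_ne β x]
    have h3 : r ^ (β x + ∑ v : {v // v ≠ x}, β v - 1) * r ^ (-∑ v : {v // v ≠ x}, β v) =
        r ^ (β x - 1) := by
      rw [← rpow_add hr]
      congr 1
      ring
    linear_combination (∏ v : {v // v ≠ x}, Gamma (β v) * c v ^ (-β v)) * exp (-(c x * r)) * h3
  calc _ = ∫⁻ r, ENNReal.ofReal (∏ v : {v // v ≠ x}, Gamma (β v) * c v ^ (-β v)) *
        ENNReal.ofReal (r ^ (β x - 1) * exp (-(c x * r))) ∂posMeas := by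
        refine lintegral_congr_ae ?_
        filter_upwards [ae_posMeas] with r hr
        exact key r hr
    _ = _ := by
      rw [lintegral_const_mul' _ _ ENNReal.ofReal_ne_top, lintegral_posMeas_gamma (hβ x) (hc x),
        ← ENNReal.ofReal_mul hP,
        Fintype.prod_eq_mul_prod_subtype_ne _ x, mul_comm]

lemma lintegral_lintegral_rotate {α β γ : Type*} [MeasurableSpace α] [MeasurableSpace β]
    [MeasurableSpace γ] (μ : Measure α) (ν : Measure β) (ρ : Measure γ) [SFinite μ] [SFinite ν]
    [SFinite ρ] {f : α → β → γ → ℝ≥0∞} (hf : Measurable fun p : α × β × γ => f p.1 p.2.1 p.2.2) :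
    ∫⁻ a, ∫⁻ b, ∫⁻ c, f a b c ∂ρ ∂ν ∂μ = ∫⁻ c, ∫⁻ b, ∫⁻ a, f a b c ∂μ ∂ν ∂ρ := by
  have m1 : Measurable (Function.uncurry fun a b => ∫⁻ c, f a b c ∂ρ) := by
    refine Measurable.lintegral_prod_right (f := fun (p : α × β) c => f p.1 p.2 c) ?_
    exact hf.comp (f := fun q : (α × β) × γ => (q.1.1, q.1.2, q.2)) (by fun_prop)
  have m2 : Measurable (Function.uncurry fun b c => ∫⁻ a, f a b c ∂μ) := by
    refine Measurable.lintegral_prod_right (f := fun (p : β × γ) a => f a p.1 p.2) ?_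
    exact hf.comp (f := fun q : (β × γ) × α => (q.2, q.1.1, q.1.2)) (by fun_prop)
  rw [lintegral_lintegral_swap m1.aemeasurable, ← lintegral_lintegral_swap m2.aemeasurable]
  refine lintegral_congr fun b => lintegral_lintegral_swap ?_
  refine Measurable.aemeasurable ?_
  exact hf.comp (f := fun q : α × γ => (q.1, b, q.2)) (by fun_prop)

/-! ### The normalization of the magic formula -/

section MagicFormula

variable (G : SimpleGraph V) [DecidableRel G.Adj] (x : V)

/-- Extension by `1` at the root. -/
def rootExt (s : {v // v ≠ x} → ℝ) : V → ℝ := fun v => if h : v = x then 1 else s ⟨v, h⟩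

/-- Edge weights between non-root vertices. -/
def bulkWeights (w : Sym2 V → ℝ) (i j : {v // v ≠ x}) : ℝ :=
  if G.Adj i j then w s(i.1, j.1) else 0

/-- Edge weights between the root and the other vertices. -/
def rootWeights (w : Sym2 V → ℝ) (i : {v // v ≠ x}) : ℝ :=
  if G.Adj i x then w s(i.1, x) else 0

/-- The change of variables from environments to weights. -/
def envOf (κ : ℝ) (s : {v // v ≠ x} → ℝ) (w : Sym2 V → ℝ) (e : Sym2 V) : ℝ :=
  κ * (w e / (2 * sprod (rootExt x s) e))

variable {x}

@[simp] lemma rootExt_root (s : {v // v ≠ x} → ℝ) : rootExt x s x = 1 := by simp [rootExt]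

@[simp] lemma rootExt_coe (s : {v // v ≠ x} → ℝ) (i : {v // v ≠ x}) : rootExt x s i = s i := by
  simp [rootExt, i.2]

lemma rootExt_pos {s : {v // v ≠ x} → ℝ} (hs : ∀ i, 0 < s i) (v : V) : 0 < rootExt x s v := by
  unfold rootExt
  split_ifs
  · exact one_pos
  · exact hs _

lemma envOf_mk (κ : ℝ) (s : {v // v ≠ x} → ℝ) (w : Sym2 V → ℝ) (i j : V) :
    envOf x κ s w s(i, j) = κ * (w s(i, j) / (2 * (rootExt x s i * rootExt x s j))) := rfl

lemma vw_envOf_root (κ : ℝ) (s : {v // v ≠ x} → ℝ) (w : Sym2 V → ℝ) :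
    vw G (envOf x κ s w) x = κ / 2 * ∑ i, rootWeights G x w i / s i := by
  rw [vw_eq_sum, Fintype.sum_eq_add_sum_subtype_ne _ x, Finset.mul_sum]
  simp only [SimpleGraph.irrefl, if_false, zero_add]
  refine Finset.sum_congr rfl fun i _ => ?_
  rw [envOf_mk, rootExt_root, rootExt_coe, rootWeights, Sym2.eq_swap]
  simp only [G.adj_comm x]
  split_ifs
  · by_cases h : s i = 0
    · simp [h]
    · field_simp
  · simp

lemma vw_envOf (κ : ℝ) {s : {v // v ≠ x} → ℝ} (hs : ∀ i, 0 < s i) (w : Sym2 V → ℝ)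
    (i : {v // v ≠ x}) :
    vw G (envOf x κ s w) i =
      κ / 2 * (∑ k, bulkWeights G x w i k / (s i * s k) + rootWeights G x w i / s i) := by
  rw [vw_eq_sum, Fintype.sum_eq_add_sum_subtype_ne _ x, add_comm, mul_add, Finset.mul_sum]
  have hi := (hs i).ne'
  congr 1
  · refine Finset.sum_congr rfl fun k _ => ?_
    have hk := (hs k).ne'
    rw [envOf_mk, rootExt_coe, rootExt_coe, bulkWeights]
    split_ifs
    · field_simp
    · simp
  · rw [envOf_mk, rootExt_coe, rootExt_root, rootWeights]
    split_ifs
    · field_simp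
    · simp

lemma tau_envOf (κ : ℝ) {s : {v // v ≠ x} → ℝ} (hs : ∀ i, 0 < s i) (w : Sym2 V → ℝ) :
    tau G (envOf x κ s w) = (κ / 2) ^ Fintype.card {v // v ≠ x} *
      (envLap (bulkWeights G x w) (rootWeights G x w) s).det := by
  rw [tau_eq_det G x, ← Matrix.det_smul]
  congr 1
  ext i j
  have hi := (hs i).ne'
  have hj := (hs j).ne'
  simp only [rootedLap, envLap, Matrix.of_apply, Matrix.smul_apply, smul_eq_mul, mul_sub]
  congr 1
  · split_ifs
    · exact vw_envOf G κ hs w i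
    · simp
  · rw [envOf_mk, rootExt_coe, rootExt_coe, bulkWeights]
    split_ifs
    · field_simp
    · simp

lemma bulkWeights_symm (w : Sym2 V → ℝ) (i j : {v // v ≠ x}) :
    bulkWeights G x w i j = bulkWeights G x w j i := by
  unfold bulkWeights
  rw [Sym2.eq_swap]
  simp only [G.adj_comm i.1]

lemma quadratic_envOf (κ : ℝ) {s : {v // v ≠ x} → ℝ} (hs : ∀ i, 0 < s i) (w : Sym2 V → ℝ) :
    vw G (envOf x κ s w) x + ∑ v : {v // v ≠ x}, s v ^ 2 * vw G (envOf x κ s w) v =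
      κ / 2 * (∑ i, ∑ j, bulkWeights G x w i j * (s j / s i) +
        ∑ i, rootWeights G x w i * (s i + 1 / s i)) := by
  rw [vw_envOf_root]
  simp_rw [vw_envOf G κ hs]
  have e1 : ∑ i, ∑ j, bulkWeights G x w i j * (s j / s i) =
      ∑ i, s i ^ 2 * ∑ j, bulkWeights G x w i j / (s i * s j) := by
    rw [Finset.sum_comm]
    refine Finset.sum_congr rfl fun i _ => ?_
    rw [Finset.mul_sum]
    refine Finset.sum_congr rfl fun j _ => ?_
    have hi := (hs i).ne'
    have hj := (hs j).ne'
    rw [bulkWeights_symm]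
    field_simp
  have e2 : ∑ i, rootWeights G x w i * (s i + 1 / s i) =
      ∑ i, s i ^ 2 * (rootWeights G x w i / s i) + ∑ i, rootWeights G x w i / s i := by
    rw [← Finset.sum_add_distrib]
    refine Finset.sum_congr rfl fun i _ => ?_
    have hi := (hs i).ne'
    field_simp
  have e3 : ∑ i, s i ^ 2 * (κ / 2 * (∑ k, bulkWeights G x w i k / (s i * s k) +
      rootWeights G x w i / s i)) = κ / 2 * (∑ i, s i ^ 2 *
      ∑ j, bulkWeights G x w i j / (s i * s j) + ∑ i, s i ^ 2 * (rootWeights G x w i / s i)) := by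
    rw [← Finset.sum_add_distrib, Finset.mul_sum]
    refine Finset.sum_congr rfl fun i _ => ?_
    ring
  rw [e1, e2, e3]
  ring

lemma card_nonroot (x : V) : (Fintype.card {v // v ≠ x} : ℝ) = Fintype.card V - 1 := by
  have h : Fintype.card {v // v ≠ x} = Fintype.card V - 1 := by
    rw [Fintype.card_subtype_compl (fun v => v = x)]
    simp
  have h1 : 1 ≤ Fintype.card V := Fintype.card_pos_iff.2 ⟨x⟩
  rw [h, Nat.cast_sub h1, Nat.cast_one]

lemma prod_bwt_rpow (B : Sym2 V → ℝ) {s : {v // v ≠ x} → ℝ} (hs : ∀ i, 0 < s i) :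
    ∏ v : {v // v ≠ x}, 2 * s v ^ (2 * bwt G x B v - 1) =
      2 ^ Fintype.card {v // v ≠ x} * ∏ e ∈ G.edgeFinset, sprod (rootExt x s) e ^ B e := by
  rw [prod_sprod_rpow G B (rootExt_pos hs), Fintype.prod_eq_mul_prod_subtype_ne _ x, rootExt_root,
    one_rpow, one_mul, Finset.prod_mul_distrib]
  simp only [Finset.prod_const, Finset.card_univ]
  congr 1
  refine Finset.prod_congr rfl fun v _ => ?_
  rw [rootExt_coe]
  congr 1
  simp [bwt, v.2]
  ring

lemma gammaKernel_envOf (B : Sym2 V → ℝ) {κ : ℝ} (hκ : 0 < κ) {s : {v // v ≠ x} → ℝ}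
    (hs : ∀ i, 0 < s i) {w : Sym2 V → ℝ} (hw : ∀ e ∈ G.edgeFinset, 0 < w e) :
    κ⁻¹ * (∏ e ∈ G.edgeFinset, κ / (2 * sprod (rootExt x s) e)) *
        ((∏ e ∈ G.edgeFinset, envOf x κ s w e ^ (B e - 1)) * √(tau G (envOf x κ s w)) *
          gammaKernel x (bwt G x B) (vw G (envOf x κ s w)) κ⁻¹ s) =
      √2 ^ Fintype.card {v // v ≠ x} * 2 ^ (-∑ e ∈ G.edgeFinset, B e) *
        ((∏ e ∈ G.edgeFinset, w e ^ (B e - 1)) *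
          envDensity (bulkWeights G x w) (rootWeights G x w) s) := by
  set k := Fintype.card {v // v ≠ x} with hk
  have hS : ∀ e, 0 < sprod (rootExt x s) e := sprod_pos (rootExt_pos hs)
  have hPpos : 0 < ∏ e ∈ G.edgeFinset, sprod (rootExt x s) e ^ B e :=
    Finset.prod_pos fun e _ => rpow_pos_of_pos (hS e) _
  set P := ∏ e ∈ G.edgeFinset, sprod (rootExt x s) e ^ B e with hP
  have h1 : (∏ e ∈ G.edgeFinset, κ / (2 * sprod (rootExt x s) e)) *
      ∏ e ∈ G.edgeFinset, envOf x κ s w e ^ (B e - 1) =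
      κ ^ (∑ e ∈ G.edgeFinset, B e) * 2 ^ (-∑ e ∈ G.edgeFinset, B e) * P⁻¹ *
        ∏ e ∈ G.edgeFinset, w e ^ (B e - 1) := by
    rw [← Finset.sum_neg_distrib, rpow_sum_of_pos hκ, rpow_sum_of_pos two_pos, hP,
      ← Finset.prod_inv_distrib, ← Finset.prod_mul_distrib, ← Finset.prod_mul_distrib,
      ← Finset.prod_mul_distrib, ← Finset.prod_mul_distrib]
    refine Finset.prod_congr rfl fun e he => ?_
    have h := hS e
    have hwe := hw e he
    unfold envOf
    set S := sprod (rootExt x s) e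
    rw [show κ * (w e / (2 * S)) = (κ / (2 * S)) * w e by ring,
      mul_rpow (by positivity) hwe.le, ← mul_assoc]
    congr 1
    have : κ / (2 * S) * (κ / (2 * S)) ^ (B e - 1) = (κ / (2 * S)) ^ B e := by
      rw [rpow_sub_one (by positivity)]
      field_simp
    rw [this, div_rpow hκ.le (by positivity), mul_rpow (by positivity) h.le, rpow_neg two_pos.le]
    field_simp
  have h3 : √(tau G (envOf x κ s w)) =
      κ ^ ((k : ℝ) / 2) * (√2 ^ k)⁻¹ *
        √(envLap (bulkWeights G x w) (rootWeights G x w) s).det := by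
    rw [tau_envOf G κ hs, Real.sqrt_mul (by positivity), ← hk, sqrt_eq_rpow, div_pow, sqrt_eq_rpow,
      sqrt_eq_rpow, div_rpow (by positivity) (by positivity), ← rpow_natCast κ, ← rpow_mul hκ.le,
      ← rpow_natCast 2, ← rpow_mul two_pos.le, ← rpow_natCast, ← rpow_mul two_pos.le]
    ring_nf
  have h4 : gammaKernel x (bwt G x B) (vw G (envOf x κ s w)) κ⁻¹ s =
      κ ^ (1 - ∑ e ∈ G.edgeFinset, B e - (k : ℝ) / 2) * (2 ^ k * P) *
      exp (-(∑ i, ∑ j, bulkWeights G x w i j * (s j / s i) +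
        ∑ i, rootWeights G x w i * (s i + 1 / s i)) / 2) := by
    unfold gammaKernel
    rw [prod_bwt_rpow G B hs, quadratic_envOf G κ hs, sum_bwt, ← card_nonroot x, inv_rpow hκ.le,
      ← rpow_neg hκ.le]
    congr 2
    · congr 1
      ring
    · field_simp
  have hκpow : κ⁻¹ * κ ^ (∑ e ∈ G.edgeFinset, B e) * κ ^ ((k : ℝ) / 2) *
      κ ^ (1 - ∑ e ∈ G.edgeFinset, B e - (k : ℝ) / 2) = 1 := by
    rw [← rpow_neg_one, ← rpow_add hκ, ← rpow_add hκ, ← rpow_add hκ, ← rpow_zero κ]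
    congr 1
    ring
  have h2 : (2 : ℝ) ^ k = √2 ^ k * √2 ^ k := by
    rw [← mul_pow, Real.mul_self_sqrt two_pos.le]
  rw [mul_assoc κ⁻¹, mul_assoc (∏ e ∈ G.edgeFinset, envOf x κ s w e ^ (B e - 1)),
    ← mul_assoc (∏ e ∈ G.edgeFinset, κ / (2 * sprod (rootExt x s) e)), h1, h3, h4, h2]
  unfold envDensity
  have hs2 : √2 ^ k ≠ 0 := by positivity
  set Ex := exp (-(∑ i, ∑ j, bulkWeights G x w i j * (s j / s i) +
        ∑ i, rootWeights G x w i * (s i + 1 / s i)) / 2)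
  set D := √(envLap (bulkWeights G x w) (rootWeights G x w) s).det
  set W := ∏ e ∈ G.edgeFinset, w e ^ (B e - 1)
  set T := (2 : ℝ) ^ (-∑ e ∈ G.edgeFinset, B e)
  have hc : P⁻¹ * P = 1 := inv_mul_cancel₀ hPpos.ne'
  have hd : (√2 ^ k)⁻¹ * √2 ^ k = 1 := inv_mul_cancel₀ hs2
  generalize (√2 ^ k)⁻¹ = R at *
  generalize √2 ^ k = R' at *
  generalize P⁻¹ = P' at *
  generalize κ⁻¹ = a at *
  generalize κ ^ (∑ e ∈ G.edgeFinset, B e) = b at *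
  generalize κ ^ ((k : ℝ) / 2) = c at *
  generalize κ ^ (1 - ∑ e ∈ G.edgeFinset, B e - (k : ℝ) / 2) = d at *
  calc _ = (a * b * c * d) * (P' * P) * (R * R') * (T * W * D * R' * Ex) := by ring
    _ = _ := by rw [hκpow, hc, hd]; ring

end MagicFormula

section Normalization

variable {G : SimpleGraph V} [DecidableRel G.Adj]

lemma linkedToRoot (hG : G.Connected) (x : V) {w : Sym2 V → ℝ}
    (hw : ∀ e ∈ G.edgeFinset, 0 < w e) :
    LinkedToRoot (bulkWeights G x w) (rootWeights G x w) := by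
  rintro S ⟨v, hv⟩
  obtain ⟨p⟩ := hG.preconnected v.1 x
  obtain ⟨d, -, h1, h2⟩ := p.exists_boundary_dart (Subtype.val '' S) ⟨v, hv, rfl⟩
    (by rintro ⟨y, -, hy⟩; exact y.2 hy)
  obtain ⟨i, hi, hid⟩ := h1
  have hadj : G.Adj i d.snd := hid ▸ d.adj
  have hpos : 0 < w s(i.1, d.snd) := hw _ (by simpa using hadj)
  by_cases hx : d.snd = x
  · refine Or.inl ⟨i, hi, ?_⟩
    rw [hx] at hadj hpos
    rwa [rootWeights, if_pos hadj]
  · refine Or.inr ⟨i, hi, ⟨d.snd, hx⟩, fun h => h2 ⟨_, h, rfl⟩, ?_⟩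
    rwa [bulkWeights, if_pos hadj]

lemma bulkWeights_nonneg (x : V) {w : Sym2 V → ℝ} (hw : ∀ e ∈ G.edgeFinset, 0 < w e)
    (i j : {v // v ≠ x}) : 0 ≤ bulkWeights G x w i j := by
  unfold bulkWeights
  split_ifs with h
  · exact (hw _ (by simpa using h)).le
  · exact le_rfl

lemma rootWeights_nonneg (x : V) {w : Sym2 V → ℝ} (hw : ∀ e ∈ G.edgeFinset, 0 < w e)
    (i : {v // v ≠ x}) : 0 ≤ rootWeights G x w i := by
  unfold rootWeights
  split_ifs with h
  · exact (hw _ (by simpa using h)).le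
  · exact le_rfl

lemma sum_weights (x : V) (w : Sym2 V → ℝ) :
    (∑ i, ∑ j, bulkWeights G x w i j) / 2 + ∑ i, rootWeights G x w i =
      ∑ e ∈ G.edgeFinset, w e := by
  have h := sum_vw G w
  rw [Fintype.sum_eq_add_sum_subtype_ne _ x] at h
  simp_rw [vw_eq_sum] at h
  rw [Fintype.sum_eq_add_sum_subtype_ne _ x] at h
  simp_rw [fun i : {v // v ≠ x} => Fintype.sum_eq_add_sum_subtype_ne
    (fun j => if G.Adj i.1 j then w s(i.1, j) else 0) x] at h
  rw [Finset.sum_add_distrib] at h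
  have e1 : ∑ i : {v // v ≠ x}, (if G.Adj x i.1 then w s(x, i.1) else 0) =
      ∑ i, rootWeights G x w i := by
    refine Finset.sum_congr rfl fun i _ => ?_
    rw [rootWeights, Sym2.eq_swap]
    simp only [G.adj_comm x]
  rw [e1] at h
  have h' : 0 + ∑ i, rootWeights G x w i + (∑ i, rootWeights G x w i +
      ∑ i, ∑ j, bulkWeights G x w i j) = 2 * ∑ e ∈ G.edgeFinset, w e := by
    rw [← h]
    simp [rootWeights, bulkWeights]
  linarith

/-- The magic-formula density without its normalizing constant. -/
def rawDensity (G : SimpleGraph V) [DecidableRel G.Adj] (x : V) (B : Sym2 V → ℝ)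
    (w : Sym2 V → ℝ) : ℝ :=
  (vw G w x) ^ ((1 : ℝ) / 2) * (∏ e ∈ G.edgeFinset, w e ^ (B e - 1)) /
      (∏ v : V, (vw G w v) ^ ((vw G B v + 1) / 2)) * √(tau G w)

lemma magicDensity_eq (x : V) (B w : Sym2 V → ℝ) :
    magicDensity G x B w = (Znorm G x B)⁻¹ * rawDensity G x B w := by
  unfold magicDensity rawDensity
  ring

lemma rawDensity_eq (x : V) (B : Sym2 V → ℝ) {w : Sym2 V → ℝ} (hw : ∀ v, 0 < vw G w v) :
    rawDensity G x B w = (∏ e ∈ G.edgeFinset, w e ^ (B e - 1)) * √(tau G w) *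
      ∏ v, vw G w v ^ (-bwt G x B v) := by
  have h : ∏ v, vw G w v ^ (-bwt G x B v) =
      vw G w x ^ ((1 : ℝ) / 2) * (∏ v, vw G w v ^ ((vw G B v + 1) / 2))⁻¹ := by
    rw [Fintype.prod_eq_mul_prod_subtype_ne _ x,
      Fintype.prod_eq_mul_prod_subtype_ne (fun v => vw G w v ^ ((vw G B v + 1) / 2)) x, mul_inv,
      ← mul_assoc, ← rpow_neg (hw x).le, ← rpow_add (hw x), ← Finset.prod_inv_distrib]
    congr 1
    · congr 1
      simp [bwt]
      ring
    · refine Finset.prod_congr rfl fun v _ => ?_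
      rw [← rpow_neg (hw v).le]
      simp [bwt, v.2]
  rw [h, rawDensity]
  ring

lemma Znorm_pos (hG : G.Connected) {e0 : Sym2 V} (he0 : e0 ∈ G.edgeFinset) (x : V)
    {B : Sym2 V → ℝ} (hB : ∀ e ∈ G.edgeFinset, 0 < B e) : 0 < Znorm G x B := by
  have h1 : 0 < ∏ e ∈ G.edgeFinset, Gamma (B e) :=
    Finset.prod_pos fun e he => Gamma_pos_of_pos (hB e he)
  have h2 : 0 < ∏ v, Gamma (bwt G x B v) :=
    Finset.prod_pos fun v _ => Gamma_pos_of_pos (bwt_pos hG he0 hB x v)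
  unfold Znorm
  positivity

lemma lintegral_edge_gamma {e0 : Sym2 V} (he0 : e0 ∈ G.edgeFinset) {B : Sym2 V → ℝ}
    (hB : ∀ e ∈ G.edgeFinset, 0 < B e) :
    ∫⁻ u, ∫⁻ t, ENNReal.ofReal (∏ e ∈ G.edgeFinset, edgeExt G e0 t u e ^ (B e - 1) *
        exp (-edgeExt G e0 t u e)) ∂posMeas ∂orthant (Epin G e0) =
      ENNReal.ofReal (∏ e ∈ G.edgeFinset, Gamma (B e)) := by
  have h0 := lintegral_posMeas_gamma (hB e0 he0) one_pos
  simp only [one_mul, one_rpow, mul_one] at h0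
  calc _ = ∫⁻ u, ENNReal.ofReal (Gamma (B e0)) * ENNReal.ofReal
        (∏ e : Epin G e0, u e ^ (B e - 1) * exp (-u e)) ∂orthant (Epin G e0) := by
        refine lintegral_congr_ae ?_
        filter_upwards [ae_orthant (Epin G e0)] with u hu
        have hpos : 0 ≤ ∏ e : Epin G e0, u e ^ (B e - 1) * exp (-u e) :=
          Finset.prod_nonneg fun e _ => by have := hu e; positivity
        rw [← h0, mul_comm, ← lintegral_const_mul' _ _ ENNReal.ofReal_ne_top]
        refine lintegral_congr fun t => ?_
        rw [← ENNReal.ofReal_mul hpos, prod_edgeFinset_eq he0]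
        simp only [edgeExt_self, edgeExt_coe]
        rw [mul_comm]
    _ = _ := by
      rw [lintegral_const_mul' _ _ ENNReal.ofReal_ne_top,
        lintegral_orthant_gamma (β := fun e : Epin G e0 => B e) (fun e => hB e e.2.1),
        ← ENNReal.ofReal_mul (Gamma_pos_of_pos (hB e0 he0)).le, prod_edgeFinset_eq he0]

lemma measurable_gammaKernel {α : Type*} [MeasurableSpace α] (x : V) (β : V → ℝ) {c : α → V → ℝ}
    {r : α → ℝ} {s : α → {v // v ≠ x} → ℝ} (hc : ∀ v, Measurable fun a => c a v)
    (hr : Measurable r) (hs : Measurable s) :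
    Measurable fun a => gammaKernel x β (c a) (r a) (s a) := by
  unfold gammaKernel
  fun_prop

lemma lintegral_substitution {e0 : Sym2 V} (he0 : e0 ∈ G.edgeFinset) (x : V) (B : Sym2 V → ℝ)
    {s : {v // v ≠ x} → ℝ} (hs : ∀ i, 0 < s i) :
    ∫⁻ r, ∫⁻ u, ENNReal.ofReal ((∏ e ∈ G.edgeFinset, pinExt G e0 u e ^ (B e - 1)) *
        √(tau G (pinExt G e0 u)) * gammaKernel x (bwt G x B) (vw G (pinExt G e0 u)) r s)
        ∂orthant (Epin G e0) ∂posMeas =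
      ∫⁻ t, ∫⁻ u, ENNReal.ofReal (√2 ^ Fintype.card {v // v ≠ x} *
        2 ^ (-∑ e ∈ G.edgeFinset, B e) *
        ((∏ e ∈ G.edgeFinset, edgeExt G e0 t u e ^ (B e - 1)) *
          envDensity (bulkWeights G x (edgeExt G e0 t u)) (rootWeights G x (edgeExt G e0 t u)) s))
        ∂orthant (Epin G e0) ∂posMeas := by
  have hS : ∀ e, 0 < 2 * sprod (rootExt x s) e := fun e =>
    mul_pos two_pos (sprod_pos (rootExt_pos hs) e)
  set S : Sym2 V → ℝ := fun e => 2 * sprod (rootExt x s) e with hSdef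
  have hS0 : 0 < S e0 := hS e0
  rw [lintegral_posMeas_scale (c := 1 / S e0) (by positivity),
    ← lintegral_const_mul' _ _ ENNReal.ofReal_ne_top]
  refine lintegral_congr_ae ?_
  filter_upwards [ae_posMeas] with t ht
  have hκ : 0 < S e0 / t := div_pos hS0 ht
  have hm : Measurable fun u : Epin G e0 → ℝ =>
      ENNReal.ofReal ((∏ e ∈ G.edgeFinset, pinExt G e0 u e ^ (B e - 1)) *
        √(tau G (pinExt G e0 u)) * gammaKernel x (bwt G x B) (vw G (pinExt G e0 u))
          (1 / S e0 * t) s) := by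
    have hp : Measurable fun u : Epin G e0 → ℝ => pinExt G e0 u :=
      measurable_edgeExt measurable_const measurable_id
    refine ENNReal.measurable_ofReal.comp (Measurable.mul (Measurable.mul ?_ ?_) ?_)
    · exact Finset.measurable_prod _ fun e _ => ((measurable_pi_apply e).comp hp).pow_const _
    · exact (measurable_tau.comp hp).sqrt
    · exact measurable_gammaKernel x _ (fun v => (measurable_vw v).comp hp) measurable_const
        measurable_const
  rw [lintegral_orthant_scale (c := fun e : Epin G e0 => S e0 / t / S e)
    (fun e => div_pos hκ (hS e)) hm, ← lintegral_const_mul' _ _ ENNReal.ofReal_ne_top,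
    ← lintegral_const_mul' _ _ ENNReal.ofReal_ne_top]
  refine lintegral_congr_ae ?_
  filter_upwards [ae_orthant (Epin G e0)] with u hu
  have hw : ∀ e ∈ G.edgeFinset, 0 < edgeExt G e0 t u e := (forall_edgeExt_pos he0).2 ⟨ht, hu⟩
  have hpin : pinExt G e0 (fun e => S e0 / t / S e * u e) =
      envOf x (S e0 / t) s (edgeExt G e0 t u) := by
    ext e
    rw [pinExt_eq_edgeExt]
    by_cases h1 : e = e0
    · rw [h1, edgeExt_self, envOf, edgeExt_self]
      change 1 = S e0 / t * (t / S e0)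
      field_simp
    by_cases h2 : e ∈ G.edgeFinset
    · have e1 := edgeExt_coe e0 1 (fun e => S e0 / t / S e * u e) ⟨e, h2, h1⟩
      have e2 := edgeExt_coe e0 t u ⟨e, h2, h1⟩
      simp only at e1 e2
      rw [e1, envOf, e2]
      change S e0 / t / S e * _ = S e0 / t * (_ / S e)
      ring
    · have e1 : ∀ t (u : Epin G e0 → ℝ), edgeExt G e0 t u e = 0 := fun t u => by
        simp only [edgeExt, h1, h2, if_false, false_and, dif_neg, not_false_eq_true]
      rw [e1, envOf, e1]
      simp
  have hprod : 1 / S e0 * ∏ e : Epin G e0, S e0 / t / S e =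
      (S e0 / t)⁻¹ * ∏ e ∈ G.edgeFinset, S e0 / t / S e := by
    rw [prod_edgeFinset_eq he0]
    field_simp
  have hpp : 0 ≤ ∏ e : Epin G e0, S e0 / t / S e :=
    Finset.prod_nonneg fun e _ => (div_pos hκ (hS e)).le
  rw [hpin, ← ENNReal.ofReal_mul hpp, ← ENNReal.ofReal_mul (by positivity), ← mul_assoc, hprod,
    show 1 / S e0 * t = (S e0 / t)⁻¹ by field_simp]
  congr 1
  exact gammaKernel_envOf G B hκ hs hw

theorem lintegral_rawDensity (hG : G.Connected) {e0 : Sym2 V} (he0 : e0 ∈ G.edgeFinset) (x : V)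
    {B : Sym2 V → ℝ} (hB : ∀ e ∈ G.edgeFinset, 0 < B e) :
    ∫⁻ u, ENNReal.ofReal (rawDensity G x B (pinExt G e0 u)) ∂orthant (Epin G e0) =
      ENNReal.ofReal (Znorm G x B) := by
  have hΓ : 0 < ∏ v, Gamma (bwt G x B v) :=
    Finset.prod_pos fun v _ => Gamma_pos_of_pos (bwt_pos hG he0 hB x v)
  set k := Fintype.card {v // v ≠ x} with hk
  set K := √2 ^ k * 2 ^ (-∑ e ∈ G.edgeFinset, B e) with hK
  have hKpos : 0 ≤ K := by positivity
  have hpin : ∀ u : Epin G e0 → ℝ, (∀ e, 0 < u e) → ∀ e ∈ G.edgeFinset, 0 < pinExt G e0 u e :=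
    fun u hu => (forall_edgeExt_pos he0).2 ⟨one_pos, hu⟩
  have main : ENNReal.ofReal (∏ v, Gamma (bwt G x B v)) *
      ∫⁻ u, ENNReal.ofReal (rawDensity G x B (pinExt G e0 u)) ∂orthant (Epin G e0) =
      ENNReal.ofReal (K * √(2 * π) ^ k * ∏ e ∈ G.edgeFinset, Gamma (B e)) := by
    calc _ = ∫⁻ u, ∫⁻ r, ∫⁻ s, ENNReal.ofReal
          ((∏ e ∈ G.edgeFinset, pinExt G e0 u e ^ (B e - 1)) * √(tau G (pinExt G e0 u)) *
            gammaKernel x (bwt G x B) (vw G (pinExt G e0 u)) r s)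
          ∂orthant {v // v ≠ x} ∂posMeas ∂orthant (Epin G e0) := by
          rw [← lintegral_const_mul' _ _ ENNReal.ofReal_ne_top]
          refine lintegral_congr_ae ?_
          filter_upwards [ae_orthant (Epin G e0)] with u hu
          have hw := hpin u hu
          have hc := vw_pos hG he0 hw
          have hA : 0 ≤ (∏ e ∈ G.edgeFinset, pinExt G e0 u e ^ (B e - 1)) *
              √(tau G (pinExt G e0 u)) :=
            mul_nonneg (Finset.prod_nonneg fun e he => rpow_nonneg (hw e he).le _)
              (Real.sqrt_nonneg _)
          simp_rw [ENNReal.ofReal_mul hA]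
          simp_rw [lintegral_const_mul' _ _ ENNReal.ofReal_ne_top]
          rw [lintegral_gammaKernel x (bwt_pos hG he0 hB x) hc, ← ENNReal.ofReal_mul hΓ.le,
            ← ENNReal.ofReal_mul hA, rawDensity_eq x B hc, Finset.prod_mul_distrib]
          congr 1
          ring
      _ = ∫⁻ s, ∫⁻ r, ∫⁻ u, ENNReal.ofReal
          ((∏ e ∈ G.edgeFinset, pinExt G e0 u e ^ (B e - 1)) * √(tau G (pinExt G e0 u)) *
            gammaKernel x (bwt G x B) (vw G (pinExt G e0 u)) r s)
          ∂orthant (Epin G e0) ∂posMeas ∂orthant {v // v ≠ x} := by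
          refine lintegral_lintegral_rotate _ _ _ ?_
          have hp : Measurable fun p : (Epin G e0 → ℝ) × ℝ × ({v // v ≠ x} → ℝ) =>
              pinExt G e0 p.1 := measurable_edgeExt measurable_const measurable_fst
          refine ENNReal.measurable_ofReal.comp (Measurable.mul (Measurable.mul ?_ ?_) ?_)
          · exact Finset.measurable_prod _ fun e _ => ((measurable_pi_apply e).comp hp).pow_const _
          · exact (measurable_tau.comp hp).sqrt
          · exact measurable_gammaKernel x _ (fun v => (measurable_vw v).comp hp)
              (by fun_prop) (by fun_prop)
      _ = ∫⁻ s, ∫⁻ t, ∫⁻ u, ENNReal.ofReal (K *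
          ((∏ e ∈ G.edgeFinset, edgeExt G e0 t u e ^ (B e - 1)) *
          envDensity (bulkWeights G x (edgeExt G e0 t u)) (rootWeights G x (edgeExt G e0 t u)) s))
          ∂orthant (Epin G e0) ∂posMeas ∂orthant {v // v ≠ x} := by
          refine lintegral_congr_ae ?_
          filter_upwards [ae_orthant {v // v ≠ x}] with s hs
          exact lintegral_substitution he0 x B hs
      _ = ∫⁻ u, ∫⁻ t, ∫⁻ s, ENNReal.ofReal (K *
          ((∏ e ∈ G.edgeFinset, edgeExt G e0 t u e ^ (B e - 1)) *
          envDensity (bulkWeights G x (edgeExt G e0 t u)) (rootWeights G x (edgeExt G e0 t u)) s))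
          ∂orthant {v // v ≠ x} ∂posMeas ∂orthant (Epin G e0) := by
          symm
          refine lintegral_lintegral_rotate _ _ _ ?_
          have hp : Measurable fun p : (Epin G e0 → ℝ) × ℝ × ({v // v ≠ x} → ℝ) =>
              edgeExt G e0 p.2.1 p.1 := measurable_edgeExt (by fun_prop) measurable_fst
          refine ENNReal.measurable_ofReal.comp (Measurable.const_mul (Measurable.mul ?_ ?_) _)
          · exact Finset.measurable_prod _ fun e _ => ((measurable_pi_apply e).comp hp).pow_const _
          · refine measurable_envDensity (fun i j => ?_) (fun i => ?_) (fun i => by fun_prop)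
            · unfold bulkWeights
              split_ifs
              · exact measurable_pi_iff.1 hp _
              · exact measurable_const
            · unfold rootWeights
              split_ifs
              · exact measurable_pi_iff.1 hp _
              · exact measurable_const
      _ = ∫⁻ u, ∫⁻ t, ENNReal.ofReal (K * √(2 * π) ^ k) *
          ENNReal.ofReal (∏ e ∈ G.edgeFinset, edgeExt G e0 t u e ^ (B e - 1) *
        exp (-edgeExt G e0 t u e)) ∂posMeas ∂orthant (Epin G e0) := by
          refine lintegral_congr_ae ?_
          filter_upwards [ae_orthant (Epin G e0)] with u hu
          refine lintegral_congr_ae ?_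
          filter_upwards [ae_posMeas] with t ht
          have hw : ∀ e ∈ G.edgeFinset, 0 < edgeExt G e0 t u e :=
            (forall_edgeExt_pos he0).2 ⟨ht, hu⟩
          have hW : 0 ≤ ∏ e ∈ G.edgeFinset, edgeExt G e0 t u e ^ (B e - 1) :=
            Finset.prod_nonneg fun e he => rpow_nonneg (hw e he).le _
          simp_rw [ENNReal.ofReal_mul hKpos, ENNReal.ofReal_mul hW]
          rw [lintegral_const_mul' _ _ ENNReal.ofReal_ne_top,
            lintegral_const_mul' _ _ ENNReal.ofReal_ne_top,
            lintegral_envDensity _ _ (bulkWeights_nonneg x hw) (rootWeights_nonneg x hw)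
              (bulkWeights_symm G _) (linkedToRoot hG x hw), sum_weights,
            ← ENNReal.ofReal_mul hW, ← ENNReal.ofReal_mul hKpos, ← ENNReal.ofReal_mul hKpos,
            ← ENNReal.ofReal_mul (by positivity), Finset.prod_mul_distrib, ← exp_sum,
            Finset.sum_neg_distrib]
          congr 1
          ring
      _ = _ := by
          simp_rw [lintegral_const_mul' _ _ ENNReal.ofReal_ne_top]
          rw [lintegral_edge_gamma he0 hB, ← ENNReal.ofReal_mul (by positivity)]
  have hZ : K * √(2 * π) ^ k * ∏ e ∈ G.edgeFinset, Gamma (B e) =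
      (∏ v, Gamma (bwt G x B v)) * Znorm G x B := by
    have hkr := card_nonroot x
    rw [← hk] at hkr
    unfold Znorm
    rw [show (1 : ℝ) - Fintype.card V + ∑ e ∈ G.edgeFinset, B e =
      -(k : ℝ) + ∑ e ∈ G.edgeFinset, B e by rw [hkr]; ring, ← hkr, rpow_add two_pos,
      rpow_neg two_pos.le, rpow_natCast, hK, rpow_neg two_pos.le, Real.sqrt_mul two_pos.le,
      mul_pow]
    have h2 : (2 : ℝ) ^ k = √2 ^ k * √2 ^ k := by
      rw [← mul_pow, Real.mul_self_sqrt two_pos.le]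
    have hp : π ^ ((k : ℝ) / 2) = √π ^ k := by
      rw [sqrt_eq_rpow, ← rpow_natCast, ← rpow_mul pi_pos.le]
      ring_nf
    rw [hp, h2]
    field_simp
  rw [hZ, ENNReal.ofReal_mul hΓ.le] at main
  exact (ENNReal.mul_right_inj (by simpa using hΓ) ENNReal.ofReal_ne_top).1 main

end Normalization

/-! ### Path recursion -/

section Paths

variable {G : SimpleGraph V} [DecidableRel G.Adj]

/-- Edge weights after one additional traversal of `e₁`. -/
def addEdge (B : Sym2 V → ℝ) (e₁ : Sym2 V) (e : Sym2 V) : ℝ := B e + if e₁ = e then 1 else 0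

lemma vw_addEdge (B : Sym2 V → ℝ) {x y : V} (h : G.Adj x y) (v : V) :
    vw G (addEdge B s(x, y)) v = vw G B v + (if v = x then 1 else 0) + if v = y then 1 else 0 := by
  rw [vw, sum_neighborFinset_eq_sum_edges, vw, sum_neighborFinset_eq_sum_edges]
  have hmem : s(x, y) ∈ G.edgeFinset := by simpa using h
  have e1 : ∀ e, (if v ∈ e then addEdge B s(x, y) e else 0) =
      (if v ∈ e then B e else 0) + if s(x, y) = e then (if v ∈ s(x, y) then 1 else 0) else 0 := by
    intro e
    unfold addEdge
    by_cases h1 : s(x, y) = e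
    · subst h1
      split_ifs <;> simp
    · simp [h1]
  simp_rw [e1]
  rw [Finset.sum_add_distrib, Finset.sum_ite_eq, if_pos hmem, add_assoc]
  congr 1
  have hne := h.ne
  by_cases hx : v = x
  · have : v ≠ y := fun hy => hne (hx.symm.trans hy)
    simp [hx, hne]
  · simp [hx]

lemma bwt_addEdge (B : Sym2 V → ℝ) {x y : V} (h : G.Adj x y) (v : V) :
    bwt G y (addEdge B s(x, y)) v = bwt G x B v + if v = x then 1 else 0 := by
  unfold bwt
  rw [vw_addEdge B h]
  ring

lemma prod_mul_ite_eq {α : Type*} {s : Finset α} [DecidableEq α] {a : α} (ha : a ∈ s)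
    (f : α → ℝ) (c : ℝ) : ∏ i ∈ s, f i * (if a = i then c else 1) = (∏ i ∈ s, f i) * c := by
  rw [Finset.prod_mul_distrib, Finset.prod_ite_eq, if_pos ha]

lemma rawDensity_addEdge (B : Sym2 V → ℝ) {x y : V} (h : G.Adj x y) {w : Sym2 V → ℝ}
    (hw : ∀ e ∈ G.edgeFinset, 0 < w e) (hv : ∀ v, 0 < vw G w v) :
    rawDensity G y (addEdge B s(x, y)) w = rawDensity G x B w * (w s(x, y) / vw G w x) := by
  have hmem : s(x, y) ∈ G.edgeFinset := by simpa using h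
  rw [rawDensity_eq y _ hv, rawDensity_eq x _ hv]
  have e1 : ∏ e ∈ G.edgeFinset, w e ^ (addEdge B s(x, y) e - 1) =
      (∏ e ∈ G.edgeFinset, w e ^ (B e - 1)) * w s(x, y) := by
    rw [← prod_mul_ite_eq hmem]
    refine Finset.prod_congr rfl fun e he => ?_
    unfold addEdge
    split_ifs with h1
    · subst h1
      rw [← rpow_add_one (hw _ he).ne']
      ring_nf
    · simp
  have e2 : ∏ v, vw G w v ^ (-bwt G y (addEdge B s(x, y)) v) =
      (∏ v, vw G w v ^ (-bwt G x B v)) * (vw G w x)⁻¹ := by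
    rw [← prod_mul_ite_eq (Finset.mem_univ x)]
    refine Finset.prod_congr rfl fun v _ => ?_
    rw [bwt_addEdge B h]
    by_cases h1 : v = x
    · subst h1
      rw [if_pos rfl, if_pos rfl, neg_add, rpow_add (hv v), rpow_neg_one]
    · rw [if_neg h1, if_neg (Ne.symm h1)]
      simp
  rw [e1, e2]
  ring

lemma Znorm_addEdge (hG : G.Connected) {B : Sym2 V → ℝ} (hB : ∀ e ∈ G.edgeFinset, 0 < B e)
    {x y : V} (h : G.Adj x y) :
    Znorm G y (addEdge B s(x, y)) = Znorm G x B * (B s(x, y) / vw G B x) := by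
  have hmem : s(x, y) ∈ G.edgeFinset := by simpa using h
  have hb := bwt_pos hG hmem hB x
  have hvx := vw_pos hG hmem hB x
  have e1 : ∏ e ∈ G.edgeFinset, Gamma (addEdge B s(x, y) e) =
      (∏ e ∈ G.edgeFinset, Gamma (B e)) * B s(x, y) := by
    rw [← prod_mul_ite_eq hmem]
    refine Finset.prod_congr rfl fun e he => ?_
    unfold addEdge
    split_ifs with h1
    · subst h1
      rw [Gamma_add_one (hB _ he).ne', mul_comm]
    · simp
  have e2 : ∏ v, Gamma (bwt G y (addEdge B s(x, y)) v) =
      (∏ v, Gamma (bwt G x B v)) * (vw G B x / 2) := by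
    rw [← prod_mul_ite_eq (Finset.mem_univ x)]
    refine Finset.prod_congr rfl fun v _ => ?_
    rw [bwt_addEdge B h]
    by_cases h1 : v = x
    · subst h1
      rw [if_pos rfl, if_pos rfl, Gamma_add_one (hb v).ne', mul_comm]
      congr 1
      simp [bwt]
    · rw [if_neg h1, if_neg (Ne.symm h1)]
      simp
  have e3 : ∑ e ∈ G.edgeFinset, addEdge B s(x, y) e = ∑ e ∈ G.edgeFinset, B e + 1 := by
    unfold addEdge
    rw [Finset.sum_add_distrib, Finset.sum_ite_eq, if_pos hmem]
  unfold Znorm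
  rw [e1, e2, e3, ← add_assoc, rpow_add_one two_ne_zero]
  have h2 : ∏ v, Gamma (bwt G x B v) ≠ 0 :=
    (Finset.prod_pos fun v _ => Gamma_pos_of_pos (hb v)).ne'
  have h3 : (2 : ℝ) ^ ((1 : ℝ) - Fintype.card V + ∑ e ∈ G.edgeFinset, B e) ≠ 0 := by positivity
  field_simp

lemma localTime_zero (a : Sym2 V → ℝ) (y : ℕ → V) : localTime a y 0 = a := by
  ext e; simp [localTime]

lemma localTime_succ (a : Sym2 V → ℝ) (y : ℕ → V) (t : ℕ) :
    localTime a y (t + 1) = addEdge (localTime a y t) s(y t, y (t + 1)) := by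
  ext e
  unfold localTime addEdge
  rw [Finset.range_add_one, Finset.filter_insert, add_assoc]
  congr 1
  split_ifs
  · rw [Finset.card_insert_of_notMem (by simp)]
    push_cast
    ring
  · simp

lemma localTime_pos {a : Sym2 V → ℝ} (ha : ∀ e ∈ G.edgeFinset, 0 < a e) (y : ℕ → V) (t : ℕ) :
    ∀ e ∈ G.edgeFinset, 0 < localTime a y t e := fun e he =>
  add_pos_of_pos_of_nonneg (ha e he) (Nat.cast_nonneg _)

lemma rawDensity_mul_prod_qstep {a w : Sym2 V → ℝ} (hw : ∀ e ∈ G.edgeFinset, 0 < w e)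
    (hv : ∀ v, 0 < vw G w v) (y : ℕ → V) (t : ℕ) (hy : ∀ k < t, G.Adj (y k) (y (k + 1))) :
    rawDensity G (y 0) a w * ∏ k ∈ Finset.range t, qstep G w (y k) (y (k + 1)) =
      rawDensity G (y t) (localTime a y t) w := by
  induction t with
  | zero => simp [localTime_zero]
  | succ t ih =>
    have h := hy t (Nat.lt_succ_self t)
    rw [Finset.prod_range_succ, ← mul_assoc, ih fun k hk => hy k (hk.trans (Nat.lt_succ_self t)),
      localTime_succ, rawDensity_addEdge _ h hw hv, qstep, if_pos h]

lemma Znorm_mul_prod_errwStep (hG : G.Connected) {a : Sym2 V → ℝ}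
    (ha : ∀ e ∈ G.edgeFinset, 0 < a e) (y : ℕ → V) (t : ℕ)
    (hy : ∀ k < t, G.Adj (y k) (y (k + 1))) :
    Znorm G (y 0) a * ∏ k ∈ Finset.range t, errwStep G a y k =
      Znorm G (y t) (localTime a y t) := by
  induction t with
  | zero => simp [localTime_zero]
  | succ t ih =>
    have h := hy t (Nat.lt_succ_self t)
    rw [Finset.prod_range_succ, ← mul_assoc, ih fun k hk => hy k (hk.trans (Nat.lt_succ_self t)),
      localTime_succ, Znorm_addEdge hG (localTime_pos ha y t) h, errwStep, if_pos h]
    rfl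

/-- A finite path started at `v0` all of whose steps are along edges. -/
def IsPathFrom (G : SimpleGraph V) (v0 : V) {T : ℕ} (x : Fin (T + 1) → V) : Prop :=
  x 0 = v0 ∧ ∀ k < T, G.Adj (extendPath v0 x k) (extendPath v0 x (k + 1))

lemma extendPath_zero {T : ℕ} (v0 : V) (x : Fin (T + 1) → V) : extendPath v0 x 0 = x 0 := by
  simp [extendPath]

lemma errwProb_of_not_isPathFrom {v0 : V} {T : ℕ} {x : Fin (T + 1) → V}
    (hx : ¬IsPathFrom G v0 x) (a : Sym2 V → ℝ) : errwProb G v0 a T x = 0 := by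
  unfold errwProb
  split_ifs with h0
  · simp only [IsPathFrom, h0, true_and, not_forall] at hx
    obtain ⟨k, hk, hadj⟩ := hx
    refine Finset.prod_eq_zero (Finset.mem_range.2 hk) ?_
    rw [errwStep, if_neg hadj]
  · rfl

lemma quenchedProb_of_not_isPathFrom {v0 : V} {T : ℕ} {x : Fin (T + 1) → V}
    (hx : ¬IsPathFrom G v0 x) (w : Sym2 V → ℝ) : quenchedProb G v0 w T x = 0 := by
  unfold quenchedProb
  split_ifs with h0
  · simp only [IsPathFrom, h0, true_and, not_forall] at hx
    obtain ⟨k, hk, hadj⟩ := hx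
    refine Finset.prod_eq_zero (Finset.mem_range.2 hk) ?_
    rw [qstep, if_neg hadj]
  · rfl

lemma errwProb_eq (hG : G.Connected) {e0 : Sym2 V} (he0 : e0 ∈ G.edgeFinset) {a : Sym2 V → ℝ}
    (ha : ∀ e ∈ G.edgeFinset, 0 < a e) {v0 : V} {T : ℕ} {x : Fin (T + 1) → V}
    (hx : IsPathFrom G v0 x) :
    errwProb G v0 a T x = Znorm G (extendPath v0 x T) (localTime a (extendPath v0 x) T) /
      Znorm G v0 a := by
  have h := Znorm_mul_prod_errwStep hG ha (extendPath v0 x) T hx.2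
  have hZ := Znorm_pos hG he0 v0 ha
  rw [extendPath_zero, hx.1] at h
  rw [errwProb, if_pos hx.1, ← h]
  field_simp

lemma quenchedProb_mul_magicDensity (hG : G.Connected) {e0 : Sym2 V} (he0 : e0 ∈ G.edgeFinset)
    {a w : Sym2 V → ℝ} (hw : ∀ e ∈ G.edgeFinset, 0 < w e) {v0 : V} {T : ℕ}
    {x : Fin (T + 1) → V} (hx : IsPathFrom G v0 x) :
    quenchedProb G v0 w T x * magicDensity G v0 a w = (Znorm G v0 a)⁻¹ *
      rawDensity G (extendPath v0 x T) (localTime a (extendPath v0 x) T) w := by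
  have h := rawDensity_mul_prod_qstep (a := a) hw (vw_pos hG he0 hw) (extendPath v0 x) T hx.2
  rw [extendPath_zero, hx.1] at h
  rw [quenchedProb, if_pos hx.1, ← h, magicDensity_eq]
  ring

lemma quenchedProb_nonneg {w : Sym2 V → ℝ} (hw : ∀ e ∈ G.edgeFinset, 0 < w e)
    (hv : ∀ v, 0 < vw G w v) (v0 : V) (T : ℕ) (x : Fin (T + 1) → V) :
    0 ≤ quenchedProb G v0 w T x := by
  unfold quenchedProb
  split_ifs
  · refine Finset.prod_nonneg fun t _ => ?_
    unfold qstep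
    split_ifs with h
    · exact div_nonneg (hw _ (by simpa using h)).le (hv _).le
    · exact le_rfl
  · exact le_rfl

lemma errwProb_nonneg (hG : G.Connected) {e0 : Sym2 V} (he0 : e0 ∈ G.edgeFinset) {a : Sym2 V → ℝ}
    (ha : ∀ e ∈ G.edgeFinset, 0 < a e) (v0 : V) (T : ℕ) (x : Fin (T + 1) → V) :
    0 ≤ errwProb G v0 a T x := by
  by_cases hx : IsPathFrom G v0 x
  · rw [errwProb_eq hG he0 ha hx]
    exact div_nonneg (Znorm_pos hG he0 _ (localTime_pos ha _ _)).le (Znorm_pos hG he0 _ ha).le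
  · rw [errwProb_of_not_isPathFrom hx]

lemma sum_prod_transition (Q : V → V → ℝ) (hQ : ∀ i, ∑ j, Q i j = 1) (T : ℕ) (i : V) :
    ∑ x : Fin (T + 1) → V, (if x 0 = i then ∏ t : Fin T, Q (x t.castSucc) (x t.succ) else 0) =
      1 := by
  induction T generalizing i with
  | zero =>
    rw [← (Equiv.funUnique (Fin 1) V).symm.sum_comp]
    simp
  | succ T ih =>
    rw [← (Fin.consEquiv fun _ : Fin (T + 2) => V).sum_comp, Fintype.sum_prod_type]
    simp only [Fin.consEquiv, Equiv.coe_fn_mk, Fin.cons_zero]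
    rw [Finset.sum_eq_single i (fun j _ hj => by simp [hj]) (by simp)]
    simp only [if_true, Fin.prod_univ_succ, Fin.castSucc_zero, Fin.cons_zero, Fin.cons_succ,
      ← Fin.succ_castSucc]
    calc _ = ∑ x : Fin (T + 1) → V, ∑ j, Q i j *
          (if x 0 = j then ∏ t : Fin T, Q (x t.castSucc) (x t.succ) else 0) := by
          refine Finset.sum_congr rfl fun x _ => ?_
          simp
      _ = 1 := by
          rw [Finset.sum_comm]
          simp_rw [← Finset.mul_sum, ih, mul_one]
          exact hQ i

lemma sum_quenchedProb {w : Sym2 V → ℝ} (hv : ∀ v, 0 < vw G w v) (v0 : V) (T : ℕ) :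
    ∑ x : Fin (T + 1) → V, quenchedProb G v0 w T x = 1 := by
  rw [← sum_prod_transition (qstep G w) (fun i => ?_) T v0]
  · refine Finset.sum_congr rfl fun x _ => ?_
    unfold quenchedProb
    split_ifs
    · rw [← Fin.prod_univ_eq_prod_range
        (fun t => qstep G w (extendPath v0 x t) (extendPath v0 x (t + 1)))]
      refine Finset.prod_congr rfl fun t _ => ?_
      have h1 : (t : ℕ) < T + 1 := by omega
      have h2 : (t : ℕ) + 1 < T + 1 := by omega
      simp only [extendPath, h1, h2, dif_pos]
      rfl
    · rfl
  · have h : ∑ j, qstep G w i j = (∑ j, if G.Adj i j then w s(i, j) else 0) / vw G w i := by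
      rw [Finset.sum_div]
      refine Finset.sum_congr rfl fun j _ => ?_
      unfold qstep
      split_ifs <;> simp
    rw [h, ← vw_eq_sum, div_self (hv i).ne']

lemma quenchedProb_le_one {w : Sym2 V → ℝ} (hw : ∀ e ∈ G.edgeFinset, 0 < w e)
    (hv : ∀ v, 0 < vw G w v) (v0 : V) (T : ℕ) (x : Fin (T + 1) → V) :
    quenchedProb G v0 w T x ≤ 1 := by
  rw [← sum_quenchedProb hv v0 T]
  exact Finset.single_le_sum (f := fun x => quenchedProb G v0 w T x)
    (fun x _ => quenchedProb_nonneg hw hv v0 T x) (Finset.mem_univ x)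

lemma measurable_quenchedProb (v0 : V) (T : ℕ) (x : Fin (T + 1) → V) :
    Measurable fun w : Sym2 V → ℝ => quenchedProb G v0 w T x := by
  unfold quenchedProb qstep
  split_ifs
  · refine Finset.measurable_prod _ fun t _ => ?_
    split_ifs
    · exact (measurable_pi_apply _).div (measurable_vw _)
    · exact measurable_const
  · exact measurable_const

end Paths

/-! ### Second differences of `log Γ` -/

section LogGamma

/-- The curvature bound `1/m + 1/m²` for `log Γ` on `[m, ∞)`. -/
def curvBound (m : ℝ) : ℝ := 1 / m + 1 / m ^ 2

lemma curvBound_nonneg {m : ℝ} (hm : 0 < m) : 0 ≤ curvBound m := by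
  unfold curvBound; positivity

lemma concaveOn_neg_log_shift {m : ℝ} (hm : 0 < m) {k : ℝ} (hk : 0 ≤ k) :
    ConcaveOn ℝ (Set.Ici m) fun x => -Real.log (x + k) - 1 / (m + k) ^ 2 * x ^ 2 / 2 := by
  have hpos : ∀ x ∈ Set.Ici m, 0 < x + k := fun x hx => by
    have : m ≤ x := hx
    linarith
  have hd : ∀ x ∈ Set.Ici m, HasDerivAt
      (fun x => -Real.log (x + k) - 1 / (m + k) ^ 2 * x ^ 2 / 2)
      (-(x + k)⁻¹ - 1 / (m + k) ^ 2 * x) x := fun x hx => by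
    have h1 := ((hasDerivAt_id x).add_const k).log (hpos x hx).ne'
    have h2 := ((hasDerivAt_pow 2 x).const_mul (1 / (m + k) ^ 2)).div_const 2
    refine (h1.neg.sub h2).congr_deriv ?_
    simp
    ring
  refine concaveOn_of_hasDerivWithinAt2_nonpos (f' := fun x => -(x + k)⁻¹ - 1 / (m + k) ^ 2 * x)
    (f'' := fun x => 1 / (x + k) ^ 2 - 1 / (m + k) ^ 2) (convex_Ici m)
    (fun x hx => (hd x hx).continuousAt.continuousWithinAt)
    (fun x hx => (hd x (interior_subset hx)).hasDerivWithinAt) (fun x hx => ?_) fun x hx => ?_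
  · have hx' := hpos x (interior_subset hx)
    have h1 := ((hasDerivAt_id x).add_const k).inv hx'.ne'
    have h2 := (hasDerivAt_id x).const_mul (1 / (m + k) ^ 2)
    refine ((h1.neg.sub h2).congr_deriv ?_).hasDerivWithinAt
    simp
    ring
  · have hx' : m ≤ x := interior_subset hx
    rw [sub_nonpos]
    gcongr

lemma sum_inv_sq_shift_le {m : ℝ} (hm : 0 < m) (n : ℕ) :
    ∑ k ∈ Finset.range (n + 1), 1 / (m + k) ^ 2 ≤ curvBound m := by
  have h : ∑ k ∈ Finset.range (n + 1), 1 / (m + k) ^ 2 ≤ curvBound m - 1 / (m + n) := by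
    induction n with
    | zero => simp [curvBound]
    | succ n ih =>
      rw [Finset.sum_range_succ]
      have h1 : 0 < m + n := by positivity
      have h2 : 1 / (m + ((n + 1 : ℕ) : ℝ)) ^ 2 ≤ 1 / (m + n) - 1 / (m + ((n + 1 : ℕ) : ℝ)) := by
        push_cast
        have h3 : 0 < m + (n + 1 : ℝ) := by positivity
        rw [div_sub_div _ _ h1.ne' h3.ne', div_le_div_iff₀ (by positivity) (by positivity)]
        nlinarith
      linarith
  have : 0 ≤ 1 / (m + n) := by positivity
  linarith

lemma concaveOn_log_Gamma_sub {m : ℝ} (hm : 0 < m) :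
    ConcaveOn ℝ (Set.Ici m) fun x => Real.log (Real.Gamma x) - curvBound m * x ^ 2 / 2 := by
  have key : ∀ n : ℕ, ConcaveOn ℝ (Set.Ici m) fun x =>
      Real.BohrMollerup.logGammaSeq x n - curvBound m * x ^ 2 / 2 := fun n => by
    have h1 : ConcaveOn ℝ (Set.Ici m) fun x : ℝ => x * Real.log n + Real.log (n.factorial) := by
      refine ⟨convex_Ici m, fun x _ y _ a b _ _ hab => le_of_eq ?_⟩
      simp only [smul_eq_mul]
      linear_combination (Real.log (n.factorial)) * hab
    have h2 : ConcaveOn ℝ (Set.Ici m) fun x : ℝ => ∑ k ∈ Finset.range (n + 1),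
        (-Real.log (x + k) - 1 / (m + k) ^ 2 * x ^ 2 / 2) := by
      have : ∀ s : Finset ℕ, ConcaveOn ℝ (Set.Ici m) fun x : ℝ => ∑ k ∈ s,
        (-Real.log (x + k) - 1 / (m + k) ^ 2 * x ^ 2 / 2) := fun s => by
        induction s using Finset.induction_on with
        | empty => simpa using concaveOn_const (0 : ℝ) (convex_Ici m)
        | insert i s hi ih =>
          simp_rw [Finset.sum_insert hi]
          exact (concaveOn_neg_log_shift hm i.cast_nonneg).add ih
      exact this _
    have h3 : ConcaveOn ℝ (Set.Ici m) fun x : ℝ =>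
        -((curvBound m - ∑ k ∈ Finset.range (n + 1), 1 / (m + k) ^ 2) / 2 * x ^ 2) := by
      have hc := sub_nonneg.2 (sum_inv_sq_shift_le hm n)
      have := (((Even.convexOn_pow (𝕜 := ℝ) even_two).subset (Set.subset_univ _)
        (convex_Ici m)).smul (div_nonneg hc zero_le_two)).neg
      exact this
    refine ((h1.add h2).add h3).congr fun x _ => ?_
    simp only [Real.BohrMollerup.logGammaSeq, Pi.add_apply, Finset.sum_sub_distrib,
      Finset.sum_neg_distrib, ← Finset.sum_mul, ← Finset.sum_div]
    ring
  refine ⟨convex_Ici m, fun x hx y hy a b ha hb hab => ?_⟩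
  have hlim : ∀ z ∈ Set.Ici m, Tendsto (fun n => Real.BohrMollerup.logGammaSeq z n -
      curvBound m * z ^ 2 / 2) atTop
      (nhds (Real.log (Real.Gamma z) - curvBound m * z ^ 2 / 2)) := fun z hz =>
    (Real.BohrMollerup.tendsto_log_gamma (hm.trans_le hz)).sub_const _
  exact le_of_tendsto_of_tendsto' (((hlim x hx).const_smul a).add ((hlim y hy).const_smul b))
    (hlim _ (convex_Ici m hx hy ha hb hab)) fun n => (key n).2 hx hy ha hb hab

/-- Rescaled form of Jensen's inequality at the point `p` between `p - ε d` and `p + d`. -/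
lemma second_difference_nonneg {s : Set ℝ} {f : ℝ → ℝ} (hf : ConvexOn ℝ s f) {p d ε : ℝ}
    (hε : 0 < ε) (h1 : p + d ∈ s) (h2 : p - ε * d ∈ s) :
    0 ≤ f (p - ε * d) - f p + ε * (f (p + d) - f p) := by
  have h := hf.2 h2 h1 (by positivity : 0 ≤ 1 / (1 + ε)) (by positivity : 0 ≤ ε / (1 + ε))
    (by field_simp)
  have e : (1 / (1 + ε)) • (p - ε * d) + (ε / (1 + ε)) • (p + d) = p := by
    simp only [smul_eq_mul]; field_simp; ring
  rw [e, smul_eq_mul, smul_eq_mul, div_mul_eq_mul_div, div_mul_eq_mul_div, ← add_div,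
    le_div_iff₀ (by positivity)] at h
  linarith

lemma log_Gamma_second_difference_le {m : ℝ} (hm : 0 < m) {p d ε : ℝ} (hε : 0 < ε)
    (h1 : m ≤ p + d) (h2 : m ≤ p - ε * d) :
    Real.log (Real.Gamma (p - ε * d)) - Real.log (Real.Gamma p) +
        ε * (Real.log (Real.Gamma (p + d)) - Real.log (Real.Gamma p)) ≤
      ε * (1 + ε) * (d ^ 2 * curvBound m / 2) := by
  have h := second_difference_nonneg (concaveOn_log_Gamma_sub hm).neg hε h1 h2
  simp only [Pi.neg_apply] at h
  nlinarith

end LogGamma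

section LogPartition

variable {G : SimpleGraph V} [DecidableRel G.Adj]

lemma log_Znorm (hG : G.Connected) {e0 : Sym2 V} (he0 : e0 ∈ G.edgeFinset) (x : V)
    {B : Sym2 V → ℝ} (hB : ∀ e ∈ G.edgeFinset, 0 < B e) :
    Real.log (Znorm G x B) = ∑ e ∈ G.edgeFinset, Real.log (Real.Gamma (B e)) -
      ∑ v, Real.log (Real.Gamma (bwt G x B v)) +
      ((Fintype.card V : ℝ) - 1) / 2 * Real.log Real.pi -
      (1 - (Fintype.card V : ℝ) + ∑ e ∈ G.edgeFinset, B e) * Real.log 2 := by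
  have h1 : ∀ e ∈ G.edgeFinset, Real.Gamma (B e) ≠ 0 := fun e he => (Gamma_pos_of_pos (hB e he)).ne'
  have h2 : ∀ v ∈ Finset.univ, Real.Gamma (bwt G x B v) ≠ 0 := fun v _ =>
    (Gamma_pos_of_pos (bwt_pos hG he0 hB x v)).ne'
  have h3 := Finset.prod_ne_zero_iff.2 h1
  have h4 := Finset.prod_ne_zero_iff.2 h2
  rw [Znorm, Real.log_div (by positivity) (by positivity), Real.log_mul (by positivity)
    (by positivity), Real.log_div h3 h4, Real.log_prod h1, Real.log_prod h2,
    Real.log_rpow Real.pi_pos, Real.log_rpow two_pos]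

lemma log_Znorm_second_difference_le (hG : G.Connected) {e0 : Sym2 V} (he0 : e0 ∈ G.edgeFinset)
    (x : V) {B D m : Sym2 V → ℝ} {ε : ℝ} (hε : 0 < ε) (hm : ∀ e ∈ G.edgeFinset, 0 < m e)
    (hB : ∀ e ∈ G.edgeFinset, 0 < B e)
    (h1 : ∀ e ∈ G.edgeFinset, m e ≤ B e + D e) (h2 : ∀ e ∈ G.edgeFinset, m e ≤ B e - ε * D e) :
    Real.log (Znorm G x fun e => B e - ε * D e) - Real.log (Znorm G x B) +
        ε * (Real.log (Znorm G x fun e => B e + D e) - Real.log (Znorm G x B)) ≤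
      ε * (1 + ε) * ∑ e ∈ G.edgeFinset, D e ^ 2 * curvBound (m e) / 2 := by
  have hB1 : ∀ e ∈ G.edgeFinset, 0 < B e + D e := fun e he => (hm e he).trans_le (h1 e he)
  have hB2 : ∀ e ∈ G.edgeFinset, 0 < B e - ε * D e := fun e he => (hm e he).trans_le (h2 e he)
  have hE : ∑ e ∈ G.edgeFinset, (Real.log (Real.Gamma (B e - ε * D e)) -
        Real.log (Real.Gamma (B e)) +
        ε * (Real.log (Real.Gamma (B e + D e)) - Real.log (Real.Gamma (B e)))) ≤
      ε * (1 + ε) * ∑ e ∈ G.edgeFinset, D e ^ 2 * curvBound (m e) / 2 := by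
    rw [Finset.mul_sum]
    exact Finset.sum_le_sum fun e he =>
      log_Gamma_second_difference_le (hm e he) hε (h1 e he) (h2 e he)
  have b1 : ∀ v, bwt G x (fun e => B e + D e) v = bwt G x B v + vw G D v / 2 := fun v => by
    simp only [bwt, vw, Finset.sum_add_distrib]
    ring
  have b2 : ∀ v, bwt G x (fun e => B e - ε * D e) v = bwt G x B v - ε * (vw G D v / 2) := fun v => by
    simp only [bwt, vw, Finset.sum_sub_distrib, ← Finset.mul_sum]
    ring
  have hV : 0 ≤ ∑ v, (Real.log (Real.Gamma (bwt G x (fun e => B e - ε * D e) v)) -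
        Real.log (Real.Gamma (bwt G x B v)) +
        ε * (Real.log (Real.Gamma (bwt G x (fun e => B e + D e) v)) -
          Real.log (Real.Gamma (bwt G x B v)))) := by
    refine Finset.sum_nonneg fun v _ => ?_
    have p1 := bwt_pos hG he0 hB1 x v
    have p2 := bwt_pos hG he0 hB2 x v
    rw [b1] at p1 ⊢
    rw [b2] at p2 ⊢
    exact second_difference_nonneg Real.convexOn_log_Gamma hε p1 p2
  rw [log_Znorm hG he0 x hB, log_Znorm hG he0 x hB1, log_Znorm hG he0 x hB2]
  simp only [Finset.sum_add_distrib, Finset.sum_sub_distrib, ← Finset.mul_sum] at hE hV ⊢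
  linarith

end LogPartition

/-! ### The environment measure and the two divergences -/

section Divergence

lemma KL_withDensity {Ω : Type*} [MeasurableSpace Ω] (Q : Measure Ω) [SigmaFinite Q] {g : Ω → ℝ≥0∞}
    (hg : Measurable g) :
    KL (Q.withDensity g) Q = ((∫ x, Real.log (g x).toReal ∂(Q.withDensity g) : ℝ) : EReal) := by
  have hac := withDensity_absolutelyContinuous Q g
  rw [KL, if_pos hac]
  congr 1
  refine integral_congr_ae ?_
  filter_upwards [hac.ae_le (Measure.rnDeriv_withDensity Q hg)] with x hx
  rw [hx]

lemma discreteMeasure_singleton {Ω : Type*} [Fintype Ω] [MeasurableSpace Ω]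
    [MeasurableSingletonClass Ω] (p : Ω → ℝ) (x : Ω) :
    discreteMeasure p {x} = ENNReal.ofReal (p x) := by
  rw [discreteMeasure, Measure.finsetSum_apply, Finset.sum_eq_single x]
  · simp
  · intro y _ hy
    simp [hy]
  · simp

instance isFiniteMeasure_discreteMeasure {Ω : Type*} [Fintype Ω] [MeasurableSpace Ω] (p : Ω → ℝ) :
    IsFiniteMeasure (discreteMeasure p) := by
  refine ⟨?_⟩
  rw [discreteMeasure, Measure.finsetSum_apply]
  refine ENNReal.sum_lt_top.2 fun x _ => ?_
  simp

lemma KL_discreteMeasure {Ω : Type*} [Fintype Ω] [MeasurableSpace Ω] [MeasurableSingletonClass Ω]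
    {p q : Ω → ℝ} (hp : ∀ x, 0 ≤ p x) (hq : ∀ x, 0 ≤ q x) (hpq : ∀ x, q x = 0 → p x = 0) :
    KL (discreteMeasure p) (discreteMeasure q) =
      ((∑ x, p x * Real.log (p x / q x) : ℝ) : EReal) := by
  have e : discreteMeasure p =
      (discreteMeasure q).withDensity fun x => ENNReal.ofReal (p x / q x) := by
    refine Measure.ext_iff_singleton.2 fun x => ?_
    rw [withDensity_apply _ (measurableSet_singleton x), lintegral_singleton,
      discreteMeasure_singleton, discreteMeasure_singleton,
      ← ENNReal.ofReal_mul (div_nonneg (hp x) (hq x))]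
    by_cases h : q x = 0
    · simp [h, hpq x h]
    · rw [div_mul_cancel₀ _ h]
  have h := KL_withDensity (discreteMeasure q) (g := fun x => ENNReal.ofReal (p x / q x))
    (measurable_of_finite _)
  rw [← e] at h
  rw [h, integral_fintype Integrable.of_finite]
  congr 1
  refine Finset.sum_congr rfl fun x _ => ?_
  rw [measureReal_def, discreteMeasure_singleton, ENNReal.toReal_ofReal (hp x),
    ENNReal.toReal_ofReal (div_nonneg (hp x) (hq x)), smul_eq_mul]

lemma sum_mul_log_div_nonneg {Ω : Type*} [Fintype Ω] {p q : Ω → ℝ} (hp : ∀ x, 0 ≤ p x)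
    (hq : ∀ x, 0 ≤ q x) (hpq : ∀ x, q x = 0 → p x = 0) (hsum : ∑ x, p x = ∑ x, q x) :
    0 ≤ ∑ x, p x * Real.log (p x / q x) := by
  have h : ∑ x, (p x - q x) ≤ ∑ x, p x * Real.log (p x / q x) := by
    refine Finset.sum_le_sum fun x _ => ?_
    rcases (hp x).eq_or_lt with h0 | h0
    · simp [← h0, hq x]
    · have hq0 : 0 < q x := (hq x).lt_of_ne fun h => h0.ne' (hpq x h.symm)
      have h1 := Real.one_sub_inv_le_log_of_pos (div_pos h0 hq0)
      calc p x - q x = p x * (1 - (p x / q x)⁻¹) := by field_simp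
        _ ≤ _ := by gcongr
  rw [Finset.sum_sub_distrib, hsum, sub_self] at h
  exact h

end Divergence

section EnvMeasure

variable {G : SimpleGraph V} [DecidableRel G.Adj]

/-- The mixing measure in the coordinates of the non-reference edges. -/
def envMeasure (G : SimpleGraph V) [DecidableRel G.Adj] (e0 : Sym2 V) (x : V) (B : Sym2 V → ℝ) :
    Measure (Epin G e0 → ℝ) :=
  (orthant (Epin G e0)).withDensity fun u => ENNReal.ofReal (magicDensity G x B (pinExt G e0 u))

lemma measurable_pinExt (e0 : Sym2 V) : Measurable fun u : Epin G e0 → ℝ => pinExt G e0 u := by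
  simp_rw [pinExt_eq_edgeExt]
  exact measurable_edgeExt measurable_const measurable_id

lemma pinExt_pos {e0 : Sym2 V} (he0 : e0 ∈ G.edgeFinset) {u : Epin G e0 → ℝ} :
    (∀ e ∈ G.edgeFinset, 0 < pinExt G e0 u e) ↔ ∀ e, 0 < u e := by
  rw [pinExt_eq_edgeExt, forall_edgeExt_pos he0]
  simp

lemma measurable_magicDensity (x : V) (B : Sym2 V → ℝ) :
    Measurable fun w : Sym2 V → ℝ => magicDensity G x B w := by
  unfold magicDensity
  refine (((((measurable_vw x).pow_const _).const_mul _).mul ?_).div ?_).mul measurable_tau.sqrt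
  · exact Finset.measurable_prod _ fun e _ => (measurable_pi_apply e).pow_const _
  · exact Finset.measurable_prod _ fun v _ => (measurable_vw v).pow_const _

lemma mixing_eq_map {e0 : Sym2 V} (he0 : e0 ∈ G.edgeFinset) (x : V) (B : Sym2 V → ℝ) :
    mixing G e0 x B = (envMeasure G e0 x B).map (pinExt G e0) := by
  rw [mixing, envMeasure, orthant_eq_restrict, ← withDensity_indicator (measurableSet_orthant _)]
  congr 2
  funext u
  have hmem : u ∈ (Set.univ.pi fun _ => Set.Ioi (0 : ℝ)) ↔
      ∀ e ∈ G.edgeFinset, 0 < pinExt G e0 u e := by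
    rw [pinExt_pos he0]
    simp
  by_cases h : ∀ e ∈ G.edgeFinset, 0 < pinExt G e0 u e
  · rw [if_pos h, Set.indicator_of_mem (hmem.2 h)]
  · rw [if_neg h, Set.indicator_of_notMem (mt hmem.1 h), ENNReal.ofReal_zero]

lemma ae_envMeasure_pos {e0 : Sym2 V} (he0 : e0 ∈ G.edgeFinset) (x : V) (B : Sym2 V → ℝ) :
    ∀ᵐ u ∂envMeasure G e0 x B, ∀ e ∈ G.edgeFinset, 0 < pinExt G e0 u e :=
  (withDensity_absolutelyContinuous _ _).ae_le
    ((ae_orthant _).mono fun _ hu => (pinExt_pos he0).2 hu)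

lemma tau_pos (hG : G.Connected) {w : Sym2 V → ℝ} (hw : ∀ e ∈ G.edgeFinset, 0 < w e) :
    0 < tau G w := by
  refine Finset.sum_pos (fun F hF => Finset.prod_pos fun e he => ?_) ?_
  · rw [spanningTrees, Finset.mem_filter, Finset.mem_powerset] at hF
    exact hw e (hF.1 he)
  · obtain ⟨H, hH, hT⟩ := hG.exists_isTree_le
    refine ⟨H.edgeFinset, ?_⟩
    rw [spanningTrees, Finset.mem_filter, Finset.mem_powerset]
    refine ⟨SimpleGraph.edgeFinset_mono hH, ?_⟩
    rwa [SimpleGraph.coe_edgeFinset, SimpleGraph.fromEdgeSet_edgeSet]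

lemma rawDensity_pos (hG : G.Connected) {e0 : Sym2 V} (he0 : e0 ∈ G.edgeFinset) (x : V)
    (B : Sym2 V → ℝ) {w : Sym2 V → ℝ} (hw : ∀ e ∈ G.edgeFinset, 0 < w e) :
    0 < rawDensity G x B w := by
  have hv := vw_pos hG he0 hw
  rw [rawDensity_eq x B hv]
  have h1 := Finset.prod_pos fun e he => rpow_pos_of_pos (hw e he) (B e - 1)
  have h2 := Finset.prod_pos fun v (_ : v ∈ Finset.univ) => rpow_pos_of_pos (hv v) (-bwt G x B v)
  have h3 := Real.sqrt_pos.2 (tau_pos hG hw)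
  positivity

lemma magicDensity_pos (hG : G.Connected) {e0 : Sym2 V} (he0 : e0 ∈ G.edgeFinset) (x : V)
    {B w : Sym2 V → ℝ} (hB : ∀ e ∈ G.edgeFinset, 0 < B e) (hw : ∀ e ∈ G.edgeFinset, 0 < w e) :
    0 < magicDensity G x B w := by
  rw [magicDensity_eq]
  exact mul_pos (inv_pos.2 (Znorm_pos hG he0 x hB)) (rawDensity_pos hG he0 x B hw)

lemma lintegral_rawDensity_div (hG : G.Connected) {e0 : Sym2 V} (he0 : e0 ∈ G.edgeFinset) (x : V)
    {B : Sym2 V → ℝ} (hB : ∀ e ∈ G.edgeFinset, 0 < B e) {c : ℝ} (hc : 0 ≤ c) :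
    ∫⁻ u, ENNReal.ofReal (c * rawDensity G x B (pinExt G e0 u)) ∂orthant (Epin G e0) =
      ENNReal.ofReal (c * Znorm G x B) := by
  simp_rw [ENNReal.ofReal_mul hc]
  rw [lintegral_const_mul' _ _ ENNReal.ofReal_ne_top, lintegral_rawDensity hG he0 x hB]

lemma isProbabilityMeasure_envMeasure (hG : G.Connected) {e0 : Sym2 V} (he0 : e0 ∈ G.edgeFinset)
    (x : V) {B : Sym2 V → ℝ} (hB : ∀ e ∈ G.edgeFinset, 0 < B e) :
    IsProbabilityMeasure (envMeasure G e0 x B) := by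
  have hZ := Znorm_pos hG he0 x hB
  refine ⟨?_⟩
  rw [envMeasure, withDensity_apply _ MeasurableSet.univ, Measure.restrict_univ]
  simp_rw [magicDensity_eq]
  rw [lintegral_rawDensity_div hG he0 x hB (inv_nonneg.2 hZ.le), inv_mul_cancel₀ hZ.ne',
    ENNReal.ofReal_one]

lemma measurable_ofReal_magicDensity_div (x : V) (B C : Sym2 V → ℝ) :
    Measurable fun w => ENNReal.ofReal (magicDensity G x B w / magicDensity G x C w) :=
  ((measurable_magicDensity x B).div (measurable_magicDensity x C)).ennreal_ofReal

lemma envMeasure_withDensity (hG : G.Connected) {e0 : Sym2 V} (he0 : e0 ∈ G.edgeFinset) (x : V)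
    (B : Sym2 V → ℝ) {C : Sym2 V → ℝ} (hC : ∀ e ∈ G.edgeFinset, 0 < C e) :
    envMeasure G e0 x B = (envMeasure G e0 x C).withDensity fun u => ENNReal.ofReal
      (magicDensity G x B (pinExt G e0 u) / magicDensity G x C (pinExt G e0 u)) := by
  have h1 : Measurable fun u => ENNReal.ofReal (magicDensity G x C (pinExt G e0 u)) :=
    ((measurable_magicDensity x C).comp (measurable_pinExt e0)).ennreal_ofReal
  have h2 : Measurable fun u => ENNReal.ofReal
      (magicDensity G x B (pinExt G e0 u) / magicDensity G x C (pinExt G e0 u)) :=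
    (measurable_ofReal_magicDensity_div x B C).comp (measurable_pinExt e0)
  rw [envMeasure, envMeasure, ← withDensity_mul _ h1 h2]
  refine withDensity_congr_ae ?_
  filter_upwards [ae_orthant (Epin G e0)] with u hu
  have hm := magicDensity_pos hG he0 x hC ((pinExt_pos he0).2 hu)
  rw [Pi.mul_apply, ← ENNReal.ofReal_mul hm.le, mul_div_cancel₀ _ hm.ne']

lemma mixing_withDensity (hG : G.Connected) {e0 : Sym2 V} (he0 : e0 ∈ G.edgeFinset) (x : V)
    (B : Sym2 V → ℝ) {C : Sym2 V → ℝ} (hC : ∀ e ∈ G.edgeFinset, 0 < C e) :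
    mixing G e0 x B = (mixing G e0 x C).withDensity fun w => ENNReal.ofReal
      (magicDensity G x B w / magicDensity G x C w) := by
  rw [mixing_eq_map he0, mixing_eq_map he0, envMeasure_withDensity hG he0 x B hC]
  refine Measure.ext fun s hs => ?_
  rw [Measure.map_apply (measurable_pinExt e0) hs, withDensity_apply _ (measurable_pinExt e0 hs),
    withDensity_apply _ hs, setLIntegral_map hs (measurable_ofReal_magicDensity_div x B C)
      (measurable_pinExt e0)]

/-- The log-likelihood ratio of two environment measures. -/
def logRatio (G : SimpleGraph V) [DecidableRel G.Adj] (e0 : Sym2 V) (x : V) (B C : Sym2 V → ℝ)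
    (u : Epin G e0 → ℝ) : ℝ :=
  Real.log (magicDensity G x B (pinExt G e0 u) / magicDensity G x C (pinExt G e0 u))

lemma KL_mixing (hG : G.Connected) {e0 : Sym2 V} (he0 : e0 ∈ G.edgeFinset) (x : V)
    {B C : Sym2 V → ℝ} (hB : ∀ e ∈ G.edgeFinset, 0 < B e) (hC : ∀ e ∈ G.edgeFinset, 0 < C e) :
    KL (mixing G e0 x B) (mixing G e0 x C) =
      ((∫ u, logRatio G e0 x B C u ∂envMeasure G e0 x B : ℝ) : EReal) := by
  have hm := measurable_ofReal_magicDensity_div (G := G) x B C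
  have := isProbabilityMeasure_envMeasure hG he0 x hC
  have : IsProbabilityMeasure (mixing G e0 x C) := by
    rw [mixing_eq_map he0]
    exact Measure.isProbabilityMeasure_map (measurable_pinExt e0).aemeasurable
  have h := KL_withDensity (mixing G e0 x C) hm
  rw [← mixing_withDensity hG he0 x B hC] at h
  rw [h, mixing_eq_map he0, integral_map (measurable_pinExt e0).aemeasurable
    hm.ennreal_toReal.log.aestronglyMeasurable]
  congr 1
  refine integral_congr_ae ?_
  filter_upwards [ae_envMeasure_pos he0 x B] with u hu
  rw [logRatio, ENNReal.toReal_ofReal (div_nonneg (magicDensity_pos hG he0 x hB hu).le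
    (magicDensity_pos hG he0 x hC hu).le)]

end EnvMeasure

/-! ### The gap bound -/

section Gap

variable {G : SimpleGraph V} [DecidableRel G.Adj]

/-- Quenched path probability as a function of the environment coordinates. -/
def pathProb (G : SimpleGraph V) [DecidableRel G.Adj] (e0 : Sym2 V) (v0 : V) (T : ℕ)
    (x : Fin (T + 1) → V) (u : Epin G e0 → ℝ) : ℝ :=
  quenchedProb G v0 (pinExt G e0 u) T x

lemma measurable_pathProb (e0 : Sym2 V) (v0 : V) (T : ℕ) (x : Fin (T + 1) → V) :
    Measurable (pathProb G e0 v0 T x) :=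
  (measurable_quenchedProb v0 T x).comp (measurable_pinExt e0)

lemma pathProb_nonneg (hG : G.Connected) {e0 : Sym2 V} (he0 : e0 ∈ G.edgeFinset) (v0 : V) (T : ℕ)
    (x : Fin (T + 1) → V) {u : Epin G e0 → ℝ} (hu : ∀ e ∈ G.edgeFinset, 0 < pinExt G e0 u e) :
    0 ≤ pathProb G e0 v0 T x u :=
  quenchedProb_nonneg hu (vw_pos hG he0 hu) v0 T x

lemma ae_norm_pathProb_le (hG : G.Connected) {e0 : Sym2 V} (he0 : e0 ∈ G.edgeFinset)
    (v0 : V) (a : Sym2 V → ℝ) (T : ℕ) (x : Fin (T + 1) → V) :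
    ∀ᵐ u ∂envMeasure G e0 v0 a, ‖pathProb G e0 v0 T x u‖ ≤ 1 := by
  filter_upwards [ae_envMeasure_pos he0 v0 a] with u hu
  rw [Real.norm_of_nonneg (pathProb_nonneg hG he0 v0 T x hu)]
  exact quenchedProb_le_one hu (vw_pos hG he0 hu) v0 T x

lemma integrable_pathProb (hG : G.Connected) {e0 : Sym2 V} (he0 : e0 ∈ G.edgeFinset)
    (v0 : V) {a : Sym2 V → ℝ} (ha : ∀ e ∈ G.edgeFinset, 0 < a e) (T : ℕ) (x : Fin (T + 1) → V) :
    Integrable (pathProb G e0 v0 T x) (envMeasure G e0 v0 a) := by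
  have := isProbabilityMeasure_envMeasure hG he0 v0 ha
  exact Integrable.of_bound (measurable_pathProb e0 v0 T x).aestronglyMeasurable 1
    (ae_norm_pathProb_le hG he0 v0 a T x)

/-- The ERRW is the mixture of the quenched walks. -/
lemma integral_pathProb (hG : G.Connected) {e0 : Sym2 V} (he0 : e0 ∈ G.edgeFinset)
    (v0 : V) {a : Sym2 V → ℝ} (ha : ∀ e ∈ G.edgeFinset, 0 < a e) (T : ℕ) (x : Fin (T + 1) → V) :
    ∫ u, pathProb G e0 v0 T x u ∂envMeasure G e0 v0 a = errwProb G v0 a T x := by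
  by_cases hx : IsPathFrom G v0 x
  · have hZ := Znorm_pos hG he0 v0 ha
    have hZ' := Znorm_pos hG he0 (extendPath v0 x T) (localTime_pos ha (extendPath v0 x) T)
    have hm : Measurable fun u => ENNReal.ofReal (magicDensity G v0 a (pinExt G e0 u)) :=
      ((measurable_magicDensity v0 a).comp (measurable_pinExt e0)).ennreal_ofReal
    rw [integral_eq_lintegral_of_nonneg_ae
      ((ae_envMeasure_pos he0 v0 a).mono fun u hu => pathProb_nonneg hG he0 v0 T x hu)
      (measurable_pathProb e0 v0 T x).aestronglyMeasurable, envMeasure,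
      lintegral_withDensity_eq_lintegral_mul _ hm (measurable_pathProb e0 v0 T x).ennreal_ofReal,
      lintegral_congr_ae (g := fun u => ENNReal.ofReal ((Znorm G v0 a)⁻¹ *
        rawDensity G (extendPath v0 x T) (localTime a (extendPath v0 x) T) (pinExt G e0 u))),
      lintegral_rawDensity_div hG he0 _ (localTime_pos ha _ _) (inv_nonneg.2 hZ.le),
      errwProb_eq hG he0 ha hx, ENNReal.toReal_ofReal (by positivity), inv_mul_eq_div]
    filter_upwards [ae_orthant (Epin G e0)] with u hu
    have hw := (pinExt_pos he0).2 hu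
    rw [Pi.mul_apply, ← ENNReal.ofReal_mul (magicDensity_pos hG he0 v0 ha hw).le, pathProb,
      mul_comm, quenchedProb_mul_magicDensity hG he0 hw hx]
  · simp_rw [pathProb, quenchedProb_of_not_isPathFrom hx, errwProb_of_not_isPathFrom hx]
    simp

lemma sum_errwProb (hG : G.Connected) {e0 : Sym2 V} (he0 : e0 ∈ G.edgeFinset)
    (v0 : V) {a : Sym2 V → ℝ} (ha : ∀ e ∈ G.edgeFinset, 0 < a e) (T : ℕ) :
    ∑ x : Fin (T + 1) → V, errwProb G v0 a T x = 1 := by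
  have := isProbabilityMeasure_envMeasure hG he0 v0 ha
  simp_rw [← integral_pathProb hG he0 v0 ha T]
  rw [← integral_finsetSum _ fun x _ => integrable_pathProb hG he0 v0 ha T x,
    integral_congr_ae (g := fun _ => (1 : ℝ))]
  · simp
  · filter_upwards [ae_envMeasure_pos he0 v0 a] with u hu
    exact sum_quenchedProb (vw_pos hG he0 hu) v0 T

lemma integrable_pathProb_mul_ratio (hG : G.Connected) {e0 : Sym2 V} (he0 : e0 ∈ G.edgeFinset)
    (v0 : V) {B C : Sym2 V → ℝ} (hB : ∀ e ∈ G.edgeFinset, 0 < B e)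
    (hC : ∀ e ∈ G.edgeFinset, 0 < C e) (T : ℕ) (x : Fin (T + 1) → V) :
    Integrable (fun u => magicDensity G v0 B (pinExt G e0 u) / magicDensity G v0 C (pinExt G e0 u) *
        pathProb G e0 v0 T x u) (envMeasure G e0 v0 C) ∧
      ∫ u, magicDensity G v0 B (pinExt G e0 u) / magicDensity G v0 C (pinExt G e0 u) *
        pathProb G e0 v0 T x u ∂envMeasure G e0 v0 C = errwProb G v0 B T x := by
  have hm : Measurable fun u => ENNReal.ofReal
      (magicDensity G v0 B (pinExt G e0 u) / magicDensity G v0 C (pinExt G e0 u)) :=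
    (measurable_ofReal_magicDensity_div v0 B C).comp (measurable_pinExt e0)
  have hlt : ∀ᵐ u ∂envMeasure G e0 v0 C, ENNReal.ofReal
      (magicDensity G v0 B (pinExt G e0 u) / magicDensity G v0 C (pinExt G e0 u)) < ∞ :=
    ae_of_all _ fun _ => ENNReal.ofReal_lt_top
  have hae : (fun u => (ENNReal.ofReal (magicDensity G v0 B (pinExt G e0 u) /
      magicDensity G v0 C (pinExt G e0 u))).toReal • pathProb G e0 v0 T x u) =ᵐ[envMeasure G e0 v0 C]
      fun u => magicDensity G v0 B (pinExt G e0 u) / magicDensity G v0 C (pinExt G e0 u) *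
        pathProb G e0 v0 T x u := by
    filter_upwards [ae_envMeasure_pos he0 v0 C] with u hu
    rw [ENNReal.toReal_ofReal (div_nonneg (magicDensity_pos hG he0 v0 hB hu).le
      (magicDensity_pos hG he0 v0 hC hu).le), smul_eq_mul]
  have h1 := integrable_pathProb hG he0 v0 hB T x
  have h2 := integral_pathProb hG he0 v0 hB T x
  rw [envMeasure_withDensity hG he0 v0 B hC] at h1 h2
  rw [integrable_withDensity_iff_integrable_smul' hm hlt] at h1
  rw [integral_withDensity_eq_integral_toReal_smul hm hlt] at h2
  exact ⟨h1.congr hae, (integral_congr_ae hae).symm.trans h2⟩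

lemma log_rawDensity (hG : G.Connected) {e0 : Sym2 V} (he0 : e0 ∈ G.edgeFinset) (x : V)
    (B : Sym2 V → ℝ) {w : Sym2 V → ℝ} (hw : ∀ e ∈ G.edgeFinset, 0 < w e) :
    Real.log (rawDensity G x B w) = ∑ e ∈ G.edgeFinset, (B e - 1) * Real.log (w e) +
      Real.log √(tau G w) - ∑ v, bwt G x B v * Real.log (vw G w v) := by
  have hv := vw_pos hG he0 hw
  have h1 : ∀ e ∈ G.edgeFinset, w e ^ (B e - 1) ≠ 0 := fun e he =>
    (rpow_pos_of_pos (hw e he) _).ne'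
  have h2 : ∀ v ∈ Finset.univ, vw G w v ^ (-bwt G x B v) ≠ 0 := fun v _ =>
    (rpow_pos_of_pos (hv v) _).ne'
  have h3 := (Real.sqrt_pos.2 (tau_pos hG hw)).ne'
  have h4 := Finset.prod_ne_zero_iff.2 h1
  have h5 := Finset.prod_ne_zero_iff.2 h2
  rw [rawDensity_eq x B hv, Real.log_mul (mul_ne_zero h4 h3) h5, Real.log_mul h4 h3,
    Real.log_prod h1, Real.log_prod h2, sub_eq_add_neg, ← Finset.sum_neg_distrib]
  congr 2
  · exact Finset.sum_congr rfl fun e he => Real.log_rpow (hw e he) _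
  · funext v
    rw [Real.log_rpow (hv v), neg_mul]

/-- Extrapolation of initial weights from `B` to `C` backwards by `ε`. -/
def extrapolate (B C : Sym2 V → ℝ) (ε : ℝ) (e : Sym2 V) : ℝ := B e - ε * (C e - B e)

lemma log_rawDensity_extrapolate (hG : G.Connected) {e0 : Sym2 V} (he0 : e0 ∈ G.edgeFinset) (x : V)
    (B C : Sym2 V → ℝ) (ε : ℝ) {w : Sym2 V → ℝ} (hw : ∀ e ∈ G.edgeFinset, 0 < w e) :
    Real.log (rawDensity G x (extrapolate B C ε) w) = Real.log (rawDensity G x B w) -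
      ε * (Real.log (rawDensity G x C w) - Real.log (rawDensity G x B w)) := by
  have hb : ∀ v, bwt G x (extrapolate B C ε) v =
      bwt G x B v - ε * (bwt G x C v - bwt G x B v) := fun v => by
    simp only [bwt, vw, extrapolate, Finset.sum_sub_distrib, ← Finset.mul_sum]
    ring
  rw [log_rawDensity hG he0 x _ hw, log_rawDensity hG he0 x _ hw, log_rawDensity hG he0 x _ hw]
  have e1 : ∑ e ∈ G.edgeFinset, (extrapolate B C ε e - 1) * Real.log (w e) =
      ∑ e ∈ G.edgeFinset, (B e - 1) * Real.log (w e) -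
        ε * (∑ e ∈ G.edgeFinset, (C e - 1) * Real.log (w e) -
          ∑ e ∈ G.edgeFinset, (B e - 1) * Real.log (w e)) := by
    rw [← Finset.sum_sub_distrib, Finset.mul_sum, ← Finset.sum_sub_distrib]
    refine Finset.sum_congr rfl fun e _ => ?_
    unfold extrapolate
    ring
  have e2 : ∑ v, bwt G x (extrapolate B C ε) v * Real.log (vw G w v) =
      ∑ v, bwt G x B v * Real.log (vw G w v) -
        ε * (∑ v, bwt G x C v * Real.log (vw G w v) - ∑ v, bwt G x B v * Real.log (vw G w v)) := by
    rw [← Finset.sum_sub_distrib, Finset.mul_sum, ← Finset.sum_sub_distrib]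
    refine Finset.sum_congr rfl fun v _ => ?_
    rw [hb]
    ring
  rw [e1, e2]
  ring

lemma log_magicDensity_div (hG : G.Connected) {e0 : Sym2 V} (he0 : e0 ∈ G.edgeFinset) (x : V)
    {B C w : Sym2 V → ℝ} (hB : ∀ e ∈ G.edgeFinset, 0 < B e) (hC : ∀ e ∈ G.edgeFinset, 0 < C e)
    (hw : ∀ e ∈ G.edgeFinset, 0 < w e) :
    Real.log (magicDensity G x B w / magicDensity G x C w) =
      Real.log (rawDensity G x B w) - Real.log (rawDensity G x C w) -
        (Real.log (Znorm G x B) - Real.log (Znorm G x C)) := by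
  have h1 := (Znorm_pos hG he0 x hB).ne'
  have h2 := (Znorm_pos hG he0 x hC).ne'
  have h3 := (rawDensity_pos hG he0 x B hw).ne'
  have h4 := (rawDensity_pos hG he0 x C hw).ne'
  rw [Real.log_div (magicDensity_pos hG he0 x hB hw).ne' (magicDensity_pos hG he0 x hC hw).ne',
    magicDensity_eq, magicDensity_eq, Real.log_mul (inv_ne_zero h1) h3,
    Real.log_mul (inv_ne_zero h2) h4, Real.log_inv, Real.log_inv]
  ring

lemma mul_log_le {q y c : ℝ} (hq : 0 ≤ q) (hy : 0 < y) (hc : 0 < c) :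
    q * Real.log y ≤ q * (Real.log c - 1) + c⁻¹ * (y * q) := by
  have h := Real.log_le_sub_one_of_pos (div_pos hy hc)
  rw [Real.log_div hy.ne' hc.ne'] at h
  calc q * Real.log y ≤ q * (Real.log c - 1 + y / c) := by
        refine mul_le_mul_of_nonneg_left ?_ hq
        linarith
    _ = _ := by ring

/-- Contribution of a single path to the gap, before optimizing over `ε`. -/
lemma path_gap_extrapolate_le (hG : G.Connected) {e0 : Sym2 V} (he0 : e0 ∈ G.edgeFinset)
    {v0 : V} {B C : Sym2 V → ℝ} (hB : ∀ e ∈ G.edgeFinset, 0 < B e)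
    (hC : ∀ e ∈ G.edgeFinset, 0 < C e) {T : ℕ} {x : Fin (T + 1) → V} (hx : IsPathFrom G v0 x)
    (h_int : Integrable (logRatio G e0 v0 B C) (envMeasure G e0 v0 B)) {ε : ℝ}
    (hA : ∀ e ∈ G.edgeFinset, 0 < extrapolate B C ε e) :
    ε * (∫ u, pathProb G e0 v0 T x u * logRatio G e0 v0 B C u ∂envMeasure G e0 v0 B -
        errwProb G v0 B T x * Real.log (errwProb G v0 B T x / errwProb G v0 C T x)) ≤
      errwProb G v0 B T x *
        (Real.log (Znorm G (extendPath v0 x T)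
            (localTime (extrapolate B C ε) (extendPath v0 x) T)) -
          Real.log (Znorm G (extendPath v0 x T) (localTime B (extendPath v0 x) T)) +
          ε * (Real.log (Znorm G (extendPath v0 x T) (localTime C (extendPath v0 x) T)) -
            Real.log (Znorm G (extendPath v0 x T) (localTime B (extendPath v0 x) T)))) := by
  set A := extrapolate B C ε with hAdef
  have hlog : ∀ a : Sym2 V → ℝ, (∀ e ∈ G.edgeFinset, 0 < a e) → 0 < errwProb G v0 a T x ∧
      Real.log (errwProb G v0 a T x) =
        Real.log (Znorm G (extendPath v0 x T) (localTime a (extendPath v0 x) T)) -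
          Real.log (Znorm G v0 a) := fun a ha => by
    have h1 := Znorm_pos hG he0 v0 ha
    have h2 := Znorm_pos hG he0 (extendPath v0 x T) (localTime_pos ha (extendPath v0 x) T)
    rw [errwProb_eq hG he0 ha hx]
    exact ⟨div_pos h2 h1, Real.log_div h2.ne' h1.ne'⟩
  obtain ⟨pA, lA⟩ := hlog A hA
  obtain ⟨pB, lB⟩ := hlog B hB
  obtain ⟨pC, lC⟩ := hlog C hC
  obtain ⟨hri, hrv⟩ := integrable_pathProb_mul_ratio hG he0 v0 hA hB T x
  have hqi := integrable_pathProb hG he0 v0 hB T x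
  have hqv := integral_pathProb hG he0 v0 hB T x
  have hli := h_int.bdd_mul (measurable_pathProb e0 v0 T x).aestronglyMeasurable
    (ae_norm_pathProb_le hG he0 v0 B T x)
  set k := Real.log (Znorm G v0 B) - Real.log (Znorm G v0 A) +
    ε * (Real.log (Znorm G v0 B) - Real.log (Znorm G v0 C)) with hk
  set c := errwProb G v0 A T x / errwProb G v0 B T x with hc
  have hcpos : 0 < c := div_pos pA pB
  have hmono : ∫ u, (pathProb G e0 v0 T x u * k +
        ε * (pathProb G e0 v0 T x u * logRatio G e0 v0 B C u)) ∂envMeasure G e0 v0 B ≤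
      ∫ u, (pathProb G e0 v0 T x u * (Real.log c - 1) +
        c⁻¹ * (magicDensity G v0 A (pinExt G e0 u) / magicDensity G v0 B (pinExt G e0 u) *
          pathProb G e0 v0 T x u)) ∂envMeasure G e0 v0 B := by
    refine integral_mono_ae ((hqi.mul_const k).add (hli.const_mul ε))
      ((hqi.mul_const _).add (hri.const_mul _)) ?_
    filter_upwards [ae_envMeasure_pos he0 v0 B] with u hu
    have h1 := mul_log_le (pathProb_nonneg hG he0 v0 T x hu)
      (div_pos (magicDensity_pos hG he0 v0 hA hu) (magicDensity_pos hG he0 v0 hB hu)) hcpos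
    rw [log_magicDensity_div hG he0 v0 hA hB hu, hAdef,
      log_rawDensity_extrapolate hG he0 v0 B C ε hu, ← hAdef] at h1
    have h2 := log_magicDensity_div hG he0 v0 hB hC hu
    refine le_trans (le_of_eq ?_) h1
    rw [logRatio, h2, pathProb, hk]
    ring
  rw [integral_add (hqi.mul_const k) (hli.const_mul ε),
    integral_add (hqi.mul_const _) (hri.const_mul _), integral_mul_const, integral_mul_const,
    integral_const_mul, integral_const_mul, hqv, hrv, hc, inv_div, div_mul_cancel₀ _ pA.ne',
    Real.log_div pA.ne' pB.ne', hk] at hmono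
  rw [Real.log_div pB.ne' pC.ne']
  rw [lA, lB] at hmono
  rw [lB, lC]
  linarith

/-- Contribution of a single path to the gap. -/
lemma path_gap_le (hG : G.Connected) {e0 : Sym2 V} (he0 : e0 ∈ G.edgeFinset)
    {v0 : V} {B C : Sym2 V → ℝ} (hB : ∀ e ∈ G.edgeFinset, 0 < B e)
    (hC : ∀ e ∈ G.edgeFinset, 0 < C e) {T : ℕ} (x : Fin (T + 1) → V)
    (h_int : Integrable (logRatio G e0 v0 B C) (envMeasure G e0 v0 B)) {m : ℝ} (hm : 0 < m)
    (hmB : ∀ e ∈ G.edgeFinset, m ≤ B e) (hmC : ∀ e ∈ G.edgeFinset, m ≤ C e) :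
    ∫ u, pathProb G e0 v0 T x u * logRatio G e0 v0 B C u ∂envMeasure G e0 v0 B -
        errwProb G v0 B T x * Real.log (errwProb G v0 B T x / errwProb G v0 C T x) ≤
      errwProb G v0 B T x *
        ∑ e ∈ G.edgeFinset, (C e - B e) ^ 2 * curvBound (edgeCount v0 x e + m) / 2 := by
  by_cases hx : IsPathFrom G v0 x
  swap
  · simp_rw [pathProb, quenchedProb_of_not_isPathFrom hx, errwProb_of_not_isPathFrom hx]
    simp
  have hPB := errwProb_nonneg hG he0 hB v0 T x
  have hlim : Tendsto (fun ε : ℝ => errwProb G v0 B T x * ((1 + ε) * ∑ e ∈ G.edgeFinset,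
      (C e - B e) ^ 2 * curvBound (edgeCount v0 x e + m - ε * |C e - B e|) / 2))
      (nhdsWithin 0 (Set.Ioi 0)) (nhds (errwProb G v0 B T x *
        ∑ e ∈ G.edgeFinset, (C e - B e) ^ 2 * curvBound (edgeCount v0 x e + m) / 2)) := by
    have hcont : ContinuousAt (fun ε : ℝ => errwProb G v0 B T x * ((1 + ε) * ∑ e ∈ G.edgeFinset,
        (C e - B e) ^ 2 * curvBound (edgeCount v0 x e + m - ε * |C e - B e|) / 2)) 0 := by
      refine continuousAt_const.mul ((continuousAt_const.add continuousAt_id).mul ?_)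
      refine tendsto_finsetSum _ fun e _ => ?_
      have hne : (edgeCount v0 x e : ℝ) + m - 0 * |C e - B e| ≠ 0 := by
        rw [zero_mul, sub_zero]
        positivity
      have hl : ContinuousAt (fun ε : ℝ => (edgeCount v0 x e : ℝ) + m - ε * |C e - B e|) 0 := by
        fun_prop
      exact (continuousAt_const.mul ((continuousAt_const.div hl hne).add
        (continuousAt_const.div (hl.pow 2) (pow_ne_zero 2 hne)))).div_const 2
    have h := hcont.tendsto.mono_left (nhdsWithin_le_nhds (s := Set.Ioi 0))
    simpa using h
  refine ge_of_tendsto hlim ?_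
  have hsmall : ∀ᶠ ε in nhdsWithin (0 : ℝ) (Set.Ioi 0), ∀ e ∈ G.edgeFinset,
      ε * |C e - B e| < m := by
    rw [Filter.eventually_all_finset]
    intro e _
    have hc : ContinuousAt (fun ε : ℝ => ε * |C e - B e|) 0 := by fun_prop
    have := hc.tendsto.mono_left (nhdsWithin_le_nhds (s := Set.Ioi 0))
    exact this.eventually_lt_const (by simpa using hm)
  filter_upwards [hsmall, self_mem_nhdsWithin] with ε hεm hε
  have hε : 0 < ε := hε
  have habs : ∀ e, ε * (C e - B e) ≤ ε * |C e - B e| := fun e =>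
    mul_le_mul_of_nonneg_left (le_abs_self _) hε.le
  have hA : ∀ e ∈ G.edgeFinset, 0 < extrapolate B C ε e := fun e he => by
    have h1 := hεm e he
    have h2 := habs e
    have h3 := hmB e he
    unfold extrapolate
    linarith
  have h1 := path_gap_extrapolate_le hG he0 hB hC hx h_int hA
  have eA : localTime (extrapolate B C ε) (extendPath v0 x) T =
      fun e => localTime B (extendPath v0 x) T e - ε * (C e - B e) := by
    funext e
    simp only [localTime, extrapolate]
    ring
  have eC : localTime C (extendPath v0 x) T =
      fun e => localTime B (extendPath v0 x) T e + (C e - B e) := by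
    funext e
    simp only [localTime]
    ring
  have hlt : ∀ e, localTime B (extendPath v0 x) T e = B e + edgeCount v0 x e := fun e => rfl
  have h2 := log_Znorm_second_difference_le hG he0 (extendPath v0 x T)
    (B := localTime B (extendPath v0 x) T) (D := fun e => C e - B e)
    (m := fun e => edgeCount v0 x e + m - ε * |C e - B e|) hε
    (fun e he => by
      have h := hεm e he
      have : (0 : ℝ) ≤ edgeCount v0 x e := Nat.cast_nonneg _
      linarith)
    (localTime_pos hB _ _)
    (fun e he => by
      have h := mul_nonneg hε.le (abs_nonneg (C e - B e))
      have h3 := hmC e he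
      rw [hlt]
      linarith)
    (fun e he => by
      have h := habs e
      have h3 := hmB e he
      rw [hlt]
      linarith)
  rw [eA, eC] at h1
  have h3 := h1.trans (mul_le_mul_of_nonneg_left h2 hPB)
  rw [mul_assoc, mul_left_comm] at h3
  exact le_of_mul_le_mul_left h3 hε

lemma errwProb_eq_zero (hG : G.Connected) {e0 : Sym2 V} (he0 : e0 ∈ G.edgeFinset) {v0 : V}
    {B C : Sym2 V → ℝ} (hC : ∀ e ∈ G.edgeFinset, 0 < C e) {T : ℕ} {x : Fin (T + 1) → V}
    (h : errwProb G v0 C T x = 0) : errwProb G v0 B T x = 0 := by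
  refine errwProb_of_not_isPathFrom (fun hx => ?_) B
  rw [errwProb_eq hG he0 hC hx] at h
  exact (div_pos (Znorm_pos hG he0 _ (localTime_pos hC _ _)) (Znorm_pos hG he0 v0 hC)).ne' h

lemma KL_errw (hG : G.Connected) [MeasurableSpace V] [DiscreteMeasurableSpace V] {e0 : Sym2 V}
    (he0 : e0 ∈ G.edgeFinset) (v0 : V) {B C : Sym2 V → ℝ} (hB : ∀ e ∈ G.edgeFinset, 0 < B e)
    (hC : ∀ e ∈ G.edgeFinset, 0 < C e) (T : ℕ) :
    KL (discreteMeasure (errwProb G v0 B T)) (discreteMeasure (errwProb G v0 C T)) =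
      ((∑ x, errwProb G v0 B T x *
        Real.log (errwProb G v0 B T x / errwProb G v0 C T x) : ℝ) : EReal) :=
  KL_discreteMeasure (errwProb_nonneg hG he0 hB v0 T) (errwProb_nonneg hG he0 hC v0 T)
    fun _ h => errwProb_eq_zero hG he0 hC h

lemma gap_le (hG : G.Connected) {e0 : Sym2 V} (he0 : e0 ∈ G.edgeFinset) (v0 : V)
    {B C : Sym2 V → ℝ} (hB : ∀ e ∈ G.edgeFinset, 0 < B e) (hC : ∀ e ∈ G.edgeFinset, 0 < C e)
    (T : ℕ) {m : ℝ} (hm : 0 < m) (hmB : ∀ e ∈ G.edgeFinset, m ≤ B e)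
    (hmC : ∀ e ∈ G.edgeFinset, m ≤ C e) :
    ∫ u, logRatio G e0 v0 B C u ∂envMeasure G e0 v0 B -
        ∑ x : Fin (T + 1) → V, errwProb G v0 B T x *
          Real.log (errwProb G v0 B T x / errwProb G v0 C T x) ≤
      1 / 2 * ∑ e ∈ G.edgeFinset, (C e - B e) ^ 2 *
        ∑ x : Fin (T + 1) → V, errwProb G v0 B T x * curvBound (edgeCount v0 x e + m) := by
  have hP := errwProb_nonneg hG he0 hB v0 T
  have hκ : ∀ (x : Fin (T + 1) → V) e, 0 ≤ curvBound (edgeCount v0 x e + m) := fun x e =>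
    curvBound_nonneg (by positivity)
  by_cases h_int : Integrable (logRatio G e0 v0 B C) (envMeasure G e0 v0 B)
  · have hsplit : ∫ u, logRatio G e0 v0 B C u ∂envMeasure G e0 v0 B =
        ∑ x : Fin (T + 1) → V,
          ∫ u, pathProb G e0 v0 T x u * logRatio G e0 v0 B C u ∂envMeasure G e0 v0 B := by
      rw [← integral_finsetSum _ fun x _ => h_int.bdd_mul
        (measurable_pathProb e0 v0 T x).aestronglyMeasurable (ae_norm_pathProb_le hG he0 v0 B T x)]
      refine integral_congr_ae ?_
      filter_upwards [ae_envMeasure_pos he0 v0 B] with u hu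
      have h1 : ∑ x : Fin (T + 1) → V, pathProb G e0 v0 T x u = 1 :=
        sum_quenchedProb (vw_pos hG he0 hu) v0 T
      rw [← Finset.sum_mul, h1, one_mul]
    rw [hsplit, ← Finset.sum_sub_distrib]
    refine (Finset.sum_le_sum fun x _ => path_gap_le hG he0 hB hC x h_int hm hmB hmC).trans_eq ?_
    simp_rw [Finset.mul_sum]
    rw [Finset.sum_comm]
    refine Finset.sum_congr rfl fun e _ => Finset.sum_congr rfl fun x _ => ?_
    ring
  · rw [integral_undef h_int]
    have h1 := sum_mul_log_div_nonneg hP (errwProb_nonneg hG he0 hC v0 T)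
      (fun x h => errwProb_eq_zero hG he0 hC h)
      ((sum_errwProb hG he0 v0 hB T).trans (sum_errwProb hG he0 v0 hC T).symm)
    have h2 : 0 ≤ 1 / 2 * ∑ e ∈ G.edgeFinset, (C e - B e) ^ 2 *
        ∑ x : Fin (T + 1) → V, errwProb G v0 B T x * curvBound (edgeCount v0 x e + m) :=
      mul_nonneg (by norm_num) (Finset.sum_nonneg fun e _ => mul_nonneg (sq_nonneg _)
        (Finset.sum_nonneg fun x _ => mul_nonneg (hP x) (hκ x e)))
    linarith

end Gap

/-- General bounds on the trajectory-level KL gap.  With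
`Gap_T := D(μ_0‖μ_1) − D(P_0^{(T)}‖P_1^{(T)})`, `δ_e := a_e⁽¹⁾ − a_e⁽⁰⁾` and
`ā := min_e min{a_e⁽⁰⁾, a_e⁽¹⁾}`,
`Gap_T ≤ ½ Σ_e δ_e² E_{P_0^{(T)}}[1/(N_e+ā) + 1/(N_e+ā)²]` and consequently
`Gap_T ≤ ½(1+1/ā) Σ_e δ_e² E_{P_0^{(T)}}[1/(N_e+ā)]`. -/
theorem gap_general_bounds
    {V : Type*} [Fintype V] [DecidableEq V] [MeasurableSpace V] [DiscreteMeasurableSpace V]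
    (G : SimpleGraph V) [DecidableRel G.Adj] (hG : G.Connected)
    (v0 : V) (e0 : Sym2 V) (he0 : e0 ∈ G.edgeFinset)
    (a0 a1 : Sym2 V → ℝ)
    (ha0 : ∀ e ∈ G.edgeFinset, 0 < a0 e) (ha1 : ∀ e ∈ G.edgeFinset, 0 < a1 e)
    (T : ℕ) (hT : 1 ≤ T)
    (abar : ℝ) (habar : abar = G.edgeFinset.inf' ⟨e0, he0⟩ fun e => min (a0 e) (a1 e)) :
    KL (mixing G e0 v0 a0) (mixing G e0 v0 a1)
        - KL (discreteMeasure (errwProb G v0 a0 T)) (discreteMeasure (errwProb G v0 a1 T))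
      ≤ ((1 / 2 * ∑ e ∈ G.edgeFinset, (a1 e - a0 e) ^ 2 *
            ∑ x : Fin (T + 1) → V, errwProb G v0 a0 T x *
              (1 / ((edgeCount v0 x e : ℝ) + abar)
                + 1 / ((edgeCount v0 x e : ℝ) + abar) ^ 2) : ℝ) : EReal) ∧
    KL (mixing G e0 v0 a0) (mixing G e0 v0 a1)
        - KL (discreteMeasure (errwProb G v0 a0 T)) (discreteMeasure (errwProb G v0 a1 T))
      ≤ ((1 / 2 * (1 + 1 / abar) * ∑ e ∈ G.edgeFinset, (a1 e - a0 e) ^ 2 *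
            ∑ x : Fin (T + 1) → V, errwProb G v0 a0 T x *
              (1 / ((edgeCount v0 x e : ℝ) + abar)) : ℝ) : EReal) := by
  have hpos : 0 < abar := by
    rw [habar]
    exact (Finset.lt_inf'_iff _).2 fun e he => lt_min (ha0 e he) (ha1 e he)
  have hmin : ∀ e ∈ G.edgeFinset, abar ≤ min (a0 e) (a1 e) := fun e he => by
    rw [habar]
    exact Finset.inf'_le (fun e => min (a0 e) (a1 e)) he
  have h := gap_le hG he0 v0 ha0 ha1 T hpos (fun e he => (hmin e he).trans (min_le_left _ _))
    fun e he => (hmin e he).trans (min_le_right _ _)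
  rw [KL_mixing hG he0 v0 ha0 ha1, KL_errw hG he0 v0 ha0 ha1 T, ← EReal.coe_sub,
    EReal.coe_le_coe_iff, EReal.coe_le_coe_iff]
  refine ⟨h, h.trans ?_⟩
  rw [mul_assoc, Finset.mul_sum _ _ (1 + 1 / abar)]
  refine mul_le_mul_of_nonneg_left (Finset.sum_le_sum fun e _ => ?_) (by norm_num)
  rw [mul_left_comm (1 + 1 / abar), Finset.mul_sum _ _ (1 + 1 / abar)]
  refine mul_le_mul_of_nonneg_left (Finset.sum_le_sum fun x _ => ?_) (sq_nonneg _)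
  rw [mul_left_comm (1 + 1 / abar)]
  refine mul_le_mul_of_nonneg_left ?_ (errwProb_nonneg hG he0 ha0 v0 T x)
  have hN : abar ≤ (edgeCount v0 x e : ℝ) + abar := le_add_of_nonneg_left (Nat.cast_nonneg _)
  have hN0 := hpos.trans_le hN
  have h1 : 1 / ((edgeCount v0 x e : ℝ) + abar) ≤ 1 / abar := one_div_le_one_div_of_le hpos hN
  have h2 := mul_le_mul_of_nonneg_right h1 (one_div_pos.2 hN0).le
  calc curvBound ((edgeCount v0 x e : ℝ) + abar)
      = 1 / ((edgeCount v0 x e : ℝ) + abar) +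
          1 / ((edgeCount v0 x e : ℝ) + abar) * (1 / ((edgeCount v0 x e : ℝ) + abar)) := by
        rw [curvBound, sq, one_div_mul_one_div]
    _ ≤ _ := by linarith

end ERRW
end
end

section
/- For all real numbers p, q > 0: (i) Λ(p,q) = (q−p)² · ∫₀¹ (1−t) · Ψ₁(p + t(q−p)) dt, where Ψ₁ = Ψ′ is the trigamma function (the second derivative of log Γ); and (ii) Λ(p,q) ≤ ((q−p)²/2) · (1/m + 1/m²), where m := min(p,q). -/
open MeasureTheory Real Filter
open scoped ENNReal NNReal Classical BigOperators

noncomputable section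

namespace ERRW

variable {V : Type*} [Fintype V] [DecidableEq V]

lemma contDiffOn_log_Gamma {n : WithTop ℕ∞} :
    ContDiffOn ℝ n (fun x => Real.log (Real.Gamma x)) (Set.Ioi 0) := by
  intro x hx
  have hU : IsOpen {z : ℂ | 0 < z.re} := isOpen_lt continuous_const Complex.continuous_re
  have hΓ : DifferentiableOn ℂ Complex.Gamma {z : ℂ | 0 < z.re} := by
    refine fun z hz => (Complex.differentiableAt_Gamma z fun m hm => ?_).differentiableWithinAt
    have : 0 < z.re := hz
    rw [hm, Complex.neg_re, Complex.natCast_re] at this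
    linarith [Nat.cast_nonneg (α := ℝ) m]
  have hx' : (x : ℂ) ∈ {z : ℂ | 0 < z.re} := by simpa using hx
  have hA : ContDiffAt ℂ n Complex.Gamma x :=
    (hΓ.analyticAt (hU.mem_nhds hx')).contDiffAt
  have hR : ContDiffAt ℝ n Real.Gamma x := hA.real_of_complex
  exact (hR.log (Real.Gamma_pos_of_pos hx).ne').contDiffWithinAt

lemma contDiffOn_digamma {n : ℕ} : ContDiffOn ℝ n digamma (Set.Ioi 0) :=
  (contDiffOn_log_Gamma (n := n + 1)).deriv_of_isOpen isOpen_Ioi le_rfl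

lemma continuousOn_trigamma : ContinuousOn trigamma (Set.Ioi 0) :=
  (contDiffOn_digamma (n := 1)).continuousOn_deriv_of_isOpen isOpen_Ioi le_rfl

lemma hasDerivAt_log_Gamma {x : ℝ} (hx : 0 < x) :
    HasDerivAt (fun y => Real.log (Real.Gamma y)) (digamma x) x :=
  ((contDiffOn_log_Gamma (n := 1)).differentiableOn one_ne_zero |>.differentiableAt
    (Ioi_mem_nhds hx)).hasDerivAt

lemma hasDerivAt_digamma {x : ℝ} (hx : 0 < x) : HasDerivAt digamma (trigamma x) x :=
  ((contDiffOn_digamma (n := 1)).differentiableOn one_ne_zero |>.differentiableAt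
    (Ioi_mem_nhds hx)).hasDerivAt

lemma Lam_eq_integral {p q : ℝ} (hp : 0 < p) (hq : 0 < q) :
    Lam p q = (q - p) ^ 2 * ∫ t in (0 : ℝ)..1, (1 - t) * trigamma (p + t * (q - p)) := by
  have hpos : ∀ t ∈ Set.uIcc (0 : ℝ) 1, 0 < p + t * (q - p) := by
    intro t ht
    rw [Set.uIcc_of_le zero_le_one] at ht
    have h : 0 < (1 - t) • p + t • q :=
      convex_Ioi (0 : ℝ) hp hq (sub_nonneg.2 ht.2) ht.1 (sub_add_cancel 1 t)
    simp only [smul_eq_mul] at h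
    linarith
  have hderiv : ∀ t ∈ Set.uIcc (0 : ℝ) 1, HasDerivAt
      (fun t => (1 - t) * (q - p) * digamma (p + t * (q - p)) +
        Real.log (Real.Gamma (p + t * (q - p))))
      ((q - p) ^ 2 * ((1 - t) * trigamma (p + t * (q - p)))) t := by
    intro t ht
    have hl : HasDerivAt (fun t => p + t * (q - p)) (q - p) t := by
      simpa using ((hasDerivAt_id t).mul_const (q - p)).const_add p
    have hψ := (hasDerivAt_digamma (hpos t ht)).comp t hl
    have hΓ := (hasDerivAt_log_Gamma (hpos t ht)).comp t hl
    have h1 := (((hasDerivAt_id t).const_sub 1).mul_const (q - p)).mul hψ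
    refine (h1.add hΓ).congr_deriv ?_
    simp only [id, Function.comp_apply]
    ring
  have hcont : ContinuousOn (fun t => (q - p) ^ 2 * ((1 - t) * trigamma (p + t * (q - p))))
      (Set.uIcc 0 1) := by
    refine continuousOn_const.mul ((by fun_prop : ContinuousOn _ _).mul ?_)
    exact continuousOn_trigamma.comp (by fun_prop) hpos
  rw [← intervalIntegral.integral_const_mul,
    intervalIntegral.integral_eq_sub_of_hasDerivAt hderiv hcont.intervalIntegrable, Lam]
  simp only [sub_self, zero_mul, one_mul, sub_zero, add_zero, add_sub_cancel, zero_add]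
  ring

lemma sum_inv_add_sq_le {x : ℝ} (hx : 0 < x) (n : ℕ) :
    ∑ k ∈ Finset.range (n + 1), 1 / (x + k) ^ 2 ≤ 1 / x + 1 / x ^ 2 := by
  suffices h : ∑ k ∈ Finset.range (n + 1), 1 / (x + k) ^ 2 ≤
      1 / x + 1 / x ^ 2 - 1 / (x + n) from h.trans (sub_le_self _ (by positivity))
  induction n with
  | zero => simp
  | succ n ih =>
    rw [Finset.sum_range_succ]
    have hn : 0 < x + n := by positivity
    have key : 1 / (x + n + 1) ^ 2 ≤ 1 / (x + n) - 1 / (x + n + 1) := by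
      rw [div_sub_div _ _ (by positivity) (by positivity), div_le_div_iff₀ (by positivity)
        (by positivity)]
      nlinarith
    push_cast
    rw [← add_assoc]
    linarith

/-- The second derivative of `logGammaSeq · n` on `[m, ∞)` is at most `1/m + 1/m²`. -/
lemma convexOn_quadratic_sub_logGammaSeq {m : ℝ} (hm : 0 < m) (n : ℕ) :
    ConvexOn ℝ (Set.Ici m) fun x =>
      (1 / m + 1 / m ^ 2) / 2 * x ^ 2 - Real.BohrMollerup.logGammaSeq x n := by
  set C := 1 / m + 1 / m ^ 2 with hC
  have hpos : ∀ x ∈ Set.Ici m, ∀ k : ℕ, 0 < x + k := fun x hx k =>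
    add_pos_of_pos_of_nonneg (hm.trans_le hx) k.cast_nonneg
  have hf : ∀ x ∈ Set.Ici m, HasDerivAt
      (fun x => C / 2 * x ^ 2 - Real.BohrMollerup.logGammaSeq x n)
      (C * x - (Real.log n - ∑ k ∈ Finset.range (n + 1), 1 / (x + k))) x := by
    intro x hx
    have hs : HasDerivAt (fun x : ℝ => ∑ k ∈ Finset.range (n + 1), Real.log (x + k))
        (∑ k ∈ Finset.range (n + 1), 1 / (x + k)) x :=
      HasDerivAt.fun_sum fun k _ => ((hasDerivAt_id x).add_const _).log (hpos x hx k).ne'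
    have hl : HasDerivAt (fun x => Real.BohrMollerup.logGammaSeq x n)
        (Real.log n - ∑ k ∈ Finset.range (n + 1), 1 / (x + k)) x := by
      refine ((((hasDerivAt_id x).mul_const (Real.log n)).add_const
        (Real.log (n.factorial : ℝ))).sub hs).congr_deriv ?_
      rw [one_mul]
    refine (((hasDerivAt_pow 2 x).const_mul (C / 2)).sub hl).congr_deriv ?_
    push_cast
    ring
  have hf' : ∀ x ∈ Set.Ici m, HasDerivAt
      (fun x : ℝ => C * x - (Real.log n - ∑ k ∈ Finset.range (n + 1), 1 / (x + k)))
      (C - ∑ k ∈ Finset.range (n + 1), 1 / (x + k) ^ 2) x := by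
    intro x hx
    have hs : HasDerivAt (fun x : ℝ => ∑ k ∈ Finset.range (n + 1), 1 / (x + k))
        (∑ k ∈ Finset.range (n + 1), -(1 / (x + k) ^ 2)) x := by
      refine HasDerivAt.fun_sum fun k _ => ?_
      simpa [neg_div] using ((hasDerivAt_id x).add_const (k : ℝ)).fun_inv (hpos x hx k).ne'
    refine (((hasDerivAt_id x).const_mul C).sub (hs.const_sub (Real.log n))).congr_deriv ?_
    rw [Finset.sum_neg_distrib]
    ring
  refine convexOn_of_hasDerivWithinAt2_nonneg (convex_Ici m)
    (fun x hx => (hf x hx).continuousAt.continuousWithinAt)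
    (fun x hx => (hf x (interior_subset hx)).hasDerivWithinAt)
    (fun x hx => (hf' x (interior_subset hx)).hasDerivWithinAt) fun x hx => ?_
  have hx' : m ≤ x := interior_subset hx
  have hCx : 1 / x + 1 / x ^ 2 ≤ C := by rw [hC]; gcongr
  linarith [sum_inv_add_sq_le (hm.trans_le hx') n]

lemma convexOn_quadratic_sub_log_Gamma {m : ℝ} (hm : 0 < m) :
    ConvexOn ℝ (Set.Ici m) fun x =>
      (1 / m + 1 / m ^ 2) / 2 * x ^ 2 - Real.log (Real.Gamma x) := by
  refine ⟨convex_Ici m, fun x hx y hy a b ha hb hab => ?_⟩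
  have hlim : ∀ z ∈ Set.Ici m, Tendsto
      (fun n => (1 / m + 1 / m ^ 2) / 2 * z ^ 2 - Real.BohrMollerup.logGammaSeq z n) atTop
      (nhds ((1 / m + 1 / m ^ 2) / 2 * z ^ 2 - Real.log (Real.Gamma z))) := fun z hz =>
    tendsto_const_nhds.sub (Real.BohrMollerup.tendsto_log_gamma (hm.trans_le hz))
  exact le_of_tendsto_of_tendsto' (hlim _ (convex_Ici m hx hy ha hb hab))
    (((hlim x hx).const_smul a).add ((hlim y hy).const_smul b))
    fun n => (convexOn_quadratic_sub_logGammaSeq hm n).2 hx hy ha hb hab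

lemma Lam_le_of_le {m p q : ℝ} (hm : 0 < m) (hp : m ≤ p) (hq : m ≤ q) :
    Lam p q ≤ (q - p) ^ 2 / 2 * (1 / m + 1 / m ^ 2) := by
  have hconv := convexOn_quadratic_sub_log_Gamma hm
  set C := 1 / m + 1 / m ^ 2
  have hd : HasDerivAt (fun x => C / 2 * x ^ 2 - Real.log (Real.Gamma x))
      (C * p - digamma p) p := by
    refine (((hasDerivAt_pow 2 p).const_mul (C / 2)).sub
      (hasDerivAt_log_Gamma (hm.trans_le hp))).congr_deriv ?_
    push_cast
    ring
  have htangent : (C * p - digamma p) * (q - p) ≤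
      (C / 2 * q ^ 2 - Real.log (Real.Gamma q)) - (C / 2 * p ^ 2 - Real.log (Real.Gamma p)) := by
    rcases lt_trichotomy p q with h | rfl | h
    · have := hconv.le_slope_of_hasDerivAt hp hq h hd
      rwa [slope_def_field, le_div_iff₀ (sub_pos.2 h)] at this
    · simp
    · have := hconv.slope_le_of_hasDerivAt hq hp h hd
      rw [slope_def_field, div_le_iff₀ (sub_pos.2 h)] at this
      linarith
  rw [Lam]
  linarith

/-- For `p, q > 0`:
(i) `Λ(p,q) = (q−p)² ∫₀¹ (1−t) Ψ₁(p + t(q−p)) dt`, with `Ψ₁ = Ψ' = (log Γ)''` the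
trigamma function; and (ii) `Λ(p,q) ≤ ((q−p)²/2)(1/m + 1/m²)` with `m = min(p,q)`. -/
theorem Lam_integral_repr_and_bound (p q : ℝ) (hp : 0 < p) (hq : 0 < q) :
    Lam p q = (q - p) ^ 2 * ∫ t in (0 : ℝ)..1, (1 - t) * trigamma (p + t * (q - p)) ∧
    Lam p q ≤ (q - p) ^ 2 / 2 * (1 / min p q + 1 / min p q ^ 2) :=
  ⟨Lam_eq_integral hp hq, Lam_le_of_le (lt_min hp hq) (min_le_left p q) (min_le_right p q)⟩

end ERRW
end
end

section
/- Let T ≥ 2 be an integer, γ > 0, and c_γ := max{1, 1/γ}. For x ∈ [0,1] let g_T(x) := E[1/(K+γ)], where K has the binomial distribution with parameters T and x. Then g_T(x) ≤ c_γ for all x ∈ [0,1], and g_T(x) ≤ 6·c_γ/(T·x) for all x with 1/(2T) ≤ x ≤ 1. -/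
open MeasureTheory Real Filter
open scoped ENNReal NNReal Classical BigOperators

noncomputable section

namespace ERRW

variable {V : Type*} [Fintype V] [DecidableEq V]

/-- The binomial weights sum to one. -/
lemma sum_binomial_weights (T : ℕ) (x : ℝ) :
    ∑ k ∈ Finset.range (T + 1), (T.choose k : ℝ) * x ^ k * (1 - x) ^ (T - k) = 1 := by
  have h := add_pow x (1 - x) T
  rw [add_sub_cancel, one_pow] at h
  exact (Finset.sum_congr rfl fun k _ => by ring).trans h.symm

/-- The bound `E[1/(Bin(T,x)+1)] ≤ 1/((T+1)x)`, with the denominator cleared. -/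
lemma sum_binomial_weights_div_add_one_mul_le (T : ℕ) {x : ℝ} (hx : x ≤ 1) :
    (∑ k ∈ Finset.range (T + 1),
        (T.choose k : ℝ) * x ^ k * (1 - x) ^ (T - k) / ((k : ℝ) + 1)) * ((T + 1) * x) ≤ 1 := by
  have h := sum_binomial_weights (T + 1) x
  rw [Finset.sum_range_succ'] at h
  have h_first : 0 ≤ ((T + 1).choose 0 : ℝ) * x ^ 0 * (1 - x) ^ (T + 1 - 0) := by
    have := pow_nonneg (sub_nonneg.2 hx) (T + 1 - 0)
    simpa using this
  refine le_trans (le_of_eq ?_) (h ▸ le_add_of_nonneg_right h_first)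
  rw [Finset.sum_mul]
  refine Finset.sum_congr rfl fun k _ => ?_
  have h_choose : ((T : ℝ) + 1) * T.choose k = (T + 1).choose (k + 1) * (k + 1) := by
    exact_mod_cast Nat.add_one_mul_choose_eq T k
  have hk : (k : ℝ) + 1 ≠ 0 := by positivity
  rw [Nat.add_sub_add_right, div_mul_eq_mul_div, div_eq_iff hk, pow_succ]
  linear_combination x ^ k * x * (1 - x) ^ (T - k) * h_choose

lemma one_div_natCast_add_le_max (k : ℕ) {γ : ℝ} (hγ : 0 < γ) :
    1 / ((k : ℝ) + γ) ≤ max 1 (1 / γ) :=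
  le_max_of_le_right <| one_div_le_one_div_of_le hγ (le_add_of_nonneg_left k.cast_nonneg)

lemma one_div_natCast_add_le_max_div (k : ℕ) {γ : ℝ} (hγ : 0 < γ) :
    1 / ((k : ℝ) + γ) ≤ 2 * max 1 (1 / γ) / ((k : ℝ) + 1) := by
  have h_max : 1 ≤ max 1 (1 / γ) := le_max_left _ _
  rcases k.eq_zero_or_pos with rfl | hk
  · have := one_div_natCast_add_le_max 0 hγ
    rw [Nat.cast_zero, zero_add] at this ⊢
    rw [zero_add, div_one]
    linarith
  · have hk' : (1 : ℝ) ≤ k := by exact_mod_cast hk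
    rw [div_le_div_iff₀ (by positivity) (by positivity)]
    nlinarith

/-- Upper bounds for the binomial inverse moment.  For an integer
`T ≥ 2`, `γ > 0`, `c_γ = max{1, 1/γ}` and `g_T(x) = E[1/(Bin(T,x)+γ)]`,
one has `g_T(x) ≤ c_γ` for all `x ∈ [0,1]`, and `g_T(x) ≤ 6 c_γ/(T x)` for
`1/(2T) ≤ x ≤ 1`. -/
theorem binomial_inverse_moment (T : ℕ) (hT : 2 ≤ T) (γ : ℝ) (hγ : 0 < γ) :
    (∀ x : ℝ, 0 ≤ x → x ≤ 1 →
      (∑ k ∈ Finset.range (T + 1),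
          (T.choose k : ℝ) * x ^ k * (1 - x) ^ (T - k) / ((k : ℝ) + γ))
        ≤ max 1 (1 / γ)) ∧
    (∀ x : ℝ, 1 / (2 * T) ≤ x → x ≤ 1 →
      (∑ k ∈ Finset.range (T + 1),
          (T.choose k : ℝ) * x ^ k * (1 - x) ^ (T - k) / ((k : ℝ) + γ))
        ≤ 6 * max 1 (1 / γ) / (T * x)) := by
  constructor
  · intro x hx0 hx1
    have hx1' : 0 ≤ 1 - x := sub_nonneg.2 hx1
    calc
      _ ≤ ∑ k ∈ Finset.range (T + 1),
            (T.choose k : ℝ) * x ^ k * (1 - x) ^ (T - k) * max 1 (1 / γ) := by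
        refine Finset.sum_le_sum fun k _ => ?_
        rw [div_eq_mul_one_div]
        exact mul_le_mul_of_nonneg_left (one_div_natCast_add_le_max k hγ) (by positivity)
      _ = max 1 (1 / γ) := by rw [← Finset.sum_mul, sum_binomial_weights, one_mul]
  · intro x hx hx1
    have hT' : (0 : ℝ) < T := by exact_mod_cast (by lia : 0 < T)
    have hx0 : 0 < x := lt_of_lt_of_le (by positivity) hx
    have hx1' : 0 ≤ 1 - x := sub_nonneg.2 hx1
    set S := ∑ k ∈ Finset.range (T + 1),
      (T.choose k : ℝ) * x ^ k * (1 - x) ^ (T - k) / ((k : ℝ) + 1)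
    have hS0 : 0 ≤ S := Finset.sum_nonneg fun k _ => by positivity
    have hS_le : S * (T * x) ≤ 1 :=
      le_trans (by gcongr; linarith) (sum_binomial_weights_div_add_one_mul_le T hx1)
    calc
      _ ≤ ∑ k ∈ Finset.range (T + 1), 2 * max 1 (1 / γ) *
            ((T.choose k : ℝ) * x ^ k * (1 - x) ^ (T - k) / ((k : ℝ) + 1)) := by
        refine Finset.sum_le_sum fun k _ => ?_
        rw [div_eq_mul_one_div]
        refine (mul_le_mul_of_nonneg_left (one_div_natCast_add_le_max_div k hγ)
          (by positivity)).trans_eq (by ring)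
      _ = 2 * max 1 (1 / γ) * S := by rw [← Finset.mul_sum]
      _ ≤ 6 * max 1 (1 / γ) / (T * x) := by
        have h_max : 0 < max 1 (1 / γ) := lt_max_of_lt_left one_pos
        rw [le_div_iff₀ (by positivity)]
        nlinarith

end ERRW
end
end
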